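/- As T → ∞, ∫₁ᵀ |ζ(1/2+it)|⁴ dt = (1/(2π²))·T·(log T)⁴ + O(T·(log T)³). -/

import Mathlib

open MeasureTheory Filter Real

namespace InghamFourthMoment

/-- Comparison of weighted sums by partial summation. -/
theorem sum_mul_le_sum_mul_of_partial_sums {a b f : ℕ → ℝ}
    (hf : ∀ k, 1 ≤ k → f (k + 1) ≤ f k) (hf0 : ∀ k, 1 ≤ k → 0 ≤ f k)
    (hab : ∀ K, 1 ≤ K → ∑ k ∈ Finset.Icc 1 K, a k ≤ ∑ k ∈ Finset.Icc 1 K, b k) (M : ℕ) :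
    ∑ k ∈ Finset.Icc 1 M, a k * f k ≤ ∑ k ∈ Finset.Icc 1 M, b k * f k := by
  have key : ∀ (c : ℕ → ℝ) (M : ℕ), ∑ k ∈ Finset.Icc 1 M, c k * f k
      = (∑ k ∈ Finset.Icc 1 M, c k) * f (M + 1)
        + ∑ j ∈ Finset.Icc 1 M, (∑ k ∈ Finset.Icc 1 j, c k) * (f j - f (j + 1)) := by
    intro c M
    induction M with
    | zero => simp
    | succ n ih =>
      rw [Finset.sum_Icc_succ_top (by omega), ih, Finset.sum_Icc_succ_top (by omega),
        Finset.sum_Icc_succ_top (by omega), Finset.sum_Icc_succ_top (by omega)]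
      ring
  rw [key, key]
  rcases Nat.eq_zero_or_pos M with rfl | hM
  · simp
  refine add_le_add (mul_le_mul_of_nonneg_right (hab M hM) (hf0 _ (by omega))) ?_
  refine Finset.sum_le_sum fun j hj => ?_
  have hj1 := (Finset.mem_Icc.mp hj).1
  exact mul_le_mul_of_nonneg_right (hab j hj1) (sub_nonneg.mpr (hf j hj1))

theorem sum_rpow_neg_three_quarters_le (N : ℕ) :
    ∑ k ∈ Finset.Icc 1 N, (k : ℝ) ^ (-(3 / 4) : ℝ) ≤ 4 * (N : ℝ) ^ (1 / 4 : ℝ) := by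
  induction N with
  | zero => simp
  | succ n ih =>
    rw [Finset.sum_Icc_succ_top (by omega)]
    have hn : (0 : ℝ) < (n + 1 : ℕ) := by positivity
    set y : ℝ := ((n + 1 : ℕ) : ℝ) ^ (1 / 4 : ℝ) with hy
    set x : ℝ := ((n : ℕ) : ℝ) ^ (1 / 4 : ℝ) with hx
    have hy0 : 0 < y := by positivity
    have hx0 : 0 ≤ x := by positivity
    have hy4 : y ^ 4 = n + 1 := by
      rw [hy, ← Real.rpow_natCast, ← Real.rpow_mul hn.le]; norm_num
    have hx4 : x ^ 4 = n := by
      rw [hx, ← Real.rpow_natCast, ← Real.rpow_mul (by positivity)]; norm_num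
    have h3 : ((n + 1 : ℕ) : ℝ) ^ (-(3 / 4) : ℝ) = (y ^ 3)⁻¹ := by
      rw [hy, ← Real.rpow_natCast, ← Real.rpow_mul hn.le, ← Real.rpow_neg hn.le]; norm_num
    rw [h3]
    have hxy : x ≤ y := by
      rw [hx, hy]; gcongr; simp
    have : (y ^ 3)⁻¹ ≤ 4 * (y - x) := by
      rw [inv_le_iff_one_le_mul₀ (by positivity)]
      have : 1 = y ^ 4 - x ^ 4 := by rw [hy4, hx4]; ring
      rw [this]
      have e : y ^ 4 - x ^ 4 = (y - x) * (y ^ 3 + y ^ 2 * x + y * x ^ 2 + x ^ 3) := by ring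
      rw [e]
      have h1 : y ^ 2 * x ≤ y ^ 3 := by nlinarith [sq_nonneg y]
      have h2 : y * x ^ 2 ≤ y ^ 3 := by
        have : x ^ 2 ≤ y ^ 2 := by gcongr
        nlinarith
      have h3 : x ^ 3 ≤ y ^ 3 := by gcongr
      nlinarith [sub_nonneg.mpr hxy]
    linarith

theorem rpow_neg_five_quarters_le (k : ℕ) (hk : 1 ≤ k) :
    ((k : ℝ) + 1) ^ (-(5 / 4) : ℝ) ≤
      4 * ((k : ℝ) ^ (-(1 / 4) : ℝ) - ((k : ℝ) + 1) ^ (-(1 / 4) : ℝ)) := by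
  have hk0 : (0 : ℝ) < k := by positivity
  set y : ℝ := ((k : ℝ) + 1) ^ (1 / 4 : ℝ) with hy
  set x : ℝ := (k : ℝ) ^ (1 / 4 : ℝ) with hx
  have hy0 : 0 < y := by positivity
  have hx0 : 0 < x := by positivity
  have hy4 : y ^ 4 = k + 1 := by
    rw [hy, ← Real.rpow_natCast, ← Real.rpow_mul (by positivity)]; norm_num
  have hx4 : x ^ 4 = k := by
    rw [hx, ← Real.rpow_natCast, ← Real.rpow_mul (by positivity)]; norm_num
  have h5 : ((k : ℝ) + 1) ^ (-(5 / 4) : ℝ) = (y ^ 5)⁻¹ := by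
    rw [hy, ← Real.rpow_natCast, ← Real.rpow_mul (by positivity), ← Real.rpow_neg (by positivity)]
    norm_num
  have h1 : (k : ℝ) ^ (-(1 / 4) : ℝ) = x⁻¹ := by
    rw [hx, ← Real.rpow_neg hk0.le]
  have h2 : ((k : ℝ) + 1) ^ (-(1 / 4) : ℝ) = y⁻¹ := by
    rw [hy, ← Real.rpow_neg (by positivity)]
  rw [h5, h1, h2]
  have hxy : x ≤ y := by
    rw [hx, hy]; gcongr; simp
  have e : 4 * (x⁻¹ - y⁻¹) = 4 * (y - x) / (x * y) := by field_simp
  rw [e, inv_eq_one_div, div_le_div_iff₀ (by positivity) (by positivity)]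
  have h1 : 1 = (y - x) * (y ^ 3 + y ^ 2 * x + y * x ^ 2 + x ^ 3) := by
    have : 1 = y ^ 4 - x ^ 4 := by rw [hy4, hx4]; ring
    rw [this]; ring
  have hb : y ^ 3 + y ^ 2 * x + y * x ^ 2 + x ^ 3 ≤ 4 * y ^ 3 := by
    have h1 : y ^ 2 * x ≤ y ^ 3 := by nlinarith [sq_nonneg y]
    have h2 : y * x ^ 2 ≤ y ^ 3 := by
      have : x ^ 2 ≤ y ^ 2 := by gcongr
      nlinarith
    have h3 : x ^ 3 ≤ y ^ 3 := by gcongr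
    linarith
  have hd : 0 ≤ y - x := by linarith
  calc 1 * (x * y) = (y - x) * (y ^ 3 + y ^ 2 * x + y * x ^ 2 + x ^ 3) * (x * y) := by
        rw [← h1]
    _ ≤ (y - x) * (4 * y ^ 3) * (y * y) := by gcongr
    _ = 4 * (y - x) * y ^ 5 := by ring

/-- The weight used to truncate Dirichlet series at height `X`. -/
noncomputable def cutoff (X : ℝ) (k : ℝ) : ℝ :=
  min ((X / k) ^ (3 / 4 : ℝ)) ((X / k) ^ (3 / 2 : ℝ))

theorem sum_rpow_five_quarters_tail_le (N M : ℕ) (hN : 1 ≤ N) :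
    ∑ k ∈ Finset.Icc (N + 1) M, (k : ℝ) ^ (-(5 / 4) : ℝ) ≤ 4 * (N : ℝ) ^ (-(1 / 4) : ℝ) := by
  rcases le_or_gt M N with h | h
  · rw [Finset.Icc_eq_empty (by omega)]; simp; positivity
  have : ∀ M, N ≤ M → ∑ k ∈ Finset.Icc (N + 1) M, (k : ℝ) ^ (-(5 / 4) : ℝ)
      ≤ 4 * ((N : ℝ) ^ (-(1 / 4) : ℝ) - (M : ℝ) ^ (-(1 / 4) : ℝ)) := by
    intro M hM
    induction M, hM using Nat.le_induction with
    | base => simp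
    | succ n hn ih =>
      rw [Finset.sum_Icc_succ_top (by omega)]
      have := rpow_neg_five_quarters_le n (by omega)
      push_cast
      linarith
  have h1 := this M h.le
  have : 0 ≤ (M : ℝ) ^ (-(1 / 4) : ℝ) := by positivity
  linarith

theorem one_add_log_pow_three_le {y : ℝ} (hy : 1 ≤ y) :
    (1 + Real.log y) ^ 3 ≤ 1728 * y ^ (1 / 4 : ℝ) := by
  have h0 : 0 ≤ Real.log y := Real.log_nonneg hy
  have hy0 : 0 < y := by linarith
  have h1 : 1 + Real.log y ≤ 12 * y ^ (1 / 12 : ℝ) := by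
    have := Real.log_le_sub_one_of_pos (x := y ^ (1 / 12 : ℝ)) (by positivity)
    rw [Real.log_rpow hy0] at this
    linarith
  calc (1 + Real.log y) ^ 3 ≤ (12 * y ^ (1 / 12 : ℝ)) ^ 3 := by gcongr
    _ = 1728 * y ^ (1 / 4 : ℝ) := by
      rw [mul_pow, ← Real.rpow_natCast, ← Real.rpow_natCast, ← Real.rpow_mul hy0.le]; norm_num

theorem sum_rpow_quarter_ge (K : ℕ) (hK : 1 ≤ K) :
    (K : ℝ) * (K : ℝ) ^ (1 / 4 : ℝ) ≤ 2 * ∑ k ∈ Finset.Icc 1 K, (k : ℝ) ^ (1 / 4 : ℝ) := by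
  have hK0 : (0 : ℝ) < K := by positivity
  have h1 : ∀ k ∈ Finset.Icc 1 K, (k : ℝ) * (K : ℝ) ^ (-(3 / 4) : ℝ) ≤ (k : ℝ) ^ (1 / 4 : ℝ) := by
    intro k hk
    have hk1 := Finset.mem_Icc.mp hk
    have hk0 : (0 : ℝ) < k := by exact_mod_cast hk1.1
    have : (k : ℝ) ^ (1 / 4 : ℝ) = k * (k : ℝ) ^ (-(3 / 4) : ℝ) := by
      nth_rw 2 [← Real.rpow_one (k : ℝ)]
      rw [← Real.rpow_add hk0]; norm_num
    rw [this]
    refine mul_le_mul_of_nonneg_left ?_ hk0.le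
    exact Real.rpow_le_rpow_of_nonpos hk0 (by exact_mod_cast hk1.2) (by norm_num)
  have h2 := Finset.sum_le_sum h1
  rw [← Finset.sum_mul] at h2
  have h3 : ∀ K : ℕ, ∑ k ∈ Finset.Icc 1 K, (k : ℝ) = K * (K + 1) / 2 := by
    intro K
    induction K with
    | zero => simp
    | succ n ih => rw [Finset.sum_Icc_succ_top (by omega), ih]; push_cast; ring
  rw [h3] at h2
  have h4 : (K : ℝ) ^ (1 / 4 : ℝ) = K * (K : ℝ) ^ (-(3 / 4) : ℝ) := by
    nth_rw 2 [← Real.rpow_one (K : ℝ)]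
    rw [← Real.rpow_add hK0]; norm_num
  rw [h4]
  have : 0 ≤ (K : ℝ) ^ (-(3 / 4) : ℝ) := by positivity
  nlinarith

theorem cutoff_nonneg {X k : ℝ} (hX : 0 ≤ X) (hk : 0 ≤ k) : 0 ≤ cutoff X k := by
  unfold cutoff; positivity

theorem cutoff_anti {X k l : ℝ} (hX : 0 ≤ X) (hk : 0 < k) (hkl : k ≤ l) :
    cutoff X l ≤ cutoff X k := by
  have hl : 0 < l := hk.trans_le hkl
  have : 0 ≤ X / l := by positivity
  unfold cutoff
  gcongr

/-- Sums of nonnegative sequences with average order `(log k) ^ 3` against the cutoff. -/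
theorem sum_mul_cutoff_le {a : ℕ → ℝ} {B : ℝ} (hB : 0 ≤ B)
    (h : ∀ K : ℕ, 1 ≤ K → ∑ k ∈ Finset.Icc 1 K, a k ≤ B * K * (1 + Real.log K) ^ 3)
    {X : ℝ} (hX : 1 ≤ X) (M : ℕ) :
    ∑ k ∈ Finset.Icc 1 M, a k * cutoff X k ≤ 41484 * B * X * (1 + Real.log X) ^ 3 := by
  have hX0 : 0 < X := by linarith
  have hlX : 0 ≤ Real.log X := Real.log_nonneg hX
  set c : ℝ := B * (1 + Real.log X) ^ 3 with hc
  have hc0 : 0 ≤ c := by positivity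
  set b : ℕ → ℝ := fun k => c * (1 + 3456 * ((k : ℝ) / X) ^ (1 / 4 : ℝ)) with hb
  have hab : ∀ K, 1 ≤ K → ∑ k ∈ Finset.Icc 1 K, a k ≤ ∑ k ∈ Finset.Icc 1 K, b k := by
    intro K hK
    have hK0 : (0 : ℝ) < K := by positivity
    have hK1 : (1 : ℝ) ≤ K := by exact_mod_cast hK
    have hlK : 0 ≤ Real.log K := Real.log_nonneg hK1
    refine (h K hK).trans ?_
    have hsum : ∑ k ∈ Finset.Icc 1 K, b k
        = c * (K + 3456 * X ^ (-(1 / 4) : ℝ) * ∑ k ∈ Finset.Icc 1 K, (k : ℝ) ^ (1 / 4 : ℝ)) := by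
      rw [hb, ← Finset.mul_sum, Finset.sum_add_distrib]
      congr 2
      · simp
      · rw [Finset.mul_sum]
        refine Finset.sum_congr rfl fun k _ => ?_
        rw [Real.div_rpow (by positivity) hX0.le, Real.rpow_neg hX0.le]
        ring
    rw [hsum]
    have hq := sum_rpow_quarter_ge K hK
    rcases le_total (K : ℝ) X with hKX | hKX
    · have h1 : (1 + Real.log K) ^ 3 ≤ (1 + Real.log X) ^ 3 := by
        gcongr
      have h2 : 0 ≤ 3456 * X ^ (-(1 / 4) : ℝ) * ∑ k ∈ Finset.Icc 1 K, (k : ℝ) ^ (1 / 4 : ℝ) := by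
        positivity
      calc B * K * (1 + Real.log K) ^ 3 ≤ B * K * (1 + Real.log X) ^ 3 := by gcongr
        _ = c * K := by rw [hc]; ring
        _ ≤ _ := by gcongr; linarith
    · have hy : 1 ≤ (K : ℝ) / X := by rwa [one_le_div hX0]
      have h1 : 1 + Real.log K ≤ (1 + Real.log X) * (1 + Real.log (K / X)) := by
        have e : Real.log K = Real.log X + Real.log (K / X) := by
          rw [Real.log_div hK0.ne' hX0.ne']; ring
        have := Real.log_nonneg hy
        rw [e]; nlinarith
      have h2 : (1 + Real.log K) ^ 3 ≤ (1 + Real.log X) ^ 3 * (1728 * ((K : ℝ) / X) ^ (1 / 4 : ℝ)) := by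
        calc (1 + Real.log K) ^ 3 ≤ ((1 + Real.log X) * (1 + Real.log (K / X))) ^ 3 := by gcongr
          _ = (1 + Real.log X) ^ 3 * (1 + Real.log (K / X)) ^ 3 := by ring
          _ ≤ _ := by gcongr; exact one_add_log_pow_three_le hy
      calc B * K * (1 + Real.log K) ^ 3
          ≤ B * K * ((1 + Real.log X) ^ 3 * (1728 * ((K : ℝ) / X) ^ (1 / 4 : ℝ))) := by gcongr
        _ = c * (1728 * X ^ (-(1 / 4) : ℝ) * (K * (K : ℝ) ^ (1 / 4 : ℝ))) := by
          rw [hc, Real.div_rpow (by positivity) hX0.le, Real.rpow_neg hX0.le]; ring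
        _ ≤ c * (1728 * X ^ (-(1 / 4) : ℝ) * (2 * ∑ k ∈ Finset.Icc 1 K, (k : ℝ) ^ (1 / 4 : ℝ))) := by
          gcongr
        _ = c * (0 + 3456 * X ^ (-(1 / 4) : ℝ) * ∑ k ∈ Finset.Icc 1 K, (k : ℝ) ^ (1 / 4 : ℝ)) := by
          ring
        _ ≤ _ := by gcongr
  have hcmp := sum_mul_le_sum_mul_of_partial_sums (a := a) (b := b) (f := fun k => cutoff X k)
    (fun k hk => cutoff_anti hX0.le (by positivity) (by push_cast; linarith))
    (fun k hk => cutoff_nonneg hX0.le (by positivity)) hab M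
  refine hcmp.trans ?_
  set N := ⌊X⌋₊ with hN
  have hN1 : 1 ≤ N := Nat.one_le_floor_iff X |>.mpr hX
  have hNX : (N : ℝ) ≤ X := Nat.floor_le hX0.le
  have hXN : X < N + 1 := Nat.lt_floor_add_one X
  have hpt : ∀ k ∈ Finset.Icc 1 M, b k * cutoff X k ≤ 3457 * c *
      (if k ≤ N then X ^ (3 / 4 : ℝ) * (k : ℝ) ^ (-(3 / 4) : ℝ)
        else X ^ (5 / 4 : ℝ) * (k : ℝ) ^ (-(5 / 4) : ℝ)) := by
    intro k hk
    have hk1 := (Finset.mem_Icc.mp hk).1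
    have hk0 : (0 : ℝ) < k := by positivity
    split_ifs with hkN
    · have hkX : (k : ℝ) ≤ X := le_trans (by exact_mod_cast hkN) hNX
      have h1 : ((k : ℝ) / X) ^ (1 / 4 : ℝ) ≤ 1 :=
        Real.rpow_le_one (by positivity) (by rwa [div_le_one hX0]) (by norm_num)
      have h2 : cutoff X k ≤ X ^ (3 / 4 : ℝ) * (k : ℝ) ^ (-(3 / 4) : ℝ) := by
        refine (min_le_left _ _).trans (le_of_eq ?_)
        rw [Real.div_rpow hX0.le hk0.le, Real.rpow_neg hk0.le]; rfl
      have h3 : b k ≤ 3457 * c := by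
        simp only [hb]; nlinarith
      exact mul_le_mul h3 h2 (cutoff_nonneg hX0.le hk0.le) (by positivity)
    · have hkX : X ≤ (k : ℝ) := by
        have : N + 1 ≤ k := by omega
        have : ((N : ℝ) + 1) ≤ k := by exact_mod_cast this
        linarith
      have h1 : 1 ≤ ((k : ℝ) / X) ^ (1 / 4 : ℝ) :=
        Real.one_le_rpow (by rwa [one_le_div hX0]) (by norm_num)
      have h3 : b k ≤ 3457 * c * ((k : ℝ) / X) ^ (1 / 4 : ℝ) := by
        simp only [hb]; nlinarith
      have h2 : cutoff X k ≤ (X / k) ^ (3 / 2 : ℝ) := min_le_right _ _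
      calc b k * cutoff X k
          ≤ (3457 * c * ((k : ℝ) / X) ^ (1 / 4 : ℝ)) * (X / k) ^ (3 / 2 : ℝ) :=
            mul_le_mul h3 h2 (cutoff_nonneg hX0.le hk0.le) (by positivity)
        _ = 3457 * c * ((X / k) ^ (5 / 4 : ℝ)) := by
          have : ((k : ℝ) / X) ^ (1 / 4 : ℝ) = (X / k) ^ (-(1 / 4) : ℝ) := by
            rw [Real.rpow_neg (by positivity), ← Real.inv_rpow (by positivity), inv_div]
          rw [this, mul_assoc, ← Real.rpow_add (by positivity)]; norm_num
        _ = _ := by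
          rw [Real.div_rpow hX0.le hk0.le, Real.rpow_neg hk0.le]; rfl
  refine (Finset.sum_le_sum hpt).trans ?_
  rw [← Finset.mul_sum]
  have hsplit : ∑ k ∈ Finset.Icc 1 M, (if k ≤ N then X ^ (3 / 4 : ℝ) * (k : ℝ) ^ (-(3 / 4) : ℝ)
        else X ^ (5 / 4 : ℝ) * (k : ℝ) ^ (-(5 / 4) : ℝ)) ≤ 12 * X := by
    rw [Finset.sum_ite]
    have s1 : ∑ k ∈ (Finset.Icc 1 M).filter (fun k => k ≤ N),
        X ^ (3 / 4 : ℝ) * (k : ℝ) ^ (-(3 / 4) : ℝ) ≤ 4 * X := by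
      rw [← Finset.mul_sum]
      have : ∑ k ∈ (Finset.Icc 1 M).filter (fun k => k ≤ N), (k : ℝ) ^ (-(3 / 4) : ℝ)
          ≤ ∑ k ∈ Finset.Icc 1 N, (k : ℝ) ^ (-(3 / 4) : ℝ) := by
        refine Finset.sum_le_sum_of_subset_of_nonneg ?_ fun _ _ _ => by positivity
        intro k hk
        simp only [Finset.mem_filter, Finset.mem_Icc] at hk ⊢
        omega
      calc _ ≤ X ^ (3 / 4 : ℝ) * (4 * (N : ℝ) ^ (1 / 4 : ℝ)) := by
            gcongr
            exact this.trans (sum_rpow_neg_three_quarters_le N)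
        _ ≤ X ^ (3 / 4 : ℝ) * (4 * X ^ (1 / 4 : ℝ)) := by gcongr
        _ = 4 * (X ^ (3 / 4 : ℝ) * X ^ (1 / 4 : ℝ)) := by ring
        _ = 4 * X := by rw [← Real.rpow_add hX0]; norm_num
    have s2 : ∑ k ∈ (Finset.Icc 1 M).filter (fun k => ¬ k ≤ N),
        X ^ (5 / 4 : ℝ) * (k : ℝ) ^ (-(5 / 4) : ℝ) ≤ 8 * X := by
      rw [← Finset.mul_sum]
      have : ∑ k ∈ (Finset.Icc 1 M).filter (fun k => ¬ k ≤ N), (k : ℝ) ^ (-(5 / 4) : ℝ)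
          ≤ ∑ k ∈ Finset.Icc (N + 1) M, (k : ℝ) ^ (-(5 / 4) : ℝ) := by
        refine Finset.sum_le_sum_of_subset_of_nonneg ?_ fun _ _ _ => by positivity
        intro k hk
        simp only [Finset.mem_filter, Finset.mem_Icc] at hk ⊢
        omega
      have hN2 : (N : ℝ) ^ (-(1 / 4) : ℝ) ≤ 2 * X ^ (-(1 / 4) : ℝ) := by
        have hN0 : (0 : ℝ) < N := by exact_mod_cast hN1
        have hN1' : (1 : ℝ) ≤ N := by exact_mod_cast hN1
        rw [Real.rpow_neg hN0.le, Real.rpow_neg hX0.le, ← div_eq_mul_inv, inv_eq_one_div,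
          div_le_div_iff₀ (by positivity) (by positivity)]
        have : X ^ (1 / 4 : ℝ) ≤ (16 * N) ^ (1 / 4 : ℝ) := by
          gcongr; linarith
        rw [Real.mul_rpow (by norm_num) hN0.le] at this
        have h16 : (16 : ℝ) ^ (1 / 4 : ℝ) = 2 := by
          rw [show (16 : ℝ) = 2 ^ (4 : ℝ) by norm_num, ← Real.rpow_mul (by norm_num)]; norm_num
        rw [h16] at this
        linarith
      calc _ ≤ X ^ (5 / 4 : ℝ) * (4 * (N : ℝ) ^ (-(1 / 4) : ℝ)) := by
            gcongr
            exact this.trans (sum_rpow_five_quarters_tail_le N M hN1)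
        _ ≤ X ^ (5 / 4 : ℝ) * (4 * (2 * X ^ (-(1 / 4) : ℝ))) := by gcongr
        _ = 8 * (X ^ (5 / 4 : ℝ) * X ^ (-(1 / 4) : ℝ)) := by ring
        _ = 8 * X := by rw [← Real.rpow_add hX0]; norm_num
    linarith
  calc 3457 * c * _ ≤ 3457 * c * (12 * X) := by gcongr
    _ = 41484 * B * X * (1 + Real.log X) ^ 3 := by rw [hc]; ring

open ArithmeticFunction in
/-- The `k`-fold divisor function with real values. -/
noncomputable def divisorFun (k : ℕ) : ArithmeticFunction ℝ :=
  (ArithmeticFunction.zeta : ArithmeticFunction ℝ) ^ k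

/-- The square of the divisor function. -/
noncomputable def divisorSq : ArithmeticFunction ℝ :=
  (divisorFun 2).pmul (divisorFun 2)

open Classical in
/-- The arithmetic function `k ^ 2 ↦ μ k`, supported on squares. -/
noncomputable def moebiusSqrt : ArithmeticFunction ℝ :=
  ⟨fun n => if IsSquare n then (ArithmeticFunction.moebius (Nat.sqrt n) : ℝ) else 0, by simp⟩

theorem moebiusSqrt_sq (k : ℕ) : moebiusSqrt (k ^ 2) = ArithmeticFunction.moebius k := by
  have : IsSquare (k ^ 2) := ⟨k, by ring⟩
  simp [moebiusSqrt, this, Nat.sqrt_eq']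

theorem moebiusSqrt_of_not_isSquare {n : ℕ} (h : ¬ IsSquare n) : moebiusSqrt n = 0 := by
  simp [moebiusSqrt, h]

theorem isMultiplicative_divisorFun (k : ℕ) : (divisorFun k).IsMultiplicative := by
  unfold divisorFun
  induction k with
  | zero => simp
  | succ n ih =>
    rw [pow_succ]
    exact ih.mul ArithmeticFunction.isMultiplicative_zeta.natCast

theorem divisorFun_succ (k : ℕ) :
    divisorFun (k + 1) = divisorFun k * (ArithmeticFunction.zeta : ArithmeticFunction ℝ) := by
  unfold divisorFun; rw [pow_succ]

theorem divisorFun_succ_apply (k n : ℕ) :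
    divisorFun (k + 1) n = ∑ i ∈ n.divisors, divisorFun k i := by
  rw [divisorFun_succ, ArithmeticFunction.coe_mul_zeta_apply]

theorem divisorFun_one_apply {n : ℕ} (hn : n ≠ 0) : divisorFun 1 n = 1 := by
  simp [divisorFun, hn]

theorem divisorFun_two_apply (n : ℕ) : divisorFun 2 n = n.divisors.card := by
  rw [divisorFun_succ_apply, Finset.sum_congr rfl
    (fun i hi => divisorFun_one_apply (Nat.pos_of_mem_divisors hi).ne')]
  simp

theorem divisorFun_nonneg (k n : ℕ) : 0 ≤ divisorFun k n := by
  induction k generalizing n with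
  | zero =>
    simp only [divisorFun, pow_zero, ArithmeticFunction.one_apply]
    split_ifs <;> norm_num
  | succ k ih =>
    rw [divisorFun_succ_apply]
    exact Finset.sum_nonneg fun i _ => ih i

theorem divisorFun_two_prime_pow {p : ℕ} (hp : p.Prime) (k : ℕ) :
    divisorFun 2 (p ^ k) = k + 1 := by
  rw [divisorFun_two_apply, Nat.divisors_prime_pow hp]; simp

theorem divisorFun_three_prime_pow {p : ℕ} (hp : p.Prime) (k : ℕ) :
    divisorFun 3 (p ^ k) = (k + 1) * (k + 2) / 2 := by
  rw [divisorFun_succ_apply, Nat.sum_divisors_prime_pow hp]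
  simp_rw [divisorFun_two_prime_pow hp]
  induction k with
  | zero => simp
  | succ n ih => rw [Finset.sum_range_succ, ih]; push_cast; ring

theorem divisorFun_four_prime_pow {p : ℕ} (hp : p.Prime) (k : ℕ) :
    divisorFun 4 (p ^ k) = (k + 1) * (k + 2) * (k + 3) / 6 := by
  rw [divisorFun_succ_apply, Nat.sum_divisors_prime_pow hp]
  simp_rw [divisorFun_three_prime_pow hp]
  induction k with
  | zero => norm_num
  | succ n ih => rw [Finset.sum_range_succ, ih]; push_cast; ring

theorem isMultiplicative_divisorSq : divisorSq.IsMultiplicative :=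
  (isMultiplicative_divisorFun 2).pmul (isMultiplicative_divisorFun 2)

theorem divisorSq_apply (n : ℕ) : divisorSq n = (divisorFun 2 n) ^ 2 := by
  simp [divisorSq, sq]

theorem divisorSq_le_divisorFun_four (n : ℕ) : divisorSq n ≤ divisorFun 4 n := by
  rcases eq_or_ne n 0 with rfl | hn
  · simp
  rw [isMultiplicative_divisorSq.multiplicative_factorization _ hn,
    (isMultiplicative_divisorFun 4).multiplicative_factorization _ hn]
  refine Finset.prod_le_prod (fun p _ => ?_) (fun p hp => ?_)
  · simp only [divisorSq_apply]; positivity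
  · have hp' : p.Prime := Nat.prime_of_mem_primeFactors (by simpa using hp)
    simp only [divisorSq_apply, divisorFun_two_prime_pow hp', divisorFun_four_prime_pow hp']
    rcases Nat.eq_zero_or_pos (n.factorization p) with h0 | h0
    · rw [h0]; norm_num
    · have hk : (1 : ℝ) ≤ n.factorization p := by exact_mod_cast h0
      set k : ℝ := (n.factorization p : ℝ)
      have hk' : 0 ≤ (k + 1) * (k * (k - 1)) :=
        mul_nonneg (by linarith) (mul_nonneg (by linarith) (by linarith))
      nlinarith [hk']

theorem isMultiplicative_moebiusSqrt : moebiusSqrt.IsMultiplicative := by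
  refine ⟨?_, ?_⟩
  · have := moebiusSqrt_sq 1
    simpa using this
  · intro m n hmn
    by_cases h : IsSquare (m * n)
    · obtain ⟨k, hk⟩ := h
      have hk' : m * n = k ^ 2 := by rw [hk, sq]
      obtain ⟨a, ha⟩ : ∃ a, m = a ^ 2 := 
        exists_eq_pow_of_mul_eq_pow (Nat.isUnit_iff.2 hmn) hk'
      obtain ⟨b, hb⟩ : ∃ b, n = b ^ 2 := 
        exists_eq_pow_of_mul_eq_pow (Nat.isUnit_iff.2 hmn.symm) (by rw [mul_comm]; exact hk')
      subst ha hb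
      have hab : a.Coprime b := by
        rwa [Nat.coprime_pow_left_iff (by norm_num), Nat.coprime_pow_right_iff (by norm_num)] at hmn
      rw [← mul_pow, moebiusSqrt_sq, moebiusSqrt_sq, moebiusSqrt_sq,
        ArithmeticFunction.isMultiplicative_moebius.map_mul_of_coprime hab]
      push_cast; rfl
    · rw [moebiusSqrt_of_not_isSquare h]
      by_cases hm : IsSquare m
      · have hn : ¬ IsSquare n := fun hn => h (hm.mul hn)
        rw [moebiusSqrt_of_not_isSquare hn, mul_zero]
      · rw [moebiusSqrt_of_not_isSquare hm, zero_mul]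

theorem moebiusSqrt_prime_pow {p : ℕ} (hp : p.Prime) (k : ℕ) :
    moebiusSqrt (p ^ k) = if k = 0 then 1 else if k = 2 then -1 else 0 := by
  rcases Nat.even_or_odd' k with ⟨j, rfl | rfl⟩
  · rw [mul_comm, pow_mul, moebiusSqrt_sq]
    rcases Nat.lt_or_ge j 2 with h | h
    · interval_cases j
      · simp
      · simp [ArithmeticFunction.moebius_apply_prime hp]
    · rw [ArithmeticFunction.moebius_apply_prime_pow hp (by omega)]
      rw [if_neg (by omega), if_neg (by omega), if_neg (by omega)]; simp
  · rw [if_neg (by omega), if_neg (by omega)]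
    apply moebiusSqrt_of_not_isSquare
    rintro ⟨r, hr⟩
    have h1 := congrArg (fun n => n.factorization p) hr
    have hr0 : r ≠ 0 := by
      rintro rfl
      simp [hp.ne_zero] at hr
    simp only [Nat.factorization_mul hr0 hr0, hp.factorization_pow, Finsupp.add_apply,
      Finsupp.single_eq_same] at h1
    omega

theorem moebiusSqrt_mul_divisorFun_four : moebiusSqrt * divisorFun 4 = divisorSq := by
  rw [ArithmeticFunction.IsMultiplicative.eq_iff_eq_on_prime_powers _
    (isMultiplicative_moebiusSqrt.mul (isMultiplicative_divisorFun 4)) _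
    isMultiplicative_divisorSq]
  intro p k hp
  rw [ArithmeticFunction.mul_apply, Nat.sum_divisorsAntidiagonal
    (f := fun a b => moebiusSqrt a * divisorFun 4 b), Nat.sum_divisors_prime_pow hp,
    divisorSq_apply, divisorFun_two_prime_pow hp]
  have h1 : ∀ j ∈ Finset.range (k + 1), moebiusSqrt (p ^ j) * divisorFun 4 (p ^ k / p ^ j)
      = (if j = 0 then 1 else if j = 2 then -1 else 0) *
        ((((k - j : ℕ) : ℝ) + 1) * (((k - j : ℕ) : ℝ) + 2) * (((k - j : ℕ) : ℝ) + 3) / 6) := by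
    intro j hj
    have hj' : j ≤ k := by simpa [Nat.lt_succ_iff] using hj
    rw [moebiusSqrt_prime_pow hp, Nat.pow_div hj' hp.pos, divisorFun_four_prime_pow hp]
  rw [Finset.sum_congr rfl h1]
  match k with
  | 0 => norm_num
  | 1 => norm_num [Finset.sum_range_succ]
  | n + 2 =>
    rw [Finset.sum_range_succ', Finset.sum_range_succ', Finset.sum_range_succ']
    have : ∑ i ∈ Finset.range n, (if i + 1 + 1 + 1 = 0 then (1 : ℝ) else if i + 1 + 1 + 1 = 2 then -1 else 0)
        * ((((n + 2 - (i + 1 + 1 + 1) : ℕ) : ℝ) + 1) * (((n + 2 - (i + 1 + 1 + 1) : ℕ) : ℝ) + 2)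
          * (((n + 2 - (i + 1 + 1 + 1) : ℕ) : ℝ) + 3) / 6) = 0 := by
      refine Finset.sum_eq_zero fun i _ => ?_
      rw [if_neg (by omega), if_neg (by omega), zero_mul]
    rw [this]
    norm_num
    ring

/-- The arithmetic function `n ↦ f n / n`. -/
noncomputable def overId (f : ArithmeticFunction ℝ) : ArithmeticFunction ℝ :=
  ⟨fun n => f n / n, by simp⟩

theorem overId_apply (f : ArithmeticFunction ℝ) (n : ℕ) : overId f n = f n / n := rfl

theorem overId_mul (f g : ArithmeticFunction ℝ) : overId (f * g) = overId f * overId g := by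
  ext n
  rw [overId_apply, ArithmeticFunction.mul_apply, ArithmeticFunction.mul_apply, Finset.sum_div]
  refine Finset.sum_congr rfl fun p hp => ?_
  rw [overId_apply, overId_apply, ← (Nat.mem_divisorsAntidiagonal.1 hp).1]
  push_cast
  rw [div_mul_div_comm]

theorem sum_mul_div_floor (f g : ArithmeticFunction ℝ) (x : ℝ) :
    ∑ n ∈ Finset.Ioc 0 ⌊x⌋₊, (f * g) n / n =
      ∑ m ∈ Finset.Ioc 0 ⌊x⌋₊, f m / m * ∑ l ∈ Finset.Ioc 0 ⌊x / m⌋₊, g l / l := by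
  have h := ArithmeticFunction.sum_Ioc_mul_eq_sum_sum (overId f) (overId g) ⌊x⌋₊
  rw [← overId_mul] at h
  simp only [overId_apply] at h
  rw [h]
  refine Finset.sum_congr rfl fun m _ => ?_
  rw [Nat.floor_div_natCast]

/-- The logarithmic summatory function of the `k`-fold divisor function. -/
noncomputable def divisorSum (k : ℕ) (x : ℝ) : ℝ :=
  ∑ n ∈ Finset.Ioc 0 ⌊x⌋₊, divisorFun k n / n

theorem divisorSum_of_lt_one (k : ℕ) {x : ℝ} (hx : x < 1) : divisorSum k x = 0 := by
  rw [divisorSum, Nat.floor_eq_zero.2 hx]; simp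

theorem divisorSum_succ (k : ℕ) (x : ℝ) :
    divisorSum (k + 1) x = ∑ m ∈ Finset.Ioc 0 ⌊x⌋₊, (1 : ℝ) / m * divisorSum k (x / m) := by
  rw [divisorSum, divisorFun_succ, mul_comm, sum_mul_div_floor]
  refine Finset.sum_congr rfl fun m hm => ?_
  have : m ≠ 0 := by simp at hm; omega
  simp [divisorSum, this]

theorem sum_one_div_floor_le {x : ℝ} (hx : 1 ≤ x) :
    ∑ m ∈ Finset.Ioc 0 ⌊x⌋₊, (1 : ℝ) / m ≤ 1 + Real.log x := by
  have h := harmonic_floor_le_one_add_log x hx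
  rw [harmonic_eq_sum_Icc] at h
  push_cast at h
  have hIcc : Finset.Icc 1 ⌊x⌋₊ = Finset.Ioc 0 ⌊x⌋₊ := by ext; simp [Nat.succ_le_iff]
  rw [hIcc] at h
  simpa [one_div] using h

theorem mem_Ioc_floor {x : ℝ} {m : ℕ} (hx : 0 ≤ x) (hm : m ∈ Finset.Ioc 0 ⌊x⌋₊) :
    (1 : ℝ) ≤ m ∧ (m : ℝ) ≤ x ∧ 1 ≤ x / m := by
  rw [Finset.mem_Ioc] at hm
  have h1 : (1 : ℝ) ≤ m := by exact_mod_cast hm.1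
  have h2 : (m : ℝ) ≤ x := (Nat.le_floor_iff hx).1 hm.2
  exact ⟨h1, h2, (one_le_div (by linarith)).2 h2⟩

theorem divisorSum_le (k : ℕ) {x : ℝ} (hx : 1 ≤ x) :
    divisorSum k x ≤ (1 + Real.log x) ^ k := by
  induction k generalizing x with
  | zero =>
    rw [divisorSum, pow_zero]
    rw [Finset.sum_eq_single 1]
    · simp [divisorFun]
    · intro b _ hb
      simp [divisorFun, ArithmeticFunction.one_apply_ne hb]
    · intro h
      exact absurd (Finset.mem_Ioc.2 ⟨one_pos, Nat.le_floor (by simpa using hx)⟩) h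
  | succ k ih =>
    have hL : 0 ≤ Real.log x := Real.log_nonneg hx
    rw [divisorSum_succ]
    calc ∑ m ∈ Finset.Ioc 0 ⌊x⌋₊, (1 : ℝ) / m * divisorSum k (x / m)
        ≤ ∑ m ∈ Finset.Ioc 0 ⌊x⌋₊, (1 : ℝ) / m * (1 + Real.log x) ^ k := by
          refine Finset.sum_le_sum fun m hm => ?_
          obtain ⟨h1, h2, h3⟩ := mem_Ioc_floor (by linarith) hm
          refine mul_le_mul_of_nonneg_left ((ih h3).trans ?_) (by positivity)
          have : x / m ≤ x := div_le_self (by linarith) h1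
          have h4 : 0 ≤ Real.log (x / m) := Real.log_nonneg h3
          gcongr
      _ ≤ (1 + Real.log x) ^ (k + 1) := by
          rw [← Finset.sum_mul, pow_succ, mul_comm]
          exact mul_le_mul_of_nonneg_left (sum_one_div_floor_le hx) (by positivity)

theorem sum_divisorFun_four_le (N : ℕ) (hN : 1 ≤ N) :
    ∑ n ∈ Finset.Icc 1 N, divisorFun 4 n ≤ N * (1 + Real.log N) ^ 3 := by
  have hIcc : Finset.Icc 1 N = Finset.Ioc 0 N := by ext; simp [Nat.succ_le_iff]
  rw [hIcc, divisorFun_succ, ArithmeticFunction.sum_Ioc_mul_zeta_eq_sum]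
  have hN' : (1 : ℝ) ≤ N := by exact_mod_cast hN
  have h3 := divisorSum_le 3 hN'
  rw [divisorSum, Nat.floor_natCast] at h3
  refine le_trans ?_ (mul_le_mul_of_nonneg_left h3 (by positivity))
  rw [Finset.mul_sum]
  refine Finset.sum_le_sum fun n _ => ?_
  have : ((N / n : ℕ) : ℝ) ≤ N / n := Nat.cast_div_le
  calc divisorFun 3 n * ((N / n : ℕ) : ℝ) ≤ divisorFun 3 n * (N / n) :=
        mul_le_mul_of_nonneg_left this (divisorFun_nonneg 3 n)
    _ = _ := by ring

theorem sum_divisorSq_le (N : ℕ) (hN : 1 ≤ N) :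
    ∑ n ∈ Finset.Icc 1 N, divisorSq n ≤ N * (1 + Real.log N) ^ 3 :=
  (Finset.sum_le_sum fun n _ => divisorSq_le_divisorFun_four n).trans
    (sum_divisorFun_four_le N hN)

theorem pow_succ_sub_pow_succ_le (j : ℕ) {a b : ℝ} (hb : 0 ≤ b) (hab : b ≤ a) :
    a ^ (j + 1) - b ^ (j + 1) ≤ (j + 1) * (a ^ j * (a - b)) ∧
      (j + 1) * (b ^ j * (a - b)) ≤ a ^ (j + 1) - b ^ (j + 1) := by
  have ha : 0 ≤ a := hb.trans hab
  have hd : 0 ≤ a - b := sub_nonneg.2 hab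
  induction j with
  | zero => simp
  | succ j ih =>
    have hpow : b ^ (j + 1) ≤ a ^ (j + 1) := pow_le_pow_left₀ hb hab _
    have h1 := mul_le_mul_of_nonneg_left ih.1 ha
    have h2 := mul_le_mul_of_nonneg_left ih.2 hb
    have h3 := mul_le_mul_of_nonneg_right hpow hd
    push_cast
    constructor
    · have e : a ^ (j + 1 + 1) - b ^ (j + 1 + 1) =
        a * (a ^ (j + 1) - b ^ (j + 1)) + b ^ (j + 1) * (a - b) := by ring
      rw [e]
      have : a * ((j + 1) * (a ^ j * (a - b))) = (j + 1) * (a ^ (j + 1) * (a - b)) := by ring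
      linarith
    · have e : a ^ (j + 1 + 1) - b ^ (j + 1 + 1) =
        b * (a ^ (j + 1) - b ^ (j + 1)) + a ^ (j + 1) * (a - b) := by ring
      rw [e]
      have : b * ((j + 1) * (b ^ j * (a - b))) = (j + 1) * (b ^ (j + 1) * (a - b)) := by ring
      linarith

theorem log_succ_sub_log_bounds {m : ℕ} (hm : 1 ≤ m) :
    (1 : ℝ) / (m + 1 : ℕ) ≤ Real.log (m + 1 : ℕ) - Real.log m ∧
      Real.log (m + 1 : ℕ) - Real.log m ≤ 1 / m := by
  have hm0 : (0 : ℝ) < m := by exact_mod_cast hm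
  have hm1 : (0 : ℝ) < (m + 1 : ℕ) := by positivity
  rw [← Real.log_div hm1.ne' hm0.ne']
  constructor
  · have := Real.one_sub_inv_le_log_of_pos (div_pos hm1 hm0)
    refine le_trans (le_of_eq ?_) this
    push_cast; field_simp; ring
  · have := Real.log_le_sub_one_of_pos (div_pos hm1 hm0)
    refine this.trans (le_of_eq ?_)
    push_cast; field_simp; ring

theorem sum_log_pow_div_bounds (j : ℕ) {x : ℝ} {N : ℕ} (hN : 1 ≤ N) (hNx : (N : ℝ) ≤ x) :
    ∑ m ∈ Finset.Ioc 0 N, 1 / (m : ℝ) * Real.log (x / m) ^ j ≤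
        Real.log x ^ j + (Real.log x ^ (j + 1) - Real.log (x / N) ^ (j + 1)) / (j + 1) ∧
      (Real.log x ^ (j + 1) - Real.log (x / N) ^ (j + 1)) / (j + 1) ≤
        ∑ m ∈ Finset.Ioc 0 N, 1 / (m : ℝ) * Real.log (x / m) ^ j := by
  suffices H : ∑ m ∈ Finset.Ioc 0 N, 1 / (m : ℝ) * Real.log (x / m) ^ j ≤
        Real.log x ^ j + (Real.log x ^ (j + 1) - Real.log (x / N) ^ (j + 1)) / (j + 1) ∧
      (Real.log x ^ (j + 1) - Real.log (x / N) ^ (j + 1)) / (j + 1) +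
        1 / (N : ℝ) * Real.log (x / N) ^ j ≤
        ∑ m ∈ Finset.Ioc 0 N, 1 / (m : ℝ) * Real.log (x / m) ^ j by
    refine ⟨H.1, le_trans ?_ H.2⟩
    have : 0 ≤ Real.log (x / N) := Real.log_nonneg ((one_le_div (by positivity)).2 hNx)
    have : 0 ≤ 1 / (N : ℝ) * Real.log (x / N) ^ j := by positivity
    linarith
  induction N, hN using Nat.le_induction with
  | base => simp
  | succ N hN ih =>
    have hN0 : (0 : ℝ) < N := by exact_mod_cast hN
    have hN1 : (0 : ℝ) < (N + 1 : ℕ) := by positivity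
    have hle : (N : ℝ) ≤ (N + 1 : ℕ) := by push_cast; linarith
    have hx : 0 < x := by linarith
    obtain ⟨ih1, ih2⟩ := ih (hle.trans hNx)
    rw [Finset.sum_Ioc_succ_top (Nat.zero_le N)]
    obtain ⟨l1, l2⟩ := log_succ_sub_log_bounds hN
    set a := Real.log (x / N) with ha
    set b := Real.log (x / (N + 1 : ℕ)) with hb
    have hab : a - b = Real.log (N + 1 : ℕ) - Real.log N := by
      rw [ha, hb, Real.log_div hx.ne' hN0.ne', Real.log_div hx.ne' hN1.ne']; ring
    have hb0 : 0 ≤ b := Real.log_nonneg ((one_le_div hN1).2 hNx)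
    have hba : b ≤ a := by
      have : (0 : ℝ) ≤ 1 / (N + 1 : ℕ) := by positivity
      linarith
    rw [← hab] at l1 l2
    obtain ⟨p1, p2⟩ := pow_succ_sub_pow_succ_le j hb0 hba
    have hj : (0 : ℝ) < j + 1 := by positivity
    have q1 : (a ^ (j + 1) - b ^ (j + 1)) / (j + 1) ≤ 1 / (N : ℝ) * a ^ j := by
      rw [div_le_iff₀ hj]
      have := mul_le_mul_of_nonneg_left l2 (pow_nonneg (hb0.trans hba) j)
      nlinarith
    have q2 : 1 / ((N + 1 : ℕ) : ℝ) * b ^ j ≤ (a ^ (j + 1) - b ^ (j + 1)) / (j + 1) := by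
      rw [le_div_iff₀ hj]
      have := mul_le_mul_of_nonneg_left l1 (pow_nonneg hb0 j)
      nlinarith
    have e : (Real.log x ^ (j + 1) - b ^ (j + 1)) / (j + 1) =
      (Real.log x ^ (j + 1) - a ^ (j + 1)) / (j + 1) + (a ^ (j + 1) - b ^ (j + 1)) / (j + 1) := by
      ring
    constructor
    · linarith
    · linarith

theorem abs_sum_log_pow_div_sub_le (j : ℕ) {x : ℝ} (hx : 1 ≤ x) :
    |∑ m ∈ Finset.Ioc 0 ⌊x⌋₊, 1 / (m : ℝ) * Real.log (x / m) ^ j -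
      Real.log x ^ (j + 1) / (j + 1)| ≤ (1 + Real.log x) ^ j := by
  have hN : 1 ≤ ⌊x⌋₊ := Nat.le_floor (by simpa using hx)
  have hNx : (⌊x⌋₊ : ℝ) ≤ x := Nat.floor_le (by linarith)
  have hN0 : (0 : ℝ) < ⌊x⌋₊ := by exact_mod_cast hN
  obtain ⟨h1, h2⟩ := sum_log_pow_div_bounds j hN hNx
  have hL : 0 ≤ Real.log x := Real.log_nonneg hx
  have hy1 : 1 ≤ x / ⌊x⌋₊ := (one_le_div hN0).2 hNx
  have hy2 : x / ⌊x⌋₊ ≤ 2 := by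
    rw [div_le_iff₀ hN0]
    have := Nat.lt_floor_add_one x
    have : (1 : ℝ) ≤ ⌊x⌋₊ := by exact_mod_cast hN
    linarith
  have hl0 : 0 ≤ Real.log (x / ⌊x⌋₊) := Real.log_nonneg hy1
  have hl1 : Real.log (x / ⌊x⌋₊) ≤ 1 := by
    have := Real.log_le_sub_one_of_pos (show 0 < x / ⌊x⌋₊ by linarith)
    linarith
  have hp0 : 0 ≤ Real.log (x / ⌊x⌋₊) ^ (j + 1) := by positivity
  have hp1 : Real.log (x / ⌊x⌋₊) ^ (j + 1) ≤ 1 := pow_le_one₀ hl0 hl1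
  have hj : (0 : ℝ) < j + 1 := by positivity
  have hd0 : 0 ≤ Real.log (x / ⌊x⌋₊) ^ (j + 1) / (j + 1) := by positivity
  have hd1 : Real.log (x / ⌊x⌋₊) ^ (j + 1) / (j + 1) ≤ 1 := by
    rw [div_le_one hj]; have : (0 : ℝ) ≤ j := j.cast_nonneg
    linarith
  have ha : Real.log x ^ j ≤ (1 + Real.log x) ^ j := by gcongr; linarith
  have hb : 1 ≤ (1 + Real.log x) ^ j := one_le_pow₀ (by linarith)
  rw [sub_div] at h1 h2
  rw [abs_le]
  constructor <;> linarith

theorem exists_abs_divisorSum_sub_le (k : ℕ) : ∃ C : ℝ, 0 ≤ C ∧ ∀ x : ℝ, 1 ≤ x →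
    |divisorSum (k + 1) x - Real.log x ^ (k + 1) / (k + 1).factorial| ≤
      C * (1 + Real.log x) ^ k := by
  induction k with
  | zero =>
    refine ⟨1, zero_le_one, fun x hx => ?_⟩
    have h := abs_sum_log_pow_div_sub_le 0 hx
    have e : divisorSum (0 + 1) x = ∑ m ∈ Finset.Ioc 0 ⌊x⌋₊, 1 / (m : ℝ) * Real.log (x / m) ^ 0 := by
      rw [divisorSum]
      refine Finset.sum_congr rfl fun m hm => ?_
      have : m ≠ 0 := by simp at hm; omega
      rw [zero_add, divisorFun_one_apply this]; simp
    rw [e]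
    simpa using h
  | succ k ih =>
    obtain ⟨C, hC, ih⟩ := ih
    refine ⟨C + 1, by positivity, fun x hx => ?_⟩
    have hL : 0 ≤ Real.log x := Real.log_nonneg hx
    set F : ℝ := ((k + 1).factorial : ℝ) with hF
    have hF1 : 1 ≤ F := by
      rw [hF]; exact_mod_cast Nat.one_le_iff_ne_zero.2 (Nat.factorial_ne_zero _)
    have hF' : (((k + 1 + 1).factorial : ℕ) : ℝ) = (((k + 1 : ℕ) : ℝ) + 1) * F := by
      rw [Nat.factorial_succ]; push_cast; rfl
    have key := abs_sum_log_pow_div_sub_le (k + 1) hx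
    set S := ∑ m ∈ Finset.Ioc 0 ⌊x⌋₊, 1 / (m : ℝ) * Real.log (x / m) ^ (k + 1) with hS
    have h1 : |divisorSum (k + 1 + 1) x - S / F| ≤ C * (1 + Real.log x) ^ (k + 1) := by
      rw [divisorSum_succ, hS, Finset.sum_div, ← Finset.sum_sub_distrib]
      refine (Finset.abs_sum_le_sum_abs _ _).trans ?_
      calc ∑ m ∈ Finset.Ioc 0 ⌊x⌋₊, |1 / (m : ℝ) * divisorSum (k + 1) (x / m) -
            1 / (m : ℝ) * Real.log (x / m) ^ (k + 1) / F|
          ≤ ∑ m ∈ Finset.Ioc 0 ⌊x⌋₊, 1 / (m : ℝ) * (C * (1 + Real.log x) ^ k) := by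
            refine Finset.sum_le_sum fun m hm => ?_
            obtain ⟨a1, a2, a3⟩ := mem_Ioc_floor (by linarith) hm
            rw [mul_div_assoc, ← mul_sub, abs_mul, abs_of_nonneg (by positivity : 0 ≤ 1 / (m : ℝ))]
            refine mul_le_mul_of_nonneg_left ((ih _ a3).trans ?_) (by positivity)
            have : x / m ≤ x := div_le_self (by linarith) a1
            have h4 : 0 ≤ Real.log (x / m) := Real.log_nonneg a3
            gcongr
        _ ≤ C * (1 + Real.log x) ^ (k + 1) := by
            rw [← Finset.sum_mul]
            refine (mul_le_mul_of_nonneg_right (sum_one_div_floor_le hx) (by positivity)).trans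
              (le_of_eq ?_)
            ring
    have h2 : |S / F - Real.log x ^ (k + 1 + 1) / (((k + 1 + 1).factorial : ℕ) : ℝ)| ≤
        (1 + Real.log x) ^ (k + 1) := by
      rw [hF', ← div_div, ← sub_div, abs_div, abs_of_pos (by linarith : 0 < F)]
      exact (div_le_self (abs_nonneg _) hF1).trans key
    calc _ ≤ _ := abs_sub_le _ (S / F) _
      _ ≤ _ := add_le_add h1 h2
      _ = _ := by ring

theorem abs_divisorSum_four_sub_le : ∃ C : ℝ, 0 ≤ C ∧ ∀ x : ℝ, 1 ≤ x → ∀ m : ℕ, 1 ≤ m →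
    |divisorSum 4 (x / m) - Real.log x ^ 4 / 24| ≤
      C * (1 + Real.log x) ^ 3 * (1 + Real.log m) := by
  obtain ⟨C, hC, h⟩ := exists_abs_divisorSum_sub_le 3
  refine ⟨C + 1, by positivity, fun x hx m hm => ?_⟩
  have hm1 : (1 : ℝ) ≤ m := by exact_mod_cast hm
  have hL : 0 ≤ Real.log x := Real.log_nonneg hx
  have hLm : 0 ≤ Real.log m := Real.log_nonneg hm1
  have hfac : ((Nat.factorial (3 + 1) : ℕ) : ℝ) = 24 := by norm_num [Nat.factorial]
  rcases le_or_gt (m : ℝ) x with hmx | hmx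
  · have h3 : 1 ≤ x / m := (one_le_div (by linarith)).2 hmx
    have h4 := h _ h3
    rw [hfac] at h4
    have hl : Real.log (x / m) = Real.log x - Real.log m :=
      Real.log_div (by linarith) (by linarith)
    have hl0 : 0 ≤ Real.log (x / m) := Real.log_nonneg h3
    have hp := (pow_succ_sub_pow_succ_le 3 hl0 (by rw [hl]; linarith :
      Real.log (x / m) ≤ Real.log x)).1
    have hp0 : Real.log (x / m) ^ 4 ≤ Real.log x ^ 4 := by
      apply pow_le_pow_left₀ hl0; rw [hl]; linarith
    have e : Real.log x - Real.log (x / m) = Real.log m := by rw [hl]; ring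
    rw [e] at hp
    have hA : Real.log x ^ 3 ≤ (1 + Real.log x) ^ 3 := by gcongr; linarith
    have hB : Real.log x ^ 3 * Real.log m ≤ (1 + Real.log x) ^ 3 * (1 + Real.log m) := by
      gcongr; linarith
    have hD : C * (1 + Real.log (x / m)) ^ 3 ≤ C * (1 + Real.log x) ^ 3 * (1 + Real.log m) := by
      calc C * (1 + Real.log (x / m)) ^ 3 ≤ C * (1 + Real.log x) ^ 3 := by
            gcongr; exact div_le_self (by linarith) hm1
        _ ≤ _ := le_mul_of_one_le_right (by positivity) (by linarith)
    norm_num at hp h4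
    rw [abs_le] at h4 ⊢
    constructor <;> nlinarith
  · rw [divisorSum_of_lt_one 4 ((div_lt_one (by linarith)).2 hmx), zero_sub, abs_neg,
      abs_of_nonneg (by positivity)]
    have hlog : Real.log x ≤ Real.log m := Real.log_le_log (by linarith) hmx.le
    calc Real.log x ^ 4 / 24 ≤ Real.log x ^ 3 * Real.log x := by
          rw [← pow_succ]; exact div_le_self (by positivity) (by norm_num)
      _ ≤ (1 + Real.log x) ^ 3 * (1 + Real.log m) := by gcongr <;> linarith
      _ ≤ (C + 1) * (1 + Real.log x) ^ 3 * (1 + Real.log m) := by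
          rw [mul_assoc]; exact le_mul_of_one_le_left (by positivity) (by linarith)

theorem hasSum_moebius_div_sq :
    HasSum (fun k : ℕ => (ArithmeticFunction.moebius k : ℝ) / (k : ℝ) ^ 2) (6 / π ^ 2) := by
  have h2 : 1 < (2 : ℂ).re := by norm_num
  have hs := ArithmeticFunction.LSeriesSummable_moebius_iff.2 h2
  have h := ArithmeticFunction.LSeries_zeta_mul_Lseries_moebius h2
  rw [ArithmeticFunction.LSeries_zeta_eq_riemannZeta h2, riemannZeta_two] at h
  have hH := hs.LSeriesHasSum
  have hv : LSeries (fun n => ((ArithmeticFunction.moebius n : ℤ) : ℂ)) 2 =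
      ((6 / π ^ 2 : ℝ) : ℂ) := by
    have hpi : (π : ℂ) ≠ 0 := by exact_mod_cast Real.pi_ne_zero
    push_cast
    field_simp at h ⊢
    linear_combination h
  rw [hv] at hH
  rw [← Complex.hasSum_ofReal]
  rw [LSeriesHasSum] at hH
  convert hH using 1
  ext k
  rcases Nat.eq_zero_or_pos k with rfl | hk
  · simp
  · rw [LSeries.term_of_ne_zero hk.ne']
    push_cast
    norm_cast

theorem summable_moebius_mul_log :
    Summable (fun k : ℕ => |(ArithmeticFunction.moebius k : ℝ)| / (k : ℝ) ^ 2 *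
      (1 + Real.log ((k ^ 2 : ℕ) : ℝ))) := by
  have hs : Summable (fun k : ℕ => 5 * (1 / (k : ℝ) ^ (3 / 2 : ℝ))) :=
    (Real.summable_one_div_nat_rpow.2 (by norm_num)).mul_left 5
  refine Summable.of_nonneg_of_le (fun k => ?_) (fun k => ?_) hs
  · have : 0 ≤ Real.log ((k ^ 2 : ℕ) : ℝ) := Real.log_natCast_nonneg _
    positivity
  · rcases Nat.eq_zero_or_pos k with rfl | hk
    · simp
    have hk1 : (1 : ℝ) ≤ k := by exact_mod_cast hk
    have hk0 : (0 : ℝ) < k := by linarith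
    have hmu : |(ArithmeticFunction.moebius k : ℝ)| ≤ 1 := by
      exact_mod_cast ArithmeticFunction.abs_moebius_le_one
    have hlog : Real.log k ≤ (k : ℝ) ^ (1 / 2 : ℝ) / (1 / 2) :=
      Real.log_le_rpow_div hk0.le (by norm_num)
    have hone : (1 : ℝ) ≤ (k : ℝ) ^ (1 / 2 : ℝ) := Real.one_le_rpow hk1 (by norm_num)
    have h1 : 1 + Real.log ((k ^ 2 : ℕ) : ℝ) ≤ 5 * (k : ℝ) ^ (1 / 2 : ℝ) := by
      push_cast
      rw [Real.log_pow]
      push_cast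
      linarith
    have h2 : (k : ℝ) ^ 2 = (k : ℝ) ^ (3 / 2 : ℝ) * (k : ℝ) ^ (1 / 2 : ℝ) := by
      rw [← Real.rpow_add hk0]; norm_num
    have h0 : 0 ≤ 1 + Real.log ((k ^ 2 : ℕ) : ℝ) := by
      have := Real.log_natCast_nonneg (k ^ 2); linarith
    calc _ ≤ 1 / (k : ℝ) ^ 2 * (5 * (k : ℝ) ^ (1 / 2 : ℝ)) := by gcongr
      _ = _ := by
        rw [h2]
        have a : (k : ℝ) ^ (1 / 2 : ℝ) ≠ 0 := by positivity
        have b : (k : ℝ) ^ (3 / 2 : ℝ) ≠ 0 := by positivity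
        field_simp

theorem sq_injective_nat : Function.Injective (fun k : ℕ => k ^ 2) :=
  Nat.pow_left_injective two_ne_zero

theorem moebiusSqrt_eq_zero_of_notMem_range {n : ℕ}
    (h : n ∉ Set.range (fun k : ℕ => k ^ 2)) : moebiusSqrt n = 0 := by
  apply moebiusSqrt_of_not_isSquare
  rintro ⟨r, rfl⟩
  exact h ⟨r, by simp [sq]⟩

theorem hasSum_moebiusSqrt_div : HasSum (fun n : ℕ => moebiusSqrt n / n) (6 / π ^ 2) := by
  rw [← sq_injective_nat.hasSum_iff]
  · convert hasSum_moebius_div_sq using 2 with k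
    simp [moebiusSqrt_sq]
  · intro n hn
    rw [moebiusSqrt_eq_zero_of_notMem_range hn, zero_div]

theorem summable_moebiusSqrt_log :
    Summable (fun n : ℕ => |moebiusSqrt n / n| * (1 + Real.log n)) := by
  rw [← sq_injective_nat.summable_iff]
  · convert summable_moebius_mul_log using 2 with k
    simp [moebiusSqrt_sq, abs_div]
  · intro n hn
    rw [moebiusSqrt_eq_zero_of_notMem_range hn]; simp

theorem exists_abs_sum_divisorSq_div_sub_le : ∃ C : ℝ, 0 ≤ C ∧ ∀ x : ℝ, 1 ≤ x →
    |∑ n ∈ Finset.Ioc 0 ⌊x⌋₊, divisorSq n / n - Real.log x ^ 4 / (4 * π ^ 2)| ≤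
      C * (1 + Real.log x) ^ 3 := by
  obtain ⟨C, hC, h⟩ := abs_divisorSum_four_sub_le
  refine ⟨C * ∑' n : ℕ, |moebiusSqrt n / n| * (1 + Real.log n), ?_, fun x hx => ?_⟩
  · refine mul_nonneg hC (tsum_nonneg fun n => mul_nonneg (abs_nonneg _) ?_)
    have := Real.log_natCast_nonneg n; linarith
  have hsum : HasSum (fun m : ℕ => moebiusSqrt m / m * divisorSum 4 (x / m))
      (∑ n ∈ Finset.Ioc 0 ⌊x⌋₊, divisorSq n / n) := by
    rw [← moebiusSqrt_mul_divisorFun_four, sum_mul_div_floor]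
    refine hasSum_sum_of_ne_finset_zero fun m hm => ?_
    rcases Nat.eq_zero_or_pos m with rfl | hm0
    · simp
    · rw [divisorSum_of_lt_one, mul_zero]
      have : ¬ (m ≤ ⌊x⌋₊) := fun hh => hm (Finset.mem_Ioc.2 ⟨hm0, hh⟩)
      rw [Nat.le_floor_iff (by linarith), not_le] at this
      rw [div_lt_one (by exact_mod_cast hm0)]
      exact this
  have hmain := hsum.sub (hasSum_moebiusSqrt_div.mul_right (Real.log x ^ 4 / 24))
  have e : 6 / π ^ 2 * (Real.log x ^ 4 / 24) = Real.log x ^ 4 / (4 * π ^ 2) := by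
    field_simp; ring
  rw [e] at hmain
  rw [← hmain.tsum_eq, mul_right_comm, ← tsum_mul_left, ← Real.norm_eq_abs]
  refine tsum_of_norm_bounded (summable_moebiusSqrt_log.mul_left _).hasSum fun m => ?_
  rw [← mul_sub, norm_mul, Real.norm_eq_abs, Real.norm_eq_abs]
  rcases Nat.eq_zero_or_pos m with rfl | hm0
  · simp
  · calc _ ≤ |moebiusSqrt m / m| * (C * (1 + Real.log x) ^ 3 * (1 + Real.log m)) := by
          gcongr; exact h x hx m hm0
      _ = _ := by ring

theorem card_divisors_le_two_mul {n R : ℕ} (hn : n ≠ 0) (hR : n < (R + 1) * (R + 1)) :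
    n.divisors.card ≤ 2 * ((Finset.Icc 1 R).filter (fun a => a ∣ n)).card := by
  rw [two_mul, ← Finset.card_filter_add_card_filter_not (s := n.divisors) (fun a => a ≤ R)]
  refine Nat.add_le_add (Finset.card_le_card fun a ha => ?_) ?_
  · rw [Finset.mem_filter] at ha
    rw [Finset.mem_filter, Finset.mem_Icc]
    exact ⟨⟨Nat.pos_of_mem_divisors ha.1, ha.2⟩, Nat.dvd_of_mem_divisors ha.1⟩
  · refine Finset.card_le_card_of_injOn (fun a => n / a) (fun a ha => ?_) (fun a ha b hb hab => ?_)
    · have ha' := Finset.mem_filter.1 ha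
      have hd := Nat.dvd_of_mem_divisors ha'.1
      have hmul : n / a * a = n := Nat.div_mul_cancel hd
      rw [Finset.mem_coe, Finset.mem_filter, Finset.mem_Icc]
      refine ⟨⟨Nat.div_pos (Nat.le_of_dvd (Nat.pos_of_ne_zero hn) hd)
        (Nat.pos_of_mem_divisors ha'.1), ?_⟩, Nat.div_dvd_of_dvd hd⟩
      by_contra hlt
      have h1 : R + 1 ≤ n / a := by simpa using hlt
      have h2 : R + 1 ≤ a := by simpa using ha'.2
      have := Nat.mul_le_mul h1 h2
      omega
    · have ha' := Nat.dvd_of_mem_divisors (Finset.mem_filter.1 ha).1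
      have hb' := Nat.dvd_of_mem_divisors (Finset.mem_filter.1 hb).1
      simp only at hab
      have h1 := Nat.div_div_self ha' hn
      rw [hab, Nat.div_div_self hb' hn] at h1
      exact h1.symm

theorem card_le_of_pairwise_modEq {S : Finset ℕ} {M q : ℕ}
    (hS : ∀ m ∈ S, m ≤ M) (h : ∀ m ∈ S, ∀ n ∈ S, m ≡ n [MOD q]) :
    S.card ≤ M / q + 1 := by
  rw [← Finset.card_range (M / q + 1)]
  refine Finset.card_le_card_of_injOn (fun m => m / q) (fun m hm => ?_) (fun a ha b hb hab => ?_)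
  · rw [Finset.mem_coe, Finset.mem_range]
    exact Nat.lt_succ_of_le (Nat.div_le_div_right (hS m hm))
  · have h1 := h a ha b hb
    simp only at hab
    rw [← Nat.div_add_mod a q, ← Nat.div_add_mod b q, hab, h1]

theorem card_dvd_dvd_add_le {M a b r : ℕ} (ha : 1 ≤ a) (hb : 1 ≤ b) (hab : a * b ≤ 2 * M) :
    ((((Finset.Icc 1 M).filter (fun m => a ∣ m ∧ b ∣ m + r)).card : ℕ) : ℝ) ≤
      if a.gcd b ∣ r then 3 * M * (a.gcd b : ℝ) / (a * b) else 0 := by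
  split_ifs with hg
  · have hcard := card_le_of_pairwise_modEq (q := a.lcm b) (M := M)
      (S := (Finset.Icc 1 M).filter (fun m => a ∣ m ∧ b ∣ m + r))
      (fun m hm => (Finset.mem_Icc.1 (Finset.mem_filter.1 hm).1).2)
      (fun m hm n hn => by
        obtain ⟨m1, m2⟩ := (Finset.mem_filter.1 hm).2
        obtain ⟨n1, n2⟩ := (Finset.mem_filter.1 hn).2
        rw [Nat.modEq_iff_dvd]
        have h1 : (a : ℤ) ∣ (n : ℤ) - m := dvd_sub (by exact_mod_cast n1) (by exact_mod_cast m1)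
        have h2 : (b : ℤ) ∣ (n : ℤ) - m := by
          have : (b : ℤ) ∣ ((n + r : ℕ) : ℤ) - ((m + r : ℕ) : ℤ) :=
            dvd_sub (by exact_mod_cast n2) (by exact_mod_cast m2)
          simpa using this
        rw [← Int.natAbs_dvd_natAbs, Int.natAbs_natCast]
        exact Nat.lcm_dvd (by rwa [← Int.natAbs_natCast a, Int.natAbs_dvd_natAbs])
          (by rwa [← Int.natAbs_natCast b, Int.natAbs_dvd_natAbs]))
    have ha0 : (0 : ℝ) < a := by exact_mod_cast ha
    have hb0 : (0 : ℝ) < b := by exact_mod_cast hb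
    have hl0 : 0 < a.lcm b := Nat.lcm_pos ha hb
    have hg1 : (1 : ℝ) ≤ a.gcd b := by exact_mod_cast Nat.gcd_pos_of_pos_left b ha
    have hgl : (a.gcd b : ℝ) * a.lcm b = a * b := by exact_mod_cast Nat.gcd_mul_lcm a b
    have hab' : (a : ℝ) * b ≤ 2 * M := by exact_mod_cast hab
    have hl0' : (0 : ℝ) < a.lcm b := by exact_mod_cast hl0
    calc _ ≤ ((M / a.lcm b + 1 : ℕ) : ℝ) := by exact_mod_cast hcard
      _ ≤ (M : ℝ) / a.lcm b + 1 := by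
          push_cast; gcongr; exact Nat.cast_div_le
      _ ≤ _ := by
          have e : (M : ℝ) / a.lcm b = M * (a.gcd b : ℝ) / (a * b) := by
            rw [← hgl]; field_simp
          rw [e, le_div_iff₀ (by positivity), add_mul, div_mul_cancel₀ _ (by positivity)]
          have hM : (0 : ℝ) ≤ M := M.cast_nonneg
          nlinarith
  · rw [Finset.filter_false_of_mem]
    · simp
    · rintro m _ ⟨h1, h2⟩
      apply hg
      rw [← Nat.dvd_add_right ((Nat.gcd_dvd_left a b).trans h1)]
      exact (Nat.gcd_dvd_right a b).trans h2

theorem sum_dvd_one_div_le {M g : ℕ} (hM : 1 ≤ M) (hg : 1 ≤ g) :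
    ∑ r ∈ Finset.Icc 1 M, (if g ∣ r then (1 : ℝ) / r else 0) ≤
      (1 + Real.log M) / g := by
  have hg0 : (0 : ℝ) < g := by exact_mod_cast hg
  have hM1 : (1 : ℝ) ≤ M := by exact_mod_cast hM
  have hs := sum_one_div_floor_le hM1
  rw [Nat.floor_natCast] at hs
  rw [← Finset.sum_filter, le_div_iff₀ hg0]
  refine le_trans ?_ hs
  rw [Finset.sum_mul]
  calc ∑ r ∈ (Finset.Icc 1 M).filter (fun r => g ∣ r), (1 : ℝ) / r * g
      = ∑ k ∈ ((Finset.Icc 1 M).filter (fun r => g ∣ r)).image (fun r => r / g), (1 : ℝ) / k := by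
        rw [Finset.sum_image]
        · refine Finset.sum_congr rfl fun r hr => ?_
          obtain ⟨h1, k, rfl⟩ := Finset.mem_filter.1 hr
          have hk : k ≠ 0 := by rintro rfl; simp at h1
          rw [Nat.mul_div_cancel_left _ hg]
          have : (k : ℝ) ≠ 0 := by exact_mod_cast hk
          push_cast
          field_simp
        · intro x hx y hy hxy
          exact (Nat.div_left_inj (Finset.mem_filter.1 hx).2 (Finset.mem_filter.1 hy).2).1 hxy
    _ ≤ _ := by
        refine Finset.sum_le_sum_of_subset_of_nonneg (fun k hk => ?_) (fun _ _ _ => by positivity)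
        obtain ⟨r, hr, rfl⟩ := Finset.mem_image.1 hk
        obtain ⟨h1, h2⟩ := Finset.mem_filter.1 hr
        rw [Finset.mem_Icc] at h1
        rw [Finset.mem_Ioc]
        exact ⟨Nat.div_pos (Nat.le_of_dvd h1.1 h2) hg, (Nat.div_le_self _ _).trans h1.2⟩

theorem divisorFun_two_le {n R : ℕ} (hn : n ≠ 0) (hR : n < (R + 1) * (R + 1)) :
    divisorFun 2 n ≤ 2 * ∑ a ∈ Finset.Icc 1 R, if a ∣ n then (1 : ℝ) else 0 := by
  rw [divisorFun_two_apply, Finset.sum_boole]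
  exact_mod_cast card_divisors_le_two_mul hn hR

/-- The additive correlations of the divisor function, weighted by the inverse of the shift. -/
theorem sum_divisor_correlation_le (M : ℕ) (hM : 1 ≤ M) :
    ∑ m ∈ Finset.Icc 1 M, ∑ r ∈ Finset.Icc 1 m, divisorFun 2 m * divisorFun 2 (m + r) / r ≤
      48 * M * (1 + Real.log M) ^ 3 := by
  set R := Nat.sqrt (2 * M) with hRdef
  have hR : 2 * M < (R + 1) * (R + 1) := Nat.lt_succ_sqrt _
  have hR2 : R * R ≤ 2 * M := Nat.sqrt_le _
  have hM1 : (1 : ℝ) ≤ M := by exact_mod_cast hM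
  have hL : 0 ≤ Real.log M := Real.log_nonneg hM1
  have hR1 : 1 ≤ R := Nat.le_sqrt.2 (by omega)
  have hR1' : (1 : ℝ) ≤ R := by exact_mod_cast hR1
  let ι (a n : ℕ) : ℝ := if a ∣ n then 1 else 0
  have hι : ∀ a n, 0 ≤ ι a n := fun a n => by simp only [ι]; split_ifs <;> norm_num
  have hharm : ∑ a ∈ Finset.Icc 1 R, (1 : ℝ) / a ≤ 2 * (1 + Real.log M) := by
    have h := sum_one_div_floor_le hR1'
    have hIcc : Finset.Icc 1 R = Finset.Ioc 0 R := by ext; simp [Nat.succ_le_iff]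
    rw [Nat.floor_natCast, ← hIcc] at h
    refine h.trans ?_
    have h2 : Real.log ((R : ℝ) * R) ≤ Real.log (2 * M) :=
      Real.log_le_log (by positivity) (by exact_mod_cast hR2)
    rw [Real.log_mul (by linarith) (by linarith), Real.log_mul (by norm_num) (by linarith)] at h2
    have := Real.log_two_lt_d9
    linarith
  calc ∑ m ∈ Finset.Icc 1 M, ∑ r ∈ Finset.Icc 1 m, divisorFun 2 m * divisorFun 2 (m + r) / r
      ≤ ∑ m ∈ Finset.Icc 1 M, ∑ r ∈ Finset.Icc 1 M,
          4 * ∑ a ∈ Finset.Icc 1 R, ∑ b ∈ Finset.Icc 1 R, (1 / r * (ι a m * ι b (m + r)) : ℝ) := by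
        refine Finset.sum_le_sum fun m hm => ?_
        rw [Finset.mem_Icc] at hm
        calc ∑ r ∈ Finset.Icc 1 m, divisorFun 2 m * divisorFun 2 (m + r) / r
            ≤ ∑ r ∈ Finset.Icc 1 m, 4 * ∑ a ∈ Finset.Icc 1 R, ∑ b ∈ Finset.Icc 1 R,
                (1 / r * (ι a m * ι b (m + r)) : ℝ) := by
              refine Finset.sum_le_sum fun r hr => ?_
              rw [Finset.mem_Icc] at hr
              have h1 := divisorFun_two_le (n := m) (R := R) (by omega) (by omega)
              have h2 := divisorFun_two_le (n := m + r) (R := R) (by omega) (by omega)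
              have h3 := mul_le_mul h1 h2 (divisorFun_nonneg 2 _) (mul_nonneg zero_le_two
                (Finset.sum_nonneg fun a _ => hι a m))
              calc divisorFun 2 m * divisorFun 2 (m + r) / r ≤ _ :=
                    div_le_div_of_nonneg_right h3 (Nat.cast_nonneg r)
                _ = _ := by
                    rw [mul_mul_mul_comm, Finset.sum_mul_sum, mul_div_assoc, Finset.sum_div]
                    norm_num only
                    refine congrArg _ (Finset.sum_congr rfl fun a _ => ?_)
                    rw [Finset.sum_div]
                    refine Finset.sum_congr rfl fun b _ => ?_
                    simp only [ι]
                    ring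
          _ ≤ _ := by
              refine Finset.sum_le_sum_of_subset_of_nonneg
                (Finset.Icc_subset_Icc_right hm.2) fun r _ _ => ?_
              refine mul_nonneg (by norm_num) (Finset.sum_nonneg fun a _ =>
                Finset.sum_nonneg fun b _ => mul_nonneg (by positivity)
                  (mul_nonneg (hι _ _) (hι _ _)))
    _ = 4 * ∑ a ∈ Finset.Icc 1 R, ∑ b ∈ Finset.Icc 1 R, ∑ r ∈ Finset.Icc 1 M,
          (1 / r * ∑ m ∈ Finset.Icc 1 M, (ι a m * ι b (m + r)) : ℝ) := by
        simp_rw [← Finset.mul_sum]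
        congr 1
        rw [Finset.sum_comm]
        simp_rw [Finset.mul_sum]
        rw [Finset.sum_congr rfl (fun r _ => Finset.sum_comm), Finset.sum_comm]
        refine Finset.sum_congr rfl fun a _ => ?_
        rw [Finset.sum_congr rfl (fun r _ => Finset.sum_comm), Finset.sum_comm]
    _ ≤ 4 * ∑ a ∈ Finset.Icc 1 R, ∑ b ∈ Finset.Icc 1 R,
          3 * M * (1 + Real.log M) * (1 / a * (1 / b)) := by
        refine mul_le_mul_of_nonneg_left (Finset.sum_le_sum fun a ha =>
          Finset.sum_le_sum fun b hb => ?_) (by norm_num)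
        rw [Finset.mem_Icc] at ha hb
        have hg1 : 1 ≤ a.gcd b := Nat.gcd_pos_of_pos_left b ha.1
        have hg0 : (0 : ℝ) < a.gcd b := by exact_mod_cast hg1
        have ha0 : (0 : ℝ) < a := by exact_mod_cast ha.1
        have hb0 : (0 : ℝ) < b := by exact_mod_cast hb.1
        calc ∑ r ∈ Finset.Icc 1 M, (1 / r * ∑ m ∈ Finset.Icc 1 M, (ι a m * ι b (m + r)) : ℝ)
            ≤ ∑ r ∈ Finset.Icc 1 M, 3 * M * (a.gcd b : ℝ) / (a * b) *
                (if a.gcd b ∣ r then (1 : ℝ) / r else 0) := by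
              refine Finset.sum_le_sum fun r _ => ?_
              have h1 : ∑ m ∈ Finset.Icc 1 M, (ι a m * ι b (m + r)) =
                  ((((Finset.Icc 1 M).filter (fun m => a ∣ m ∧ b ∣ m + r)).card : ℕ) : ℝ) := by
                rw [← Finset.sum_boole]
                refine Finset.sum_congr rfl fun m _ => ?_
                simp only [ι]
                by_cases c1 : a ∣ m <;> by_cases c2 : b ∣ m + r <;> simp [c1, c2]
              rw [h1]
              refine (mul_le_mul_of_nonneg_left (card_dvd_dvd_add_le ha.1 hb.1
                ((Nat.mul_le_mul ha.2 hb.2).trans hR2)) (by positivity)).trans (le_of_eq ?_)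
              split_ifs <;> ring
          _ ≤ 3 * M * (a.gcd b : ℝ) / (a * b) * ((1 + Real.log M) / a.gcd b) := by
              rw [← Finset.mul_sum]
              exact mul_le_mul_of_nonneg_left (sum_dvd_one_div_le hM hg1) (by positivity)
          _ = _ := by field_simp
    _ = 12 * M * (1 + Real.log M) *
          ((∑ a ∈ Finset.Icc 1 R, (1 : ℝ) / a) * (∑ b ∈ Finset.Icc 1 R, (1 : ℝ) / b)) := by
        simp_rw [← Finset.mul_sum]
        rw [← Finset.sum_mul]
        ring
    _ ≤ 12 * M * (1 + Real.log M) * ((2 * (1 + Real.log M)) * (2 * (1 + Real.log M))) := by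
        have : 0 ≤ ∑ a ∈ Finset.Icc 1 R, (1 : ℝ) / a :=
          Finset.sum_nonneg fun _ _ => by positivity
        gcongr
    _ = _ := by ring

/-- The decay of the off-diagonal weights in terms of `x = m n`. -/
noncomputable def decay (T x : ℝ) : ℝ := min ((T ^ 2 / x) ^ (1 / 4 : ℝ)) (T ^ 2 / x)

theorem decay_nonneg {T x : ℝ} (hx : 0 ≤ x) : 0 ≤ decay T x :=
  le_min (by positivity) (by positivity)

theorem min_rpow_le_cutoff {T m : ℝ} (hT : 0 < T) (hm : 0 < m) :
    min ((T / m) ^ (1 / 2 : ℝ)) ((T / m) ^ (2 : ℝ)) ≤ cutoff T m := by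
  have h0 : 0 < T / m := div_pos hT hm
  unfold cutoff
  rcases le_total 1 (T / m) with h | h
  · exact (min_le_left _ _).trans (le_min (Real.rpow_le_rpow_of_exponent_le h (by norm_num))
      (Real.rpow_le_rpow_of_exponent_le h (by norm_num)))
  · exact (min_le_right _ _).trans (le_min (Real.rpow_le_rpow_of_exponent_ge h0 h (by norm_num))
      (Real.rpow_le_rpow_of_exponent_ge h0 h (by norm_num)))

theorem decay_mul_le_cutoff {T m n : ℝ} (hT : 0 < T) (hm : 0 < m) (hmn : m ≤ n) :
    decay T (m * n) ≤ cutoff T m := by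
  refine le_trans ?_ (min_rpow_le_cutoff hT hm)
  have h1 : T ^ 2 / (m * n) ≤ (T / m) ^ 2 := by
    rw [div_pow]
    exact div_le_div_of_nonneg_left (by positivity) (by positivity) (by nlinarith)
  have h0 : 0 ≤ T ^ 2 / (m * n) := by have := hm.trans_le hmn; positivity
  refine min_le_min ?_ ?_
  · refine (Real.rpow_le_rpow h0 h1 (by norm_num)).trans (le_of_eq ?_)
    rw [← Real.rpow_natCast, ← Real.rpow_mul (by positivity)]
    norm_num
  · rw [Real.rpow_two]; exact h1

theorem decay_div_sqrt {T x : ℝ} (hT : 0 < T) (hx : 0 < x) :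
    decay T x / √x = cutoff (T ^ 2) x / T := by
  have hs : 0 < √x := Real.sqrt_pos.2 hx
  have hX : 0 < T ^ 2 / x := by positivity
  have e : T / √x = (T ^ 2 / x) ^ (1 / 2 : ℝ) := by
    rw [← Real.sqrt_eq_rpow, Real.sqrt_div (by positivity), Real.sqrt_sq hT.le]
  have h : decay T x * (T / √x) = cutoff (T ^ 2) x := by
    rw [e, decay, cutoff, min_mul_of_nonneg _ _ (by positivity), ← Real.rpow_add hX]
    congr 1
    · norm_num
    · nth_rewrite 1 [← Real.rpow_one (T ^ 2 / x)]
      rw [← Real.rpow_add hX]; norm_num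
  rw [← h]
  field_simp

/-- The bound for the contribution of a pair of integers off the diagonal. -/
noncomputable def pairBound (T : ℝ) (p : ℕ × ℕ) : ℝ :=
  divisorFun 2 p.1 * divisorFun 2 p.2 / √(p.1 * p.2) *
    (decay T (p.1 * p.2) / |Real.log p.2 - Real.log p.1|)

theorem pairBound_nonneg (T : ℝ) (p : ℕ × ℕ) : 0 ≤ pairBound T p := by
  unfold pairBound
  have h1 := divisorFun_nonneg 2 p.1
  have h2 := divisorFun_nonneg 2 p.2
  have h3 : 0 ≤ decay T ((p.1 : ℝ) * p.2) := decay_nonneg (by positivity)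
  positivity

theorem pairBound_swap (T : ℝ) (p : ℕ × ℕ) : pairBound T p.swap = pairBound T p := by
  unfold pairBound
  rw [Prod.fst_swap, Prod.snd_swap, abs_sub_comm, mul_comm (p.2 : ℝ), mul_comm (divisorFun 2 p.2)]

theorem pairBound_near_le {T : ℝ} (hT : 0 < T) {m r : ℕ} (hm : 1 ≤ m) (hr : 1 ≤ r) (hrm : r ≤ m) :
    pairBound T (m, m + r) ≤
      2 * (divisorFun 2 m * divisorFun 2 (m + r) / r) * cutoff T m := by
  have hm0 : (0 : ℝ) < m := by exact_mod_cast hm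
  have hr0 : (0 : ℝ) < r := by exact_mod_cast hr
  have hrm' : (r : ℝ) ≤ m := by exact_mod_cast hrm
  have hn : (0 : ℝ) < m + r := by positivity
  have hlog : (r : ℝ) / (m + r) ≤ Real.log (m + r) - Real.log m := by
    rw [← Real.log_div hn.ne' hm0.ne']
    refine le_trans (le_of_eq ?_) (Real.one_sub_inv_le_log_of_pos (by positivity))
    field_simp; ring
  have hlog0 : 0 < Real.log (m + r) - Real.log m := lt_of_lt_of_le (by positivity) hlog
  have hsq : (m : ℝ) ≤ √(m * (m + r)) := Real.le_sqrt_of_sq_le (by nlinarith)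
  have hdec := decay_mul_le_cutoff hT hm0 (by linarith : (m : ℝ) ≤ m + r)
  have hd0 : 0 ≤ decay T ((m : ℝ) * (m + r)) := decay_nonneg (by positivity)
  have h1 := divisorFun_nonneg 2 m
  have h2 := divisorFun_nonneg 2 (m + r)
  have hc : 0 ≤ cutoff T m := hd0.trans hdec
  unfold pairBound
  push_cast
  rw [abs_of_pos hlog0]
  calc divisorFun 2 m * divisorFun 2 (m + r) / √(m * (m + r)) *
        (decay T (m * (m + r)) / (Real.log (m + r) - Real.log m))
      ≤ divisorFun 2 m * divisorFun 2 (m + r) / m * (cutoff T m / (r / (m + r))) := by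
        gcongr
    _ = divisorFun 2 m * divisorFun 2 (m + r) / r * cutoff T m * ((m + r) / m) := by
        field_simp
    _ ≤ divisorFun 2 m * divisorFun 2 (m + r) / r * cutoff T m * 2 := by
        have : ((m : ℝ) + r) / m ≤ 2 := by rw [div_le_iff₀ hm0]; linarith
        gcongr
    _ = _ := by ring

theorem pairBound_far_le {T : ℝ} (hT : 0 < T) {m n : ℕ} (hm : 1 ≤ m) (hmn : 2 * m < n) :
    pairBound T (m, n) ≤
      2 / T * (divisorFun 2 m * divisorFun 2 n * cutoff (T ^ 2) ((m * n : ℕ) : ℝ)) := by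
  have hm0 : (0 : ℝ) < m := by exact_mod_cast hm
  have hmn' : 2 * (m : ℝ) ≤ n := by exact_mod_cast hmn.le
  have hn0 : (0 : ℝ) < n := by linarith
  have hlog : 1 / 2 ≤ Real.log n - Real.log m := by
    rw [← Real.log_div hn0.ne' hm0.ne']
    have h2 : (2 : ℝ) ≤ n / m := by rwa [le_div_iff₀ hm0]
    have := Real.log_le_log two_pos h2
    have := Real.log_two_gt_d9
    linarith
  have h1 := divisorFun_nonneg 2 m
  have h2 := divisorFun_nonneg 2 n
  have hd0 : 0 ≤ decay T ((m : ℝ) * n) := decay_nonneg (by positivity)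
  unfold pairBound
  dsimp only
  rw [abs_of_pos (by linarith)]
  calc divisorFun 2 m * divisorFun 2 n / √(m * n) *
        (decay T (m * n) / (Real.log n - Real.log m))
      ≤ divisorFun 2 m * divisorFun 2 n / √(m * n) * (decay T (m * n) / (1 / 2)) := by
        gcongr
    _ = 2 * (divisorFun 2 m * divisorFun 2 n) * (decay T (m * n) / √(m * n)) := by ring
    _ = _ := by
        rw [decay_div_sqrt hT (by positivity)]
        push_cast; ring

theorem divisorFun_two_mul_two : divisorFun 2 * divisorFun 2 = divisorFun 4 := by
  unfold divisorFun; rw [← pow_add]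

theorem sum_divisorFun_two_mul_le {M : ℕ} {h : ℕ → ℝ} (hh : ∀ k, 0 ≤ h k) :
    ∑ p ∈ Finset.Icc 1 M ×ˢ Finset.Icc 1 M, divisorFun 2 p.1 * divisorFun 2 p.2 * h (p.1 * p.2) ≤
      ∑ k ∈ Finset.Icc 1 (M * M), divisorFun 4 k * h k := by
  rw [← Finset.sum_fiberwise_of_maps_to (t := Finset.Icc 1 (M * M)) (g := fun p => p.1 * p.2)]
  · refine Finset.sum_le_sum fun k hk => ?_
    rw [← divisorFun_two_mul_two, ArithmeticFunction.mul_apply, Finset.sum_mul]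
    rw [Finset.mem_Icc] at hk
    calc _ = ∑ p ∈ (Finset.Icc 1 M ×ˢ Finset.Icc 1 M).filter (fun p => p.1 * p.2 = k),
          divisorFun 2 p.1 * divisorFun 2 p.2 * h k :=
          Finset.sum_congr rfl fun p hp => by rw [(Finset.mem_filter.1 hp).2]
      _ ≤ _ := by
          refine Finset.sum_le_sum_of_subset_of_nonneg (fun p hp => ?_) fun p _ _ => ?_
          · rw [Nat.mem_divisorsAntidiagonal]
            exact ⟨(Finset.mem_filter.1 hp).2, by omega⟩
          · exact mul_nonneg (mul_nonneg (divisorFun_nonneg _ _) (divisorFun_nonneg _ _)) (hh k)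
  · intro p hp
    rw [Finset.mem_product, Finset.mem_Icc, Finset.mem_Icc] at hp
    rw [Finset.mem_Icc]
    exact ⟨Nat.mul_pos hp.1.1 hp.2.1, Nat.mul_le_mul hp.1.2 hp.2.2⟩

theorem sum_pairBound_far_le {T : ℝ} (hT : 1 ≤ T) (M : ℕ) :
    ∑ p ∈ (Finset.Icc 1 M ×ˢ Finset.Icc 1 M).filter (fun p => 2 * p.1 < p.2), pairBound T p ≤
      663744 * T * (1 + Real.log T) ^ 3 := by
  have hT0 : 0 < T := by linarith
  have hL : 0 ≤ Real.log T := Real.log_nonneg hT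
  have hcut : ∀ k : ℕ, 0 ≤ cutoff (T ^ 2) k := fun k =>
    cutoff_nonneg (by positivity) (Nat.cast_nonneg k)
  have hmain := sum_mul_cutoff_le (a := divisorFun 4) (B := 1) zero_le_one
    (fun K hK => by rw [one_mul]; exact sum_divisorFun_four_le K hK)
    (X := T ^ 2) (one_le_pow₀ hT) (M * M)
  have hp0 : ∀ p : ℕ × ℕ, 0 ≤ divisorFun 2 p.1 * divisorFun 2 p.2 *
      cutoff (T ^ 2) ((p.1 * p.2 : ℕ) : ℝ) := fun p =>
    mul_nonneg (mul_nonneg (divisorFun_nonneg _ _) (divisorFun_nonneg _ _)) (hcut _)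
  calc _ ≤ ∑ p ∈ (Finset.Icc 1 M ×ˢ Finset.Icc 1 M).filter (fun p => 2 * p.1 < p.2),
        2 / T * (divisorFun 2 p.1 * divisorFun 2 p.2 * cutoff (T ^ 2) ((p.1 * p.2 : ℕ) : ℝ)) := by
        refine Finset.sum_le_sum fun p hp => ?_
        obtain ⟨h1, h2⟩ := Finset.mem_filter.1 hp
        rw [Finset.mem_product, Finset.mem_Icc, Finset.mem_Icc] at h1
        exact pairBound_far_le hT0 h1.1.1 h2
    _ ≤ 2 / T * ∑ p ∈ Finset.Icc 1 M ×ˢ Finset.Icc 1 M,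
        (divisorFun 2 p.1 * divisorFun 2 p.2 * cutoff (T ^ 2) ((p.1 * p.2 : ℕ) : ℝ)) := by
        rw [← Finset.mul_sum]
        refine mul_le_mul_of_nonneg_left ?_ (by positivity)
        exact Finset.sum_le_sum_of_subset_of_nonneg (Finset.filter_subset _ _) fun p _ _ => hp0 p
    _ ≤ 2 / T * (41484 * 1 * T ^ 2 * (1 + Real.log (T ^ 2)) ^ 3) := by
        refine mul_le_mul_of_nonneg_left (le_trans ?_ hmain) (by positivity)
        exact sum_divisorFun_two_mul_le (h := fun k => cutoff (T ^ 2) k) hcut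
    _ ≤ 2 / T * (41484 * 1 * T ^ 2 * (2 * (1 + Real.log T)) ^ 3) := by
        have e : Real.log (T ^ 2) = 2 * Real.log T := by rw [Real.log_pow]; norm_num
        rw [e]
        gcongr
        linarith
    _ = _ := by field_simp; ring

theorem sum_pairBound_near_le {T : ℝ} (hT : 1 ≤ T) (M : ℕ) :
    ∑ p ∈ (Finset.Icc 1 M ×ˢ Finset.Icc 1 M).filter (fun p => p.1 < p.2 ∧ p.2 ≤ 2 * p.1),
      pairBound T p ≤ 3982464 * T * (1 + Real.log T) ^ 3 := by
  have hT0 : 0 < T := by linarith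
  have hmain := sum_mul_cutoff_le
    (a := fun m => ∑ r ∈ Finset.Icc 1 m, divisorFun 2 m * divisorFun 2 (m + r) / r) (B := 48)
    (by norm_num) (fun K hK => sum_divisor_correlation_le K hK) hT M
  have hmaps : ∀ p ∈ (Finset.Icc 1 M ×ˢ Finset.Icc 1 M).filter
      (fun p => p.1 < p.2 ∧ p.2 ≤ 2 * p.1), p.1 ∈ Finset.Icc 1 M := fun p hp =>
    (Finset.mem_product.1 (Finset.mem_filter.1 hp).1).1
  rw [← Finset.sum_fiberwise_of_maps_to hmaps]
  calc _ ≤ ∑ m ∈ Finset.Icc 1 M, 2 * ((∑ r ∈ Finset.Icc 1 m,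
        divisorFun 2 m * divisorFun 2 (m + r) / r) * cutoff T m) := by
        refine Finset.sum_le_sum fun m hm => ?_
        rw [Finset.mem_Icc] at hm
        have hcut : 0 ≤ cutoff T m := cutoff_nonneg hT0.le (Nat.cast_nonneg m)
        calc _ ≤ ∑ p ∈ (Finset.Icc 1 m).image (fun r => (m, m + r)), pairBound T p := by
              refine Finset.sum_le_sum_of_subset_of_nonneg (fun p hp => ?_)
                fun p _ _ => pairBound_nonneg T p
              obtain ⟨h1, h2⟩ := Finset.mem_filter.1 hp
              obtain ⟨h3, h4, h5⟩ := Finset.mem_filter.1 h1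
              refine Finset.mem_image.2 ⟨p.2 - m, Finset.mem_Icc.2 ⟨by omega, by omega⟩, ?_⟩
              ext
              · exact h2.symm
              · simp only; omega
          _ = ∑ r ∈ Finset.Icc 1 m, pairBound T (m, m + r) := by
              rw [Finset.sum_image]
              intro a _ b _ hab
              simpa using hab
          _ ≤ ∑ r ∈ Finset.Icc 1 m,
                2 * (divisorFun 2 m * divisorFun 2 (m + r) / r) * cutoff T m :=
              Finset.sum_le_sum fun r hr => pairBound_near_le hT0 hm.1 (Finset.mem_Icc.1 hr).1
                (Finset.mem_Icc.1 hr).2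
          _ = _ := by
              rw [← Finset.sum_mul, ← Finset.mul_sum, mul_assoc]
    _ ≤ _ := by
        rw [← Finset.mul_sum]
        refine (mul_le_mul_of_nonneg_left hmain zero_le_two).trans (le_of_eq ?_)
        ring

/-- The total contribution of the pairs off the diagonal. -/
theorem sum_pairBound_le {T : ℝ} (hT : 1 ≤ T) (S : Finset (ℕ × ℕ))
    (hS : ∀ p ∈ S, 1 ≤ p.1 ∧ 1 ≤ p.2 ∧ p.1 ≠ p.2) :
    ∑ p ∈ S, pairBound T p ≤ 10000000 * T * (1 + Real.log T) ^ 3 := by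
  have hL : 0 ≤ Real.log T := Real.log_nonneg hT
  set M := S.sup (fun p => p.1 + p.2)
  set Q := Finset.Icc 1 M ×ˢ Finset.Icc 1 M with hQ
  have hM : ∀ p ∈ S, p.1 + p.2 ≤ M := fun p hp => Finset.le_sup (f := fun p => p.1 + p.2) hp
  set U := Q.filter (fun p => p.1 < p.2) with hU
  have hUle : ∑ p ∈ U, pairBound T p ≤ 5000000 * T * (1 + Real.log T) ^ 3 := by
    have h1 := sum_pairBound_far_le hT M
    have h2 := sum_pairBound_near_le hT M
    calc _ ≤ ∑ p ∈ Q.filter (fun p => 2 * p.1 < p.2) ∪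
          Q.filter (fun p => p.1 < p.2 ∧ p.2 ≤ 2 * p.1), pairBound T p := by
          refine Finset.sum_le_sum_of_subset_of_nonneg (fun p hp => ?_)
            fun p _ _ => pairBound_nonneg T p
          obtain ⟨h3, h4⟩ := Finset.mem_filter.1 hp
          rw [Finset.mem_union, Finset.mem_filter, Finset.mem_filter]
          by_cases h5 : 2 * p.1 < p.2
          · exact Or.inl ⟨h3, h5⟩
          · exact Or.inr ⟨h3, h4, not_lt.1 h5⟩
      _ ≤ ∑ p ∈ Q.filter (fun p => 2 * p.1 < p.2), pairBound T p +
          ∑ p ∈ Q.filter (fun p => p.1 < p.2 ∧ p.2 ≤ 2 * p.1), pairBound T p := by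
          rw [← Finset.sum_union_inter]
          exact le_add_of_nonneg_right (Finset.sum_nonneg fun p _ => pairBound_nonneg T p)
      _ ≤ 663744 * T * (1 + Real.log T) ^ 3 + 3982464 * T * (1 + Real.log T) ^ 3 :=
          add_le_add h1 h2
      _ ≤ _ := by
          have : 0 ≤ T * (1 + Real.log T) ^ 3 := by positivity
          nlinarith
  calc ∑ p ∈ S, pairBound T p ≤ ∑ p ∈ U ∪ U.image Prod.swap, pairBound T p := by
        refine Finset.sum_le_sum_of_subset_of_nonneg (fun p hp => ?_)
          fun p _ _ => pairBound_nonneg T p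
        obtain ⟨h1, h2, h3⟩ := hS p hp
        have h4 := hM p hp
        rw [Finset.mem_union, Finset.mem_image]
        rcases lt_or_gt_of_ne h3 with h | h
        · left
          simp only [hU, hQ, Finset.mem_filter, Finset.mem_product, Finset.mem_Icc]
          omega
        · right
          refine ⟨p.swap, ?_, p.swap_swap⟩
          simp only [hU, hQ, Finset.mem_filter, Finset.mem_product, Finset.mem_Icc,
            Prod.fst_swap, Prod.snd_swap]
          omega
    _ ≤ ∑ p ∈ U, pairBound T p + ∑ p ∈ U.image Prod.swap, pairBound T p := by
        rw [← Finset.sum_union_inter]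
        exact le_add_of_nonneg_right (Finset.sum_nonneg fun p _ => pairBound_nonneg T p)
    _ = ∑ p ∈ U, pairBound T p + ∑ p ∈ U, pairBound T p := by
        rw [Finset.sum_image (Prod.swap_injective.injOn)]
        simp_rw [pairBound_swap]
    _ ≤ _ := by linarith

/-- The total contribution of the diagonal errors. -/
theorem sum_divisorSq_mul_cutoff_le {T : ℝ} (hT : 1 ≤ T) (M : ℕ) :
    ∑ n ∈ Finset.Icc 1 M, divisorSq n * cutoff T n ≤ 41484 * T * (1 + Real.log T) ^ 3 := by
  have h := sum_mul_cutoff_le (a := divisorSq) (B := 1) zero_le_one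
    (fun K hK => by rw [one_mul]; exact sum_divisorSq_le K hK) hT M
  simpa using h

theorem tendsto_deriv_of_bounded {f : ℕ → ℂ → ℂ} {g : ℂ → ℂ} {c : ℂ} {R M : ℝ} (hR : 0 < R)
    (hf : ∀ᶠ n in atTop, DifferentiableOn ℂ (f n) (Metric.closedBall c R))
    (hg : DifferentiableOn ℂ g (Metric.closedBall c R))
    (hM : ∀ᶠ n in atTop, ∀ z ∈ Metric.sphere c R, ‖f n z‖ ≤ M)
    (hlim : ∀ z ∈ Metric.sphere c R, Tendsto (fun n => f n z) atTop (nhds (g z))) :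
    Tendsto (fun n => deriv (f n) c) atTop (nhds (deriv g c)) := by
  have hpi : (2 * π * Complex.I : ℂ) ≠ 0 := Complex.two_pi_I_ne_zero
  have key : Tendsto (fun n => ∮ z in C(c, R), (1 / (z - c) ^ 2) • f n z) atTop
      (nhds (∮ z in C(c, R), (1 / (z - c) ^ 2) • g z)) := by
    simp only [circleIntegral]
    refine intervalIntegral.tendsto_integral_filter_of_dominated_convergence
      (fun _ => R * (1 / R ^ 2 * M)) ?_ ?_ ?_ ?_
    · filter_upwards [hf] with n hn
      have hc : Continuous (fun θ : ℝ => deriv (circleMap c R) θ •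
          ((1 / (circleMap c R θ - c) ^ 2) • f n (circleMap c R θ))) := by
        have h1 : Continuous (fun θ => f n (circleMap c R θ)) :=
          hn.continuousOn.comp_continuous (continuous_circleMap c R)
            (fun θ => Metric.sphere_subset_closedBall (circleMap_mem_sphere c hR.le θ))
        have h2 : ∀ θ, (circleMap c R θ - c) ^ 2 ≠ 0 := fun θ =>
          pow_ne_zero _ (sub_ne_zero.2 (circleMap_ne_center hR.ne'))
        have h3 : Continuous (fun θ => (1 : ℂ) / (circleMap c R θ - c) ^ 2) :=
          continuous_const.div (((continuous_circleMap c R).sub continuous_const).pow 2) h2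
        simp only [deriv_circleMap]
        exact ((continuous_circleMap 0 R).mul continuous_const).smul (h3.smul h1)
      exact hc.aestronglyMeasurable
    · filter_upwards [hM] with n hn
      refine Eventually.of_forall fun θ _ => ?_
      rw [norm_smul, norm_smul, deriv_circleMap, norm_mul, norm_circleMap_zero, Complex.norm_I,
        mul_one, norm_div, norm_pow, circleMap_sub_center, norm_circleMap_zero, norm_one,
        abs_of_pos hR]
      gcongr
      exact hn _ (circleMap_mem_sphere c hR.le θ)
    · exact intervalIntegrable_const
    · refine Eventually.of_forall fun θ _ => ?_
      exact ((hlim _ (circleMap_mem_sphere c hR.le θ)).const_smul _).const_smul _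
  rw [hg.deriv_eq_smul_circleIntegral hR] at key
  have key2 := key.const_smul (2 * π * Complex.I : ℂ)⁻¹
  rw [smul_smul, inv_mul_cancel₀ hpi, one_smul] at key2
  refine key2.congr' ?_
  filter_upwards [hf] with n hn
  rw [hn.deriv_eq_smul_circleIntegral hR, smul_smul, inv_mul_cancel₀ hpi, one_smul]

theorem add_natCast_ne_zero {s : ℂ} (hs : 0 < s.re) (j : ℕ) : s + j ≠ 0 := by
  intro h
  have := congrArg Complex.re h
  simp at this
  have : (0 : ℝ) ≤ j := j.cast_nonneg
  linarith

theorem norm_GammaSeq_le {s : ℂ} (hs : 0 < s.re) {n : ℕ} (hn : n ≠ 0) :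
    ‖Complex.GammaSeq s n‖ ≤ Real.Gamma s.re := by
  have hn0 : (0 : ℝ) < n := by exact_mod_cast Nat.pos_of_ne_zero hn
  have hσ : ∀ j : ℕ, 0 < s.re + j := fun j => by positivity
  have h1 : ‖Complex.GammaSeq s n‖ ≤
      (n : ℝ) ^ s.re * n.factorial / ∏ j ∈ Finset.range (n + 1), (s.re + j) := by
    rw [Complex.GammaSeq, norm_div, norm_mul, norm_prod, Complex.norm_natCast,
      Complex.norm_natCast_cpow_of_pos (Nat.pos_of_ne_zero hn)]
    refine div_le_div_of_nonneg_left (by positivity) (Finset.prod_pos fun j _ => hσ j) ?_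
    refine Finset.prod_le_prod (fun j _ => (hσ j).le) fun j _ => ?_
    have := Complex.re_le_norm (s + j)
    simpa using this
  refine h1.trans ?_
  have h2 := Real.BohrMollerup.ge_logGammaSeq Real.convexOn_log_Gamma
    (fun {y} hy => by
      rw [Function.comp_apply, Function.comp_apply, Real.Gamma_add_one hy.ne',
        Real.log_mul hy.ne' (Real.Gamma_pos_of_pos hy).ne', add_comm]) hs hn
  simp only [Function.comp_apply, Real.Gamma_one, Real.log_one, zero_add] at h2
  have hP : 0 < ∏ j ∈ Finset.range (n + 1), (s.re + j) := Finset.prod_pos fun j _ => hσ j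
  rw [← Real.log_le_log_iff (by positivity) (Real.Gamma_pos_of_pos hs)]
  refine le_trans (le_of_eq ?_) h2
  rw [Real.BohrMollerup.logGammaSeq, Real.log_div (by positivity) hP.ne',
    Real.log_mul (by positivity) (by positivity), Real.log_rpow hn0,
    Real.log_prod fun j _ => (hσ j).ne']

theorem differentiableAt_Gamma_of_re_pos {s : ℂ} (hs : 0 < s.re) :
    DifferentiableAt ℂ Complex.Gamma s := by
  refine Complex.differentiableAt_Gamma s fun m hm => ?_
  rw [hm] at hs
  simp at hs
  have : (0 : ℝ) ≤ m := m.cast_nonneg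
  linarith

theorem hasDerivAt_GammaSeq {s : ℂ} (hs : 0 < s.re) {n : ℕ} (hn : n ≠ 0) :
    HasDerivAt (fun s => Complex.GammaSeq s n)
      (Complex.GammaSeq s n * (Complex.log n - ∑ j ∈ Finset.range (n + 1), 1 / (s + j))) s := by
  have hn0 : (n : ℂ) ≠ 0 := by exact_mod_cast hn
  have hP : HasDerivAt (fun s : ℂ => ∏ j ∈ Finset.range (n + 1), (s + j))
      (∑ i ∈ Finset.range (n + 1), (∏ j ∈ (Finset.range (n + 1)).erase i, (s + j)) • (1 : ℂ)) s :=
    HasDerivAt.fun_finsetProd fun j _ => (hasDerivAt_id s).add_const (j : ℂ)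
  have hP0 : ∏ j ∈ Finset.range (n + 1), (s + j) ≠ 0 :=
    Finset.prod_ne_zero_iff.2 fun j _ => add_natCast_ne_zero hs j
  have hsum : ∑ i ∈ Finset.range (n + 1), (∏ j ∈ (Finset.range (n + 1)).erase i, (s + j)) • (1 : ℂ)
      = (∏ j ∈ Finset.range (n + 1), (s + j)) * ∑ j ∈ Finset.range (n + 1), 1 / (s + j) := by
    rw [Finset.mul_sum]
    refine Finset.sum_congr rfl fun i hi => ?_
    rw [← Finset.mul_prod_erase _ _ hi, smul_eq_mul]
    have := add_natCast_ne_zero hs i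
    field_simp
  rw [hsum] at hP
  have hA := ((hasDerivAt_id s).const_cpow (Or.inl hn0)).mul_const ((n.factorial : ℕ) : ℂ)
  refine (hA.div hP hP0).congr_deriv ?_
  simp only [Complex.GammaSeq, id]
  field_simp

theorem tendsto_logDeriv_GammaSeq {z : ℂ} (hz : 0 < z.re) :
    Tendsto (fun n : ℕ => Complex.log n - ∑ j ∈ Finset.range (n + 1), 1 / (z + j)) atTop
      (nhds (Complex.digamma z)) := by
  set R := z.re / 2 with hR
  have hR0 : 0 < R := by positivity
  have hre : ∀ w ∈ Metric.closedBall z R, R ≤ w.re ∧ w.re ≤ 3 * R := by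
    intro w hw
    have h1 := (Complex.abs_re_le_norm (w - z)).trans (by simpa [dist_eq_norm] using hw)
    rw [Complex.sub_re, abs_le] at h1
    constructor <;> linarith
  obtain ⟨M, hM⟩ : ∃ M, ∀ x ∈ Set.Icc R (3 * R), Real.Gamma x ≤ M := by
    have hc : ContinuousOn Real.Gamma (Set.Icc R (3 * R)) := fun x hx => by
      refine (Real.differentiableAt_Gamma fun m => ?_).continuousAt.continuousWithinAt
      have : (0 : ℝ) ≤ m := m.cast_nonneg
      have := hx.1
      intro h; linarith
    obtain ⟨M, hM⟩ := isCompact_Icc.bddAbove_image hc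
    exact ⟨M, fun x hx => hM (Set.mem_image_of_mem _ hx)⟩
  have hd := tendsto_deriv_of_bounded (f := fun n s => Complex.GammaSeq s n) (g := Complex.Gamma)
    (c := z) (M := M) hR0
    (by
      filter_upwards [eventually_ne_atTop 0] with n hn w hw
      exact (hasDerivAt_GammaSeq (hR0.trans_le (hre w hw).1) hn).differentiableAt.differentiableWithinAt)
    (fun w hw =>
      (differentiableAt_Gamma_of_re_pos (hR0.trans_le (hre w hw).1)).differentiableWithinAt)
    (by
      filter_upwards [eventually_ne_atTop 0] with n hn w hw
      have h := hre w (Metric.sphere_subset_closedBall hw)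
      exact (norm_GammaSeq_le (hR0.trans_le h.1) hn).trans (hM _ h))
    (fun w _ => Complex.GammaSeq_tendsto_Gamma w)
  have h0 : Complex.Gamma z ≠ 0 := Complex.Gamma_ne_zero_of_re_pos hz
  have hG := Complex.GammaSeq_tendsto_Gamma z
  rw [Complex.digamma_def, logDeriv_apply]
  refine (hd.div hG h0).congr' ?_
  filter_upwards [eventually_ne_atTop 0, hG.eventually_ne h0] with n hn hn'
  rw [Pi.div_apply, (hasDerivAt_GammaSeq hz hn).deriv, mul_div_cancel_left₀ _ hn']

theorem norm_log_add_one_sub_le {z : ℂ} (hz : 0 < z.re) :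
    ‖Complex.log (z + 1) - Complex.log z - 1 / z‖ ≤ 1 / ‖z‖ ^ 2 := by
  have hz0 : z ≠ 0 := by rintro rfl; simp at hz
  have hre : ∀ θ : ℝ, 0 ≤ θ → 0 < (z + θ).re := fun θ hθ => by simp; linarith
  have hd : ∀ θ ∈ Set.Icc (0 : ℝ) 1, HasDerivWithinAt
      (fun θ : ℝ => Complex.log (z + θ) - θ / z) (1 / (z + θ) - 1 / z) (Set.Icc 0 1) θ := by
    intro θ hθ
    have h1 : HasDerivAt (fun θ : ℝ => z + (θ : ℂ)) 1 θ :=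
      (Complex.ofRealCLM.hasDerivAt (x := θ)).const_add z
    have h2 := h1.clog_real (Or.inl (hre θ hθ.1))
    have h3 : HasDerivAt (fun θ : ℝ => (θ : ℂ) / z) (1 / z) θ :=
      (Complex.ofRealCLM.hasDerivAt (x := θ)).div_const z
    exact (h2.sub h3).hasDerivWithinAt
  have hb : ∀ θ ∈ Set.Icc (0 : ℝ) 1, ‖1 / (z + θ) - 1 / z‖ ≤ 1 / ‖z‖ ^ 2 := by
    intro θ hθ
    have h0 : z + θ ≠ 0 := fun h => by have := hre θ hθ.1; rw [h] at this; simp at this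
    have hn : ‖z‖ ≤ ‖z + θ‖ := by
      rw [← sq_le_sq₀ (norm_nonneg _) (norm_nonneg _), Complex.sq_norm, Complex.sq_norm,
        Complex.normSq_apply, Complex.normSq_apply]
      simp
      nlinarith [hθ.1, mul_nonneg hz.le hθ.1]
    have e : 1 / (z + θ) - 1 / z = -θ / ((z + θ) * z) := by field_simp; ring
    have hzn : 0 < ‖z‖ := norm_pos_iff.2 hz0
    rw [e, norm_div, norm_neg, norm_mul, Complex.norm_real, Real.norm_of_nonneg hθ.1, sq]
    gcongr
    exact hθ.2
  have := Convex.norm_image_sub_le_of_norm_hasDerivWithin_le hd hb (convex_Icc 0 1)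
    (Set.left_mem_Icc.2 zero_le_one) (Set.right_mem_Icc.2 zero_le_one)
  simp only [Complex.ofReal_one, Complex.ofReal_zero, add_zero, zero_div, sub_zero, norm_one,
    mul_one] at this
  rwa [sub_right_comm] at this

theorem sum_one_div_add_sq_le {a : ℝ} (ha : 0 < a) (n : ℕ) :
    ∑ j ∈ Finset.range (n + 1), 1 / (a + j) ^ 2 ≤ 1 / a ^ 2 + 1 / a - 1 / (a + n) := by
  induction n with
  | zero => simp
  | succ n ih =>
    rw [Finset.sum_range_succ]
    have h0 : (0 : ℝ) < a + n := by positivity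
    have h1 : (0 : ℝ) < a + (n + 1 : ℕ) := by positivity
    have : 1 / (a + (n + 1 : ℕ)) ^ 2 ≤ 1 / (a + n) - 1 / (a + (n + 1 : ℕ)) := by
      rw [div_sub_div _ _ h0.ne' h1.ne', div_le_div_iff₀ (by positivity) (by positivity)]
      push_cast
      push_cast at h1
      nlinarith
    linarith

theorem norm_digamma_sub_log_le {z : ℂ} (hz : 1 / 8 ≤ z.re) :
    ‖Complex.digamma z - Complex.log z‖ ≤ 18 / ‖z‖ := by
  have hz0 : 0 < z.re := by linarith
  have hzn8 : 1 / 8 ≤ ‖z‖ := hz.trans (Complex.re_le_norm z)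
  have hzn : 0 < ‖z‖ := by linarith
  have hre : ∀ j : ℕ, 0 < (z + j).re := fun j => by simp; positivity
  have htel : ∀ n : ℕ, Complex.log (z + (n + 1 : ℕ)) - Complex.log z -
      ∑ j ∈ Finset.range (n + 1), 1 / (z + j) =
      ∑ j ∈ Finset.range (n + 1),
        (Complex.log (z + j + 1) - Complex.log (z + j) - 1 / (z + j)) := by
    intro n
    have h := Finset.sum_range_sub (fun j : ℕ => Complex.log (z + j)) (n + 1)
    rw [Nat.cast_zero, add_zero] at h
    rw [← h, ← Finset.sum_sub_distrib]
    refine Finset.sum_congr rfl fun j _ => ?_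
    push_cast
    rw [add_assoc]
  have hbd : ∀ n : ℕ, ‖Complex.log (z + (n + 1 : ℕ)) - Complex.log z -
      ∑ j ∈ Finset.range (n + 1), 1 / (z + j)‖ ≤ 18 / ‖z‖ := by
    intro n
    rw [htel]
    calc _ ≤ ∑ j ∈ Finset.range (n + 1), 2 * (1 / (‖z‖ + j) ^ 2) := by
          refine norm_sum_le_of_le _ fun j _ => (norm_log_add_one_sub_le (hre j)).trans ?_
          have h1 : (‖z‖ + j) ^ 2 ≤ 2 * ‖z + j‖ ^ 2 := by
            have h2 : ‖z + j‖ ^ 2 = ‖z‖ ^ 2 + 2 * z.re * j + j ^ 2 := by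
              rw [Complex.sq_norm, Complex.sq_norm, Complex.normSq_apply, Complex.normSq_apply]
              simp; ring
            have hj : (0 : ℝ) ≤ j := j.cast_nonneg
            rw [h2]
            nlinarith [sq_nonneg (‖z‖ - j), mul_nonneg hz0.le hj]
          have h0 : 0 < ‖z + j‖ := norm_pos_iff.2 (add_natCast_ne_zero hz0 j)
          rw [mul_one_div, div_le_div_iff₀ (by positivity) (by positivity)]
          linarith
      _ ≤ 2 * (1 / ‖z‖ ^ 2 + 1 / ‖z‖) := by
          rw [← Finset.mul_sum]
          have := sum_one_div_add_sq_le hzn n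
          have : 0 ≤ 1 / (‖z‖ + n) := by positivity
          linarith
      _ ≤ 18 / ‖z‖ := by
          have h1 : 1 / ‖z‖ ≤ 8 := by rw [div_le_iff₀ hzn]; linarith
          have h2 : 1 / ‖z‖ ^ 2 ≤ 8 * (1 / ‖z‖) := by
            rw [sq, ← one_div_mul_one_div]; gcongr
          have : 18 / ‖z‖ = 18 * (1 / ‖z‖) := by ring
          rw [this]; linarith
  have hlim : Tendsto (fun n : ℕ => Complex.log (z + (n + 1 : ℕ)) - Complex.log n) atTop
      (nhds 0) := by
    have h1 : Tendsto (fun n : ℕ => Complex.log (1 + (z + 1) / n)) atTop (nhds (Complex.log 1)) := by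
      refine Tendsto.clog ?_ (by simp)
      have := (tendsto_const_div_atTop_nhds_zero_nat (z + 1)).const_add 1
      simpa using this
    rw [Complex.log_one] at h1
    refine h1.congr' ?_
    filter_upwards [eventually_ne_atTop 0] with n hn
    have hn0 : (0 : ℝ) < n := by exact_mod_cast Nat.pos_of_ne_zero hn
    have hw : (0 : ℝ) < (1 + (z + 1) / n).re := by
      have : ((z + 1) / (n : ℂ)).re = (z.re + 1) / n := by
        rw [← Complex.ofReal_natCast, Complex.div_ofReal_re]; simp
      rw [Complex.add_re, this, Complex.one_re]
      positivity
    have hw0 : 1 + (z + 1) / n ≠ 0 := fun h => by rw [h] at hw; simp at hw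
    have e : z + (n + 1 : ℕ) = ((n : ℝ) : ℂ) * (1 + (z + 1) / n) := by
      have : (n : ℂ) ≠ 0 := by exact_mod_cast hn
      push_cast
      field_simp
      ring
    rw [e, Complex.log_ofReal_mul hn0 hw0, ← Complex.ofReal_natCast n, ← Complex.ofReal_log hn0.le]
    ring
  have hmain : Tendsto (fun n : ℕ => Complex.log (z + (n + 1 : ℕ)) - Complex.log z -
      ∑ j ∈ Finset.range (n + 1), 1 / (z + j)) atTop
      (nhds (0 + (Complex.digamma z - Complex.log z))) := by
    refine (hlim.add ((tendsto_logDeriv_GammaSeq hz0).sub_const (Complex.log z))).congr fun n => ?_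
    ring
  rw [zero_add] at hmain
  exact le_of_tendsto hmain.norm (Eventually.of_forall hbd)

/-- The argument `1/4 + w/2 + it/2` of the Gamma factors. -/
noncomputable def gammaArg (t : ℝ) (w : ℂ) : ℂ := 1 / 4 + w / 2 + t / 2 * Complex.I

theorem gammaArg_re (t : ℝ) (w : ℂ) : (gammaArg t w).re = 1 / 4 + w.re / 2 := by
  simp [gammaArg]

theorem gammaArg_im (t : ℝ) (w : ℂ) : (gammaArg t w).im = w.im / 2 + t / 2 := by
  simp [gammaArg]

theorem gammaArg_re_ge {t : ℝ} {w : ℂ} (hw : -1 / 4 ≤ w.re) : 1 / 8 ≤ (gammaArg t w).re := by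
  rw [gammaArg_re]; linarith

theorem abs_le_mul_norm_gammaArg {t : ℝ} {w : ℂ} (hw : -1 / 4 ≤ w.re) :
    |t| ≤ 16 * (1 + |w.im|) * ‖gammaArg t w‖ := by
  have h1 : 1 / 8 ≤ ‖gammaArg t w‖ := (gammaArg_re_ge hw).trans (Complex.re_le_norm _)
  have h2 := Complex.abs_im_le_norm (gammaArg t w)
  rw [gammaArg_im] at h2
  have hv := abs_nonneg w.im
  rcases le_or_gt |w.im| (|t| / 2) with h | h
  · have h3 : |t| / 4 ≤ |w.im / 2 + t / 2| := by
      have := abs_sub_abs_le_abs_sub (t / 2) (-(w.im / 2))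
      rw [abs_neg, abs_div, abs_div, abs_two] at this
      have e : w.im / 2 + t / 2 = t / 2 - -(w.im / 2) := by ring
      rw [e]; linarith
    nlinarith [mul_nonneg hv (norm_nonneg (gammaArg t w))]
  · nlinarith [mul_nonneg hv (norm_nonneg (gammaArg t w))]

theorem norm_gammaArg_le {t : ℝ} {w : ℂ} (ht : 1 ≤ |t|) (hw : -1 / 4 ≤ w.re) (hw' : w.re ≤ 1) :
    ‖gammaArg t w‖ ≤ 2 * |t| * (1 + |w.im|) := by
  have h := Complex.norm_le_abs_re_add_abs_im (gammaArg t w)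
  have h8 := gammaArg_re_ge (t := t) hw
  rw [abs_of_nonneg (by linarith : 0 ≤ (gammaArg t w).re), gammaArg_re, gammaArg_im] at h
  have h3 : |w.im / 2 + t / 2| ≤ |w.im| / 2 + |t| / 2 := by
    refine (abs_add_le _ _).trans (le_of_eq ?_)
    rw [abs_div, abs_div, abs_two]
  nlinarith [abs_nonneg w.im, mul_nonneg (abs_nonneg w.im) (sub_nonneg.2 ht)]

theorem norm_digamma_gammaArg_sub_log_le {t : ℝ} {w : ℂ} (ht : 1 ≤ |t|) (hw : -1 / 4 ≤ w.re)
    (hw' : w.re ≤ 1) :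
    ‖Complex.digamma (gammaArg t w) - Real.log |t|‖ ≤ 152 + Real.log (1 + |w.im|) := by
  set z := gammaArg t w with hz
  have h8 : 1 / 8 ≤ z.re := gammaArg_re_ge hw
  have hn8 : 1 / 8 ≤ ‖z‖ := h8.trans (Complex.re_le_norm _)
  have hn0 : 0 < ‖z‖ := by linarith
  have hv := abs_nonneg w.im
  have hv1 : 0 < 1 + |w.im| := by linarith
  have h1 := norm_digamma_sub_log_le h8
  have h2 : 18 / ‖z‖ ≤ 144 := by rw [div_le_iff₀ hn0]; linarith
  have hL : |Real.log ‖z‖ - Real.log (|t|)| ≤ 3 + Real.log (1 + |w.im|) := by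
    have a1 := Real.log_le_log (by linarith) (abs_le_mul_norm_gammaArg (t := t) hw)
    have a2 := Real.log_le_log hn0 (norm_gammaArg_le ht hw hw')
    rw [Real.log_mul (by positivity) hn0.ne', Real.log_mul (by norm_num) (by positivity)] at a1
    rw [Real.log_mul (by positivity) (by positivity), Real.log_mul two_ne_zero (by positivity)] at a2
    have h16 : Real.log 16 = 4 * Real.log 2 := by
      rw [← Real.log_rpow two_pos]; norm_num
    have := Real.log_two_lt_d9
    rw [abs_le]; constructor <;> linarith
  have hlog : Complex.log z - Real.log |t| =
      ((Real.log ‖z‖ - Real.log |t| : ℝ) : ℂ) + (Complex.arg z : ℂ) * Complex.I := by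
    rw [Complex.log]; push_cast; ring
  have h3 : ‖Complex.log z - Real.log |t|‖ ≤ 3 + Real.log (1 + |w.im|) + 4 := by
    rw [hlog]
    refine (norm_add_le _ _).trans (add_le_add ?_ ?_)
    · rw [Complex.norm_real]; exact hL
    · rw [norm_mul, Complex.norm_I, mul_one, Complex.norm_real]
      exact (Complex.abs_arg_le_pi z).trans (by have := Real.pi_lt_four; linarith)
  calc _ = ‖(Complex.digamma z - Complex.log z) + (Complex.log z - Real.log |t|)‖ := by ring_nf
    _ ≤ _ := norm_add_le _ _
    _ ≤ 144 + (3 + Real.log (1 + |w.im|) + 4) := add_le_add (h1.trans h2) h3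
    _ ≤ _ := by linarith

theorem hasDerivAt_Gamma_digamma {z : ℂ} (hz : 0 < z.re) :
    HasDerivAt Complex.Gamma (Complex.Gamma z * Complex.digamma z) z := by
  have h := (differentiableAt_Gamma_of_re_pos hz).hasDerivAt
  rwa [Complex.digamma_def, logDeriv_apply, mul_div_cancel₀ _ (Complex.Gamma_ne_zero_of_re_pos hz)]

/-- The product of the two Gamma factors. -/
noncomputable def gammaPair (t : ℝ) (w : ℂ) : ℂ :=
  Complex.Gamma (gammaArg t w) * Complex.Gamma (gammaArg (-t) w)

theorem gammaPair_ne_zero {t : ℝ} {w : ℂ} (hw : -1 / 4 ≤ w.re) : gammaPair t w ≠ 0 := by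
  have h : ∀ t, 0 < (gammaArg t w).re := fun t => by
    have := gammaArg_re_ge (t := t) hw; linarith
  exact mul_ne_zero (Complex.Gamma_ne_zero_of_re_pos (h _)) (Complex.Gamma_ne_zero_of_re_pos (h _))

theorem hasDerivAt_gammaPair {t : ℝ} {w : ℂ} (hw : -1 / 4 ≤ w.re) :
    HasDerivAt (gammaPair t) (gammaPair t w *
      ((Complex.digamma (gammaArg t w) + Complex.digamma (gammaArg (-t) w)) / 2)) w := by
  have h : ∀ t, 0 < (gammaArg t w).re := fun t => by
    have := gammaArg_re_ge (t := t) hw; linarith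
  have hg : ∀ t, HasDerivAt (gammaArg t) (1 / 2) w := fun t =>
    (((hasDerivAt_id w).div_const 2).const_add (1 / 4)).add_const _
  have h1 := (hasDerivAt_Gamma_digamma (h t)).comp w (hg t)
  have h2 := (hasDerivAt_Gamma_digamma (h (-t))).comp w (hg (-t))
  refine (h1.mul h2).congr_deriv ?_
  simp only [gammaPair, Function.comp_apply]
  ring

theorem norm_gammaPair_le {t : ℝ} {w : ℂ} (ht : 1 ≤ t) (hw : -1 / 4 ≤ w.re) (hw' : w.re ≤ 1) :
    ‖gammaPair t w‖ ≤
      ‖gammaPair t 0‖ * t ^ w.re * Real.exp (‖w‖ * (152 + Real.log (1 + |w.im|))) := by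
  have ht0 : 0 < t := by linarith
  have htc : (t : ℂ) ≠ 0 := by exact_mod_cast ht0.ne'
  set K := ‖w‖ * (152 + Real.log (1 + |w.im|)) with hK
  let F : ℝ → ℂ := fun θ => gammaPair t (θ * w) * (t : ℂ) ^ (-(θ * w))
  have hre : ∀ θ ∈ Set.Icc (0 : ℝ) 1, -1 / 4 ≤ ((θ : ℂ) * w).re ∧ ((θ : ℂ) * w).re ≤ 1 ∧
      |((θ : ℂ) * w).im| ≤ |w.im| := by
    intro θ hθ
    simp only [Complex.mul_re, Complex.mul_im, Complex.ofReal_re, Complex.ofReal_im, zero_mul,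
      sub_zero, add_zero, abs_mul]
    rw [abs_of_nonneg hθ.1]
    refine ⟨?_, ?_, mul_le_of_le_one_left (abs_nonneg _) hθ.2⟩
    · nlinarith [hθ.1, hθ.2]
    · nlinarith [hθ.1, hθ.2]
  have hF : ∀ θ ∈ Set.Icc (0 : ℝ) 1, HasDerivAt F (F θ * (w *
      ((Complex.digamma (gammaArg t (θ * w)) - Real.log |t| +
        (Complex.digamma (gammaArg (-t) (θ * w)) - Real.log |-t|)) / 2))) θ := by
    intro θ hθ
    have h1 : HasDerivAt (fun θ : ℝ => (θ : ℂ) * w) (1 * w) θ :=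
      (Complex.ofRealCLM.hasDerivAt (x := θ)).mul_const w
    have h2 := (hasDerivAt_gammaPair (t := t) (hre θ hθ).1).comp θ h1
    have h3 := ((hasDerivAt_neg ((θ : ℂ) * w)).const_cpow (c := (t : ℂ)) (Or.inl htc)).comp θ h1
    refine (h2.mul h3).congr_deriv ?_
    simp only [F, Function.comp_apply]
    rw [abs_neg, abs_of_pos ht0, Complex.ofReal_log ht0.le]
    ring
  have hb : ∀ θ ∈ Set.Ico (0 : ℝ) 1, ‖F θ * (w *
      ((Complex.digamma (gammaArg t (θ * w)) - Real.log |t| +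
        (Complex.digamma (gammaArg (-t) (θ * w)) - Real.log |-t|)) / 2))‖ ≤ K * ‖F θ‖ + 0 := by
    intro θ hθ
    obtain ⟨a1, a2, a3⟩ := hre θ (Set.Ico_subset_Icc_self hθ)
    have b1 := norm_digamma_gammaArg_sub_log_le (t := t) (by rwa [abs_of_pos ht0]) a1 a2
    have b2 := norm_digamma_gammaArg_sub_log_le (t := -t) (by rwa [abs_neg, abs_of_pos ht0]) a1 a2
    have b3 : Real.log (1 + |((θ : ℂ) * w).im|) ≤ Real.log (1 + |w.im|) :=
      Real.log_le_log (by positivity) (by linarith)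
    rw [add_zero, norm_mul (F θ), norm_mul w, norm_div, Complex.norm_ofNat, mul_comm K]
    refine mul_le_mul_of_nonneg_left (mul_le_mul_of_nonneg_left ?_ (norm_nonneg _)) (norm_nonneg _)
    rw [div_le_iff₀ two_pos]
    refine (norm_add_le _ _).trans ?_
    linarith
  have hgr := norm_le_gronwallBound_of_norm_deriv_right_le (f := F) (δ := ‖F 0‖) (K := K) (ε := 0)
    (a := 0) (b := 1) (fun θ hθ => (hF θ hθ).continuousAt.continuousWithinAt)
    (fun θ hθ => (hF θ (Set.Ico_subset_Icc_self hθ)).hasDerivWithinAt) le_rfl hb 1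
    (Set.right_mem_Icc.2 zero_le_one)
  rw [gronwallBound_ε0, sub_zero, mul_one] at hgr
  have hF0 : F 0 = gammaPair t 0 := by simp [F]
  have hF1 : ‖F 1‖ = ‖gammaPair t w‖ * t ^ (-w.re) := by
    simp only [F, Complex.ofReal_one, one_mul, norm_mul]
    rw [Complex.norm_cpow_eq_rpow_re_of_pos ht0, Complex.neg_re]
  rw [hF0, hF1, Real.rpow_neg ht0.le, ← div_eq_mul_inv, div_le_iff₀ (by positivity)] at hgr
  linarith

theorem hasDerivAt_gammaPair_real {t : ℝ} {w : ℂ} (hw : -1 / 4 ≤ w.re) :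
    HasDerivAt (fun t : ℝ => gammaPair t w) (gammaPair t w *
      (Complex.I / 2 *
        (Complex.digamma (gammaArg t w) - Complex.digamma (gammaArg (-t) w)))) t := by
  have h : ∀ t, 0 < (gammaArg t w).re := fun t => by
    have := gammaArg_re_ge (t := t) hw; linarith
  have hg : ∀ t : ℝ, HasDerivAt (fun t => gammaArg t w) (1 / 2 * Complex.I) t := fun t =>
    (((Complex.ofRealCLM.hasDerivAt (x := t)).div_const 2).mul_const Complex.I).const_add _
  have hg' : HasDerivAt (fun t => gammaArg (-t) w) (-(1 / 2 * Complex.I)) t := by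
    have := (hg (-t)).scomp t (hasDerivAt_neg t)
    simpa [Function.comp_def] using this
  have h1 := (hasDerivAt_Gamma_digamma (h t)).comp t (hg t)
  have h2 := (hasDerivAt_Gamma_digamma (h (-t))).comp t hg'
  refine (h1.mul h2).congr_deriv ?_
  simp only [gammaPair, Function.comp_apply]
  ring

theorem norm_log_gammaArg_sub_le {t : ℝ} {w : ℂ} (ht : 1 ≤ |t|) (hw : -1 / 4 ≤ w.re) :
    ‖Complex.log (gammaArg t w) - Complex.log (gammaArg t 0)‖ ≤
      8 * (1 + |w.im|) * ‖w‖ / |t| := by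
  have hre : ∀ θ ∈ Set.Icc (0 : ℝ) 1, -1 / 4 ≤ ((θ : ℂ) * w).re ∧
      |((θ : ℂ) * w).im| ≤ |w.im| := by
    intro θ hθ
    simp only [Complex.mul_re, Complex.mul_im, Complex.ofReal_re, Complex.ofReal_im, zero_mul,
      sub_zero, add_zero, abs_mul]
    rw [abs_of_nonneg hθ.1]
    refine ⟨?_, mul_le_of_le_one_left (abs_nonneg _) hθ.2⟩
    nlinarith [hθ.1, hθ.2]
  have ht0 : 0 < |t| := by linarith
  have hd : ∀ θ ∈ Set.Icc (0 : ℝ) 1, HasDerivWithinAt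
      (fun θ : ℝ => Complex.log (gammaArg t (θ * w))) ((w / 2) / gammaArg t (θ * w))
      (Set.Icc 0 1) θ := by
    intro θ hθ
    have h1 : HasDerivAt (fun θ : ℝ => gammaArg t (θ * w)) (w / 2) θ := by
      have := ((((Complex.ofRealCLM.hasDerivAt (x := θ)).mul_const w).div_const 2).const_add
        (1 / 4)).add_const ((t : ℂ) / 2 * Complex.I)
      simpa [gammaArg] using this
    have h8 := gammaArg_re_ge (t := t) (hre θ hθ).1
    exact (h1.clog_real (Or.inl (by linarith))).hasDerivWithinAt
  have hb : ∀ θ ∈ Set.Icc (0 : ℝ) 1, ‖(w / 2) / gammaArg t (θ * w)‖ ≤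
      8 * (1 + |w.im|) * ‖w‖ / |t| := by
    intro θ hθ
    obtain ⟨a1, a2⟩ := hre θ hθ
    have h8 := (gammaArg_re_ge (t := t) a1).trans (Complex.re_le_norm _)
    have h1 := abs_le_mul_norm_gammaArg (t := t) a1
    have h2 : |t| ≤ 16 * (1 + |w.im|) * ‖gammaArg t (θ * w)‖ := by
      refine h1.trans ?_
      gcongr
    rw [norm_div, norm_div, Complex.norm_ofNat, div_le_div_iff₀ (by linarith) ht0]
    nlinarith [mul_le_mul_of_nonneg_left h2 (norm_nonneg w)]
  have := Convex.norm_image_sub_le_of_norm_hasDerivWithin_le hd hb (convex_Icc 0 1)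
    (Set.left_mem_Icc.2 zero_le_one) (Set.right_mem_Icc.2 zero_le_one)
  simpa using this

theorem norm_digamma_gammaArg_sub_le {t : ℝ} {w : ℂ} (ht : 1 ≤ |t|) (hw : -1 / 4 ≤ w.re)
    (hw' : w.re ≤ 1) :
    ‖Complex.digamma (gammaArg t w) - Complex.digamma (gammaArg t 0)‖ ≤
      600 * (1 + |w.im|) ^ 2 / |t| := by
  have ht0 : 0 < |t| := by linarith
  have hv := abs_nonneg w.im
  have hnw : ‖w‖ ≤ 1 + |w.im| := by
    refine (Complex.norm_le_abs_re_add_abs_im w).trans ?_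
    have : |w.re| ≤ 1 := abs_le.2 ⟨by linarith, hw'⟩
    linarith
  have hinv : ∀ w : ℂ, -1 / 4 ≤ w.re → 18 / ‖gammaArg t w‖ ≤ 288 * (1 + |w.im|) / |t| := by
    intro w hw
    have h8 := (gammaArg_re_ge (t := t) hw).trans (Complex.re_le_norm _)
    have h1 := abs_le_mul_norm_gammaArg (t := t) hw
    rw [div_le_div_iff₀ (by linarith) ht0]
    linarith
  have h1 := (norm_digamma_sub_log_le (gammaArg_re_ge (t := t) hw)).trans (hinv w hw)
  have h0 := (norm_digamma_sub_log_le (gammaArg_re_ge (t := t) (w := 0) (by norm_num))).trans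
    (hinv 0 (by norm_num))
  have h2 := norm_log_gammaArg_sub_le ht hw
  calc _ = ‖(Complex.digamma (gammaArg t w) - Complex.log (gammaArg t w)) +
        (Complex.log (gammaArg t w) - Complex.log (gammaArg t 0)) -
        (Complex.digamma (gammaArg t 0) - Complex.log (gammaArg t 0))‖ := by ring_nf
    _ ≤ 288 * (1 + |w.im|) / |t| + 8 * (1 + |w.im|) * ‖w‖ / |t| +
        288 * (1 + |(0 : ℂ).im|) / |t| :=
        (norm_sub_le _ _).trans (add_le_add ((norm_add_le _ _).trans (add_le_add h1 h2)) h0)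
    _ ≤ _ := by
        rw [← add_div, ← add_div]
        refine div_le_div_of_nonneg_right ?_ ht0.le
        rw [Complex.zero_im, abs_zero]
        nlinarith [mul_le_mul_of_nonneg_left hnw (by linarith : 0 ≤ 1 + |w.im|)]

/-- The ratio of the Gamma factors. -/
noncomputable def gammaRatio (t : ℝ) (w : ℂ) : ℂ := gammaPair t w / gammaPair t 0

theorem gammaRatio_zero (t : ℝ) : gammaRatio t 0 = 1 :=
  div_self (gammaPair_ne_zero (by norm_num))

theorem hasDerivAt_gammaRatio_real {t : ℝ} {w : ℂ} (hw : -1 / 4 ≤ w.re) :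
    HasDerivAt (fun t : ℝ => gammaRatio t w) (gammaRatio t w * (Complex.I / 2 *
      ((Complex.digamma (gammaArg t w) - Complex.digamma (gammaArg t 0)) -
        (Complex.digamma (gammaArg (-t) w) - Complex.digamma (gammaArg (-t) 0))))) t := by
  have h0 : gammaPair t 0 ≠ 0 := gammaPair_ne_zero (by norm_num)
  refine ((hasDerivAt_gammaPair_real hw).div
    (hasDerivAt_gammaPair_real (t := t) (w := 0) (by norm_num)) h0).congr_deriv ?_
  simp only [gammaRatio]
  field_simp
  ring

theorem norm_deriv_gammaRatio_le {t : ℝ} {w : ℂ} (ht : 1 ≤ t) (hw : -1 / 4 ≤ w.re)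
    (hw' : w.re ≤ 1) :
    ‖deriv (fun t : ℝ => gammaRatio t w) t‖ ≤ ‖gammaRatio t w‖ * (600 * (1 + |w.im|) ^ 2 / t) := by
  have ht' : |t| = t := abs_of_pos (by linarith)
  have h1 := norm_digamma_gammaArg_sub_le (t := t) (by rwa [ht']) hw hw'
  have h2 := norm_digamma_gammaArg_sub_le (t := -t) (by rwa [abs_neg, ht']) hw hw'
  rw [abs_neg, ht'] at h2
  rw [ht'] at h1
  rw [(hasDerivAt_gammaRatio_real hw).deriv, norm_mul, norm_mul, norm_div, Complex.norm_I,
    Complex.norm_ofNat]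
  refine mul_le_mul_of_nonneg_left ?_ (norm_nonneg _)
  have := norm_sub_le (Complex.digamma (gammaArg t w) - Complex.digamma (gammaArg t 0))
    (Complex.digamma (gammaArg (-t) w) - Complex.digamma (gammaArg (-t) 0))
  linarith

theorem differentiableAt_gammaRatio {t : ℝ} {w : ℂ} (hw : -1 / 4 ≤ w.re) :
    DifferentiableAt ℂ (gammaRatio t) w :=
  (hasDerivAt_gammaPair hw).differentiableAt.div_const _

theorem exists_norm_gammaRatio_le : ∃ C : ℝ, 0 < C ∧ ∀ t : ℝ, 1 ≤ t → ∀ w : ℂ,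
    -1 / 4 ≤ w.re → w.re ≤ 1 → ‖gammaRatio t w‖ ≤ C * t ^ w.re * Real.exp (w.im ^ 2 / 16) := by
  refine ⟨Real.exp 1000000, Real.exp_pos _, fun t ht w hw hw' => ?_⟩
  have ht0 : 0 < t := by linarith
  have hg0 : 0 < ‖gammaPair t 0‖ := norm_pos_iff.2 (gammaPair_ne_zero (by norm_num))
  have h := norm_gammaPair_le ht hw hw'
  rw [gammaRatio, norm_div, div_le_iff₀ hg0]
  refine h.trans ?_
  have hE : Real.exp (‖w‖ * (152 + Real.log (1 + |w.im|))) ≤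
      Real.exp 1000000 * Real.exp (w.im ^ 2 / 16) := by
    rw [← Real.exp_add, Real.exp_le_exp]
    have hv := abs_nonneg w.im
    set u := 1 + |w.im| with hu
    have hu1 : 1 ≤ u := by linarith
    have hnw : ‖w‖ ≤ u := by
      refine (Complex.norm_le_abs_re_add_abs_im w).trans ?_
      have : |w.re| ≤ 1 := abs_le.2 ⟨by linarith, hw'⟩
      linarith
    have hlog : Real.log u ≤ u / 64 + 7 := by
      have h1 := Real.log_le_sub_one_of_pos (show 0 < u / 64 by linarith)
      rw [Real.log_div (by linarith) (by norm_num)] at h1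
      have h64 : Real.log 64 = 6 * Real.log 2 := by
        rw [← Real.log_rpow two_pos]; norm_num
      have := Real.log_two_lt_d9
      linarith
    have hlog0 : 0 ≤ Real.log u := Real.log_nonneg hu1
    have hsq : w.im ^ 2 = (u - 1) ^ 2 := by rw [hu, add_sub_cancel_left, sq_abs]
    rw [hsq]
    calc ‖w‖ * (152 + Real.log u) ≤ u * (152 + (u / 64 + 7)) := by gcongr
      _ ≤ _ := by nlinarith [sq_nonneg (u - 4000)]
  calc _ ≤ ‖gammaPair t 0‖ * t ^ w.re * (Real.exp 1000000 * Real.exp (w.im ^ 2 / 16)) := by gcongr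
    _ = _ := by ring

/-- The normalised polynomial factor cancelling the poles. -/
noncomputable def poleFactor (t : ℝ) (w : ℂ) : ℂ :=
  1 + 2 * w ^ 2 / (t ^ 2 + 1 / 4 : ℝ) + (w ^ 4 - w ^ 2) / ((t ^ 2 + 1 / 4 : ℝ) : ℂ) ^ 2

/-- The weight in the smoothed approximate functional equation. -/
noncomputable def kernel (t : ℝ) (w : ℂ) : ℂ :=
  (poleFactor t w * gammaRatio t w) ^ 2 * ((π : ℂ) ^ (-2 * w) * Complex.exp (w ^ 2))

theorem kernel_zero (t : ℝ) : kernel t 0 = 1 := by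
  simp [kernel, poleFactor, gammaRatio_zero]

theorem differentiableAt_kernel {t : ℝ} {w : ℂ} (hw : -1 / 4 ≤ w.re) :
    DifferentiableAt ℂ (kernel t) w := by
  have h1 := differentiableAt_gammaRatio (t := t) hw
  have h2 : DifferentiableAt ℂ (poleFactor t) w := by unfold poleFactor; fun_prop
  have h3 : DifferentiableAt ℂ (fun w : ℂ => (π : ℂ) ^ (-2 * w)) w :=
    (differentiableAt_id.const_mul _).const_cpow (Or.inl (by exact_mod_cast Real.pi_ne_zero))
  unfold kernel
  fun_prop

theorem norm_sq_le_one_add {w : ℂ} (hw : -1 / 4 ≤ w.re) (hw' : w.re ≤ 1) :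
    ‖w‖ ^ 2 ≤ 1 + w.im ^ 2 := by
  rw [← Complex.normSq_eq_norm_sq, Complex.normSq_apply]
  nlinarith

theorem norm_poleFactor_le {t : ℝ} {w : ℂ} (ht : 1 ≤ t) (hw : -1 / 4 ≤ w.re) (hw' : w.re ≤ 1) :
    ‖poleFactor t w‖ ≤ 5 * (1 + w.im ^ 2) ^ 2 := by
  have hu := norm_sq_le_one_add hw hw'
  have hu1 : 1 ≤ 1 + w.im ^ 2 := by nlinarith [sq_nonneg w.im]
  set u := 1 + w.im ^ 2
  have hτ : 1 ≤ t ^ 2 + 1 / 4 := by nlinarith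
  set τ := t ^ 2 + 1 / 4
  have h0 : 0 ≤ ‖w‖ ^ 2 := by positivity
  have hτ2 : 1 ≤ τ ^ 2 := one_le_pow₀ hτ
  rw [poleFactor]
  refine (norm_add₃_le).trans ?_
  rw [norm_one, norm_div, norm_div, norm_mul, norm_pow, norm_pow, Complex.norm_ofNat,
    Complex.norm_of_nonneg (zero_le_one.trans hτ)]
  have a1 : 2 * ‖w‖ ^ 2 / τ ≤ 2 * u := (div_le_self (by positivity) hτ).trans (by linarith)
  have a2 : ‖w ^ 4 - w ^ 2‖ / τ ^ 2 ≤ u ^ 2 + u := by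
    refine (div_le_self (norm_nonneg _) hτ2).trans ((norm_sub_le _ _).trans ?_)
    rw [norm_pow, norm_pow]
    nlinarith
  nlinarith

theorem hasDerivAt_poleFactor_real {t : ℝ} {w : ℂ} (ht : 1 ≤ t) :
    HasDerivAt (fun t : ℝ => poleFactor t w) (-(2 * t : ℝ) * (2 * w ^ 2 / ((t ^ 2 + 1 / 4 : ℝ) : ℂ) ^ 2 +
      2 * (w ^ 4 - w ^ 2) / ((t ^ 2 + 1 / 4 : ℝ) : ℂ) ^ 3)) t := by
  have hτ : ((t ^ 2 + 1 / 4 : ℝ) : ℂ) ≠ 0 := by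
    have : 0 < t ^ 2 + 1 / 4 := by positivity
    exact_mod_cast this.ne'
  have h : HasDerivAt (fun t : ℝ => ((t ^ 2 + 1 / 4 : ℝ) : ℂ)) ((2 * t : ℝ) : ℂ) t := by
    have := ((hasDerivAt_pow 2 t).add_const (1 / 4)).ofReal_comp
    simpa using this
  unfold poleFactor
  have h2 := h.pow 2
  refine ((((hasDerivAt_const t (2 * w ^ 2)).div h hτ).const_add 1).add
    ((hasDerivAt_const t (w ^ 4 - w ^ 2)).div h2 (pow_ne_zero 2 hτ))).congr_deriv ?_
  simp only [Pi.pow_apply]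
  generalize ((t ^ 2 + 1 / 4 : ℝ) : ℂ) = τ at hτ ⊢
  push_cast
  field_simp
  ring

theorem norm_deriv_poleFactor_le {t : ℝ} {w : ℂ} (ht : 1 ≤ t) (hw : -1 / 4 ≤ w.re)
    (hw' : w.re ≤ 1) :
    ‖deriv (fun t : ℝ => poleFactor t w) t‖ ≤ 12 * (1 + w.im ^ 2) ^ 2 / t := by
  have hu := norm_sq_le_one_add hw hw'
  have hu1 : 1 ≤ 1 + w.im ^ 2 := by nlinarith [sq_nonneg w.im]
  have h0 : 0 ≤ ‖w‖ ^ 2 := by positivity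
  have ht0 : 0 < t := by linarith
  rw [(hasDerivAt_poleFactor_real ht).deriv]
  set u := 1 + w.im ^ 2
  have hτt : t ^ 2 ≤ t ^ 2 + 1 / 4 := by linarith
  have hτ : 1 ≤ t ^ 2 + 1 / 4 := by nlinarith
  set τ := t ^ 2 + 1 / 4
  have hτ0 : 0 < τ := by linarith
  have a : ‖2 * w ^ 2 / (τ : ℂ) ^ 2 + 2 * (w ^ 4 - w ^ 2) / (τ : ℂ) ^ 3‖ ≤ 6 * u ^ 2 / τ := by
    refine (norm_add_le _ _).trans ?_
    rw [norm_div, norm_div, norm_mul, norm_mul, norm_pow, norm_pow, norm_pow, Complex.norm_ofNat,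
      Complex.norm_of_nonneg hτ0.le]
    have a2 : ‖w ^ 4 - w ^ 2‖ ≤ u ^ 2 + u := by
      refine (norm_sub_le _ _).trans ?_
      rw [norm_pow, norm_pow]
      nlinarith
    have b1 : 2 * ‖w‖ ^ 2 / τ ^ 2 ≤ 2 * u / τ := by
      rw [div_le_div_iff₀ (by positivity) hτ0]
      nlinarith [mul_nonneg (mul_nonneg hτ0.le (sub_nonneg.2 hτ)) (by linarith : 0 ≤ u),
        mul_le_mul_of_nonneg_right hu hτ0.le]
    have b2 : 2 * ‖w ^ 4 - w ^ 2‖ / τ ^ 3 ≤ 2 * (u ^ 2 + u) / τ := by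
      have : τ ≤ τ ^ 3 := le_self_pow₀ hτ (by norm_num)
      gcongr
    refine (add_le_add b1 b2).trans ?_
    rw [← add_div]
    gcongr
    nlinarith
  rw [norm_mul, norm_neg, Complex.norm_of_nonneg (by linarith)]
  refine (mul_le_mul_of_nonneg_left a (by linarith)).trans ?_
  rw [mul_div_assoc', div_le_div_iff₀ hτ0 ht0]
  nlinarith [mul_le_mul_of_nonneg_left hτt (by positivity : 0 ≤ 12 * u ^ 2)]

theorem differentiableAt_kernel_real {t : ℝ} {w : ℂ} (ht : 1 ≤ t) (hw : -1 / 4 ≤ w.re) :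
    DifferentiableAt ℝ (fun t : ℝ => kernel t w) t :=
  (((hasDerivAt_poleFactor_real ht).differentiableAt.mul
    (hasDerivAt_gammaRatio_real hw).differentiableAt).pow 2).mul_const _

theorem norm_pi_cpow_mul_exp_le {w : ℂ} (hw : -1 / 4 ≤ w.re) (hw' : w.re ≤ 1) :
    ‖(π : ℂ) ^ (-2 * w) * Complex.exp (w ^ 2)‖ ≤ 6 * Real.exp (-w.im ^ 2) := by
  rw [norm_mul, Complex.norm_cpow_eq_rpow_re_of_pos Real.pi_pos, Complex.norm_exp]
  have h1 : π ^ (-2 * w).re ≤ 2 := by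
    have e : (-2 * w).re ≤ 1 / 2 := by simp; linarith
    refine (Real.rpow_le_rpow_of_exponent_le (by linarith [Real.pi_gt_three]) e).trans ?_
    rw [← Real.sqrt_eq_rpow, Real.sqrt_le_left (by norm_num)]
    linarith [Real.pi_lt_four]
  have h2 : Real.exp (w ^ 2).re ≤ 3 * Real.exp (-w.im ^ 2) := by
    have e : (w ^ 2).re ≤ 1 + -w.im ^ 2 := by
      rw [sq, Complex.mul_re]; nlinarith
    refine (Real.exp_le_exp.2 e).trans ?_
    rw [Real.exp_add]
    have := Real.exp_one_lt_d9
    gcongr; linarith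
  calc _ ≤ 2 * (3 * Real.exp (-w.im ^ 2)) := by gcongr
    _ = _ := by ring

theorem pow_five_le (v : ℝ) : (1 + v ^ 2) ^ 5 ≤ 1000000 * Real.exp (3 / 8 * v ^ 2) := by
  have h := Real.add_one_le_exp (3 / 40 * (1 + v ^ 2))
  have h1 : 1 + v ^ 2 ≤ 40 / 3 * Real.exp (3 / 40 * (1 + v ^ 2)) := by linarith
  calc (1 + v ^ 2) ^ 5 ≤ (40 / 3 * Real.exp (3 / 40 * (1 + v ^ 2))) ^ 5 := by gcongr
    _ = (40 / 3) ^ 5 * (Real.exp (3 / 8) * Real.exp (3 / 8 * v ^ 2)) := by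
      rw [mul_pow, ← Real.exp_nat_mul, ← Real.exp_add]; congr 2; push_cast; ring
    _ ≤ (40 / 3) ^ 5 * (2 * Real.exp (3 / 8 * v ^ 2)) := by
      gcongr
      rw [← Real.le_log_iff_exp_le two_pos]
      linarith [Real.log_two_gt_d9]
    _ ≤ _ := by nlinarith [Real.exp_pos (3 / 8 * v ^ 2)]

theorem exists_norm_kernel_le : ∃ C : ℝ, 0 < C ∧ ∀ t : ℝ, 1 ≤ t → ∀ w : ℂ,
    -1 / 4 ≤ w.re → w.re ≤ 1 →
    ‖kernel t w‖ ≤ C * t ^ (2 * w.re) * Real.exp (-w.im ^ 2 / 2) ∧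
    ‖deriv (fun t : ℝ => kernel t w) t‖ ≤ C * t ^ (2 * w.re - 1) * Real.exp (-w.im ^ 2 / 2) := by
  obtain ⟨C, hC, h⟩ := exists_norm_gammaRatio_le
  refine ⟨10 ^ 12 * C ^ 2, by positivity, fun t ht w hw hw' => ?_⟩
  have ht0 : 0 < t := by linarith
  have hg := h t ht w hw hw'
  have hq := norm_poleFactor_le ht hw hw'
  have he := norm_pi_cpow_mul_exp_le hw hw'
  have h5 := pow_five_le w.im
  have hu1 : 1 ≤ 1 + w.im ^ 2 := by nlinarith [sq_nonneg w.im]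
  have hg2 : ‖gammaRatio t w‖ ^ 2 ≤ C ^ 2 * t ^ (2 * w.re) * Real.exp (w.im ^ 2 / 8) := by
    refine (pow_le_pow_left₀ (norm_nonneg _) hg 2).trans (le_of_eq ?_)
    rw [mul_pow, mul_pow, ← Real.exp_nat_mul, ← Real.rpow_mul_natCast ht0.le]
    congr 2
    · congr 1; push_cast; ring
    · push_cast; ring
  have hE : Real.exp (3 / 8 * w.im ^ 2) * Real.exp (w.im ^ 2 / 8) * Real.exp (-w.im ^ 2) =
      Real.exp (-w.im ^ 2 / 2) := by
    rw [← Real.exp_add, ← Real.exp_add]; congr 1; ring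
  have hmain : (1 + w.im ^ 2) ^ 5 * ‖gammaRatio t w‖ ^ 2 * Real.exp (-w.im ^ 2) ≤
      10 ^ 6 * C ^ 2 * t ^ (2 * w.re) * Real.exp (-w.im ^ 2 / 2) := by
    calc _ ≤ (1000000 * Real.exp (3 / 8 * w.im ^ 2)) *
          (C ^ 2 * t ^ (2 * w.re) * Real.exp (w.im ^ 2 / 8)) * Real.exp (-w.im ^ 2) := by gcongr
      _ = _ := by rw [← hE]; ring
  set u := 1 + w.im ^ 2 with hu
  set g := ‖gammaRatio t w‖ with hgdef
  have hu4 : u ^ 4 ≤ u ^ 5 := pow_le_pow_right₀ hu1 (by norm_num)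
  constructor
  · rw [kernel, norm_mul, norm_pow, norm_mul]
    calc _ ≤ (5 * u ^ 2 * g) ^ 2 * (6 * Real.exp (-w.im ^ 2)) := by gcongr
      _ = 150 * (u ^ 4 * g ^ 2 * Real.exp (-w.im ^ 2)) := by ring
      _ ≤ 150 * (u ^ 5 * g ^ 2 * Real.exp (-w.im ^ 2)) := by gcongr
      _ ≤ 150 * (10 ^ 6 * C ^ 2 * t ^ (2 * w.re) * Real.exp (-w.im ^ 2 / 2)) := by gcongr
      _ ≤ _ := by
        rw [show 10 ^ 12 * C ^ 2 * t ^ (2 * w.re) * Real.exp (-w.im ^ 2 / 2) =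
          10 ^ 6 * (10 ^ 6 * C ^ 2 * t ^ (2 * w.re) * Real.exp (-w.im ^ 2 / 2)) by ring]
        gcongr; norm_num
  · have hgd := norm_deriv_gammaRatio_le ht hw hw'
    have hqd := norm_deriv_poleFactor_le ht hw hw'
    have d1 := (hasDerivAt_poleFactor_real (w := w) ht).differentiableAt.hasDerivAt
    have d2 := (hasDerivAt_gammaRatio_real (t := t) hw).differentiableAt.hasDerivAt
    have d := (((d1.mul d2).pow 2).mul_const ((π : ℂ) ^ (-2 * w) * Complex.exp (w ^ 2)))
    have e : deriv (fun t : ℝ => kernel t w) t = _ := d.deriv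
    rw [e]
    have hu2 : (1 + |w.im|) ^ 2 ≤ 2 * u := by
      rw [hu, ← sq_abs w.im]; nlinarith [sq_nonneg (1 - |w.im|)]
    simp only [Pi.mul_apply, Nat.cast_ofNat, Nat.add_one_sub_one, pow_one]
    rw [norm_mul, norm_mul (_ * _), norm_mul, norm_mul (poleFactor t w), Complex.norm_ofNat]
    have hA : ‖deriv (fun t : ℝ => poleFactor t w) t * gammaRatio t w +
        poleFactor t w * deriv (fun t : ℝ => gammaRatio t w) t‖ ≤ 6012 * u ^ 3 * g / t := by
      refine (norm_add_le _ _).trans ?_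
      rw [norm_mul, norm_mul]
      have b1 : ‖deriv (fun t : ℝ => gammaRatio t w) t‖ ≤ g * (1200 * u / t) := by
        refine hgd.trans ?_
        gcongr ?_ * (?_ / t)
        linarith
      have hu3 : u ^ 2 ≤ u ^ 3 := pow_le_pow_right₀ hu1 (by norm_num)
      calc _ ≤ 12 * u ^ 2 / t * g + 5 * u ^ 2 * (g * (1200 * u / t)) := by gcongr
        _ = (12 * u ^ 2 + 6000 * u ^ 3) * g / t := by ring
        _ ≤ _ := by gcongr; linarith
    have hrp : t ^ (2 * w.re - 1) = t ^ (2 * w.re) / t := by rw [Real.rpow_sub_one ht0.ne']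
    calc _ ≤ 2 * (5 * u ^ 2 * g) * (6012 * u ^ 3 * g / t) * (6 * Real.exp (-w.im ^ 2)) := by gcongr
      _ = 360720 * (u ^ 5 * g ^ 2 * Real.exp (-w.im ^ 2)) / t := by ring
      _ ≤ 10 ^ 6 * (10 ^ 6 * C ^ 2 * t ^ (2 * w.re) * Real.exp (-w.im ^ 2 / 2)) / t := by
        gcongr; norm_num
      _ = _ := by rw [hrp]; ring

theorem continuous_kernel {c : ℝ} (hc : -1 / 4 ≤ c) :
    Continuous fun p : ℝ × ℝ => kernel p.1 (c + p.2 * Complex.I) := by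
  have hΓ : ∀ (f : ℝ × ℝ → ℝ) (g : ℝ × ℝ → ℂ), Continuous f → Continuous g →
      (∀ p, -1 / 4 ≤ (g p).re) → Continuous fun p => Complex.Gamma (gammaArg (f p) (g p)) := by
    intro f g hf hg hre
    refine continuous_iff_continuousAt.2 fun p => ?_
    have h8 := gammaArg_re_ge (t := f p) (hre p)
    have h1 : ContinuousAt Complex.Gamma (gammaArg (f p) (g p)) :=
      (differentiableAt_Gamma_of_re_pos (by linarith)).continuousAt
    have h2 : Continuous fun p => gammaArg (f p) (g p) := by unfold gammaArg; fun_prop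
    exact h1.comp_of_eq h2.continuousAt rfl
  have hw : Continuous fun p : ℝ × ℝ => (c + p.2 * Complex.I : ℂ) := by fun_prop
  have hre : ∀ p : ℝ × ℝ, -1 / 4 ≤ ((c : ℂ) + p.2 * Complex.I).re := fun p => by simpa using hc
  have h0 : ∀ p : ℝ × ℝ, -1 / 4 ≤ (0 : ℂ).re := fun p => by norm_num
  have hP : Continuous fun p : ℝ × ℝ => gammaRatio p.1 (c + p.2 * Complex.I) := by
    unfold gammaRatio gammaPair
    exact ((hΓ _ _ continuous_fst hw hre).mul (hΓ _ _ continuous_fst.neg hw hre)).div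
      ((hΓ _ _ continuous_fst continuous_const h0).mul
        (hΓ _ _ continuous_fst.neg continuous_const h0))
      fun p => gammaPair_ne_zero (by norm_num)
  have hτ : ∀ p : ℝ × ℝ, ((p.1 ^ 2 + 1 / 4 : ℝ) : ℂ) ≠ 0 := fun p => by
    have : 0 < p.1 ^ 2 + 1 / 4 := by positivity
    exact_mod_cast this.ne'
  have hτc : Continuous fun p : ℝ × ℝ => ((p.1 ^ 2 + 1 / 4 : ℝ) : ℂ) := by fun_prop
  have hQ : Continuous fun p : ℝ × ℝ => poleFactor p.1 (c + p.2 * Complex.I) := by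
    unfold poleFactor
    exact (continuous_const.add (((continuous_const.mul (hw.pow 2))).div hτc hτ)).add
      (((hw.pow 4).sub (hw.pow 2)).div (hτc.pow 2) fun p => pow_ne_zero 2 (hτ p))
  unfold kernel
  refine ((hQ.mul hP).pow 2).mul (((continuous_const.mul hw).const_cpow
    (Or.inl (by exact_mod_cast Real.pi_ne_zero))).mul (hw.pow 2).cexp)

theorem integrable_of_norm_le_exp {f : ℝ → ℂ} (hf : Continuous f) {C : ℝ}
    (hb : ∀ y, ‖f y‖ ≤ C * Real.exp (-y ^ 2 / 2)) : Integrable f := by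
  have h := (integrable_exp_neg_mul_sq (b := 1 / 2) (by norm_num)).const_mul C
  refine h.mono' hf.aestronglyMeasurable (Eventually.of_forall fun y => (hb y).trans (le_of_eq ?_))
  congr 2; ring

/-- Vertical line integrals of a function holomorphic and of rapid decay in a strip agree. -/
theorem integral_vertical_eq {a b C : ℝ} {G : ℂ → ℂ} (hab : a ≤ b)
    (hG : DifferentiableOn ℂ G {w | a ≤ w.re ∧ w.re ≤ b})
    (hb : ∀ w : ℂ, a ≤ w.re → w.re ≤ b → ‖G w‖ ≤ C * Real.exp (-w.im ^ 2 / 2)) :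
    ∫ y : ℝ, G (b + y * Complex.I) = ∫ y : ℝ, G (a + y * Complex.I) := by
  have hcont : ∀ c : ℝ, a ≤ c → c ≤ b → Continuous fun y : ℝ => G (c + y * Complex.I) := by
    intro c h1 h2
    have : Continuous fun y : ℝ => (c + y * Complex.I : ℂ) := by fun_prop
    exact hG.continuousOn.comp_continuous this fun y => by simp [h1, h2]
  have hInt : ∀ c : ℝ, a ≤ c → c ≤ b → Integrable fun y : ℝ => G (c + y * Complex.I) := by
    intro c h1 h2
    refine integrable_of_norm_le_exp (hcont c h1 h2) (C := C) fun y => ?_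
    simpa using hb (c + y * Complex.I) (by simpa using h1) (by simpa using h2)
  have hlim : ∀ c : ℝ, a ≤ c → c ≤ b → Tendsto (fun R : ℝ => ∫ y in (-R)..R, G (c + y * Complex.I))
      atTop (nhds (∫ y : ℝ, G (c + y * Complex.I))) := fun c h1 h2 =>
    intervalIntegral_tendsto_integral (hInt c h1 h2) tendsto_neg_atTop_atBot tendsto_id
  have hexp : Tendsto (fun R : ℝ => C * Real.exp (-R ^ 2 / 2) * |b - a|) atTop (nhds 0) := by
    have h : Tendsto (fun R : ℝ => -R ^ 2 / 2) atTop atBot := by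
      have := (tendsto_pow_atTop (α := ℝ) two_ne_zero).const_mul_atTop_of_neg
        (show (-1 / 2 : ℝ) < 0 by norm_num)
      refine this.congr fun x => by ring
    have := ((Real.tendsto_exp_atBot.comp h).const_mul C).mul_const |b - a|
    simpa using this
  have hhor : ∀ e : ℝ, e ^ 2 = 1 →
      Tendsto (fun R : ℝ => ∫ x in a..b, G (x + (e * R : ℝ) * Complex.I)) atTop (nhds 0) := by
    intro e he
    refine squeeze_zero_norm (fun R => ?_) hexp
    refine intervalIntegral.norm_integral_le_of_norm_le_const fun x hx => ?_
    rw [Set.uIoc_of_le hab] at hx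
    have := hb (x + (e * R : ℝ) * Complex.I) (by simpa using hx.1.le) (by simpa using hx.2)
    have e1 : ((x : ℂ) + (e * R : ℝ) * Complex.I).im = e * R := by simp
    rwa [e1, mul_pow, he, one_mul] at this
  have hrect : ∀ R : ℝ, (∫ x in a..b, G (x + (-1 * R : ℝ) * Complex.I)) -
      (∫ x in a..b, G (x + (1 * R : ℝ) * Complex.I)) +
      Complex.I * (∫ y in (-R)..R, G (b + y * Complex.I)) -
      Complex.I * (∫ y in (-R)..R, G (a + y * Complex.I)) = 0 := by
    intro R
    have := Complex.integral_boundary_rect_eq_zero_of_differentiableOn G ⟨a, -R⟩ ⟨b, R⟩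
      (hG.mono fun w hw => by
        have := hw.1
        simp only [Set.mem_preimage, Set.uIcc_of_le hab] at this
        exact this)
    simpa using this
  have hl := (((hhor (-1) (by norm_num)).sub (hhor 1 (by norm_num))).add
    ((hlim b hab le_rfl).const_mul Complex.I)).sub ((hlim a le_rfl hab).const_mul Complex.I)
  have h0 := tendsto_nhds_unique (hl.congr hrect) tendsto_const_nhds
  rw [sub_zero, zero_add, ← mul_sub] at h0
  rcases mul_eq_zero.1 h0 with h | h
  · exact absurd h Complex.I_ne_zero
  · exact sub_eq_zero.1 h

theorem add_mul_I_ne_zero {c : ℝ} (hc : c ≠ 0) (y : ℝ) : (c + y * Complex.I : ℂ) ≠ 0 := by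
  intro h
  have := congrArg Complex.re h
  simp at this
  exact hc this

theorem abs_le_norm_add_mul_I (c y : ℝ) : |c| ≤ ‖(c + y * Complex.I : ℂ)‖ := by
  have := Complex.abs_re_le_norm (c + y * Complex.I)
  simpa using this

theorem integral_exp_sq_div {c : ℝ} (hc : 0 < c) :
    ∫ y : ℝ, Complex.exp ((c + y * Complex.I) ^ 2) / (c + y * Complex.I) = π := by
  have hinner : ∀ y : ℝ, ∫ u in Set.Ioi (0 : ℝ), Complex.exp ((c + y * Complex.I) ^ 2) *
      Complex.exp (-(c + y * Complex.I) * u) =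
      Complex.exp ((c + y * Complex.I) ^ 2) / (c + y * Complex.I) := by
    intro y
    rw [integral_const_mul, integral_exp_mul_complex_Ioi (by simpa using hc)]
    have := add_mul_I_ne_zero hc.ne' y
    simp only [Complex.ofReal_zero, mul_zero, Complex.exp_zero]
    field_simp
  simp_rw [← hinner]
  have hInt : Integrable (fun p : ℝ × ℝ => Complex.exp ((c + p.1 * Complex.I) ^ 2) *
      Complex.exp (-(c + p.1 * Complex.I) * p.2)) (volume.prod (volume.restrict (Set.Ioi 0))) := by
    have h1 : Integrable (fun y : ℝ => Real.exp (c ^ 2) * Real.exp (-1 * y ^ 2)) :=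
      (integrable_exp_neg_mul_sq one_pos).const_mul _
    have h2 : Integrable (fun u : ℝ => Real.exp (-c * u)) (volume.restrict (Set.Ioi 0)) :=
      exp_neg_integrableOn_Ioi 0 hc
    refine (h1.mul_prod h2).mono' (by fun_prop) (Eventually.of_forall fun p => le_of_eq ?_)
    rw [norm_mul, Complex.norm_exp, Complex.norm_exp, ← Real.exp_add, ← Real.exp_add,
      ← Real.exp_add]
    congr 1
    simp [sq, sub_eq_add_neg]
  rw [integral_integral_swap hInt]
  have hinner2 : ∀ u : ℝ, ∫ y : ℝ, Complex.exp ((c + y * Complex.I) ^ 2) *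
      Complex.exp (-(c + y * Complex.I) * u) = ((√π * Real.exp (-(1 / 4) * u ^ 2) : ℝ) : ℂ) := by
    intro u
    have := integral_cexp_quadratic (b := -1) (by simp) ((2 * c - u) * Complex.I) (c ^ 2 - c * u)
    rw [← integral_congr_ae (Eventually.of_forall fun y => ?_)] at this
    · rw [this]
      have e : ((π : ℂ) / -(-1)) ^ (1 / 2 : ℂ) = ((√π : ℝ) : ℂ) := by
        rw [Real.sqrt_eq_rpow, Complex.ofReal_cpow Real.pi_pos.le]; norm_num
      rw [e]
      push_cast
      congr 2
      rw [mul_pow, Complex.I_sq]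
      ring
    · rw [← Complex.exp_add]
      congr 1
      linear_combination (y : ℂ) ^ 2 * Complex.I_sq
  simp_rw [hinner2]
  rw [integral_complex_ofReal, integral_const_mul, integral_gaussian_Ioi]
  congr 1
  rw [show π / (1 / 4) = π * 2 ^ 2 by ring, Real.sqrt_mul Real.pi_pos.le, Real.sqrt_sq two_pos.le]
  have := Real.mul_self_sqrt Real.pi_pos.le
  linarith

theorem norm_exp_sq_le {a b : ℝ} {w : ℂ} (ha : -a ≤ w.re) (hb : w.re ≤ b) (ha0 : 0 < a)
    (hb0 : 0 < b) : ‖Complex.exp (w ^ 2)‖ ≤ Real.exp ((a + b) ^ 2) * Real.exp (-w.im ^ 2 / 2) := by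
  rw [Complex.norm_exp, ← Real.exp_add, Real.exp_le_exp, sq, Complex.mul_re]
  nlinarith [sq_nonneg w.im, abs_le.1 (abs_le_of_sq_le_sq (show w.re ^ 2 ≤ (a + b) ^ 2 from
    sq_le_sq' (by linarith) (by linarith)) (by linarith))]

/-- The residue theorem for `H(w)/w` between two vertical lines. -/
theorem integral_div_sub_integral_div {a b C : ℝ} {H : ℂ → ℂ} (ha : 0 < a) (hb : 0 < b)
    (hH : DifferentiableOn ℂ H {w | -a ≤ w.re ∧ w.re ≤ b})
    (hC : ∀ w : ℂ, -a ≤ w.re → w.re ≤ b → ‖H w‖ ≤ C * Real.exp (-w.im ^ 2 / 2)) :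
    (∫ y : ℝ, H (b + y * Complex.I) / (b + y * Complex.I)) -
      (∫ y : ℝ, H ((-a : ℝ) + y * Complex.I) / ((-a : ℝ) + y * Complex.I)) = 2 * π * H 0 := by
  set s : Set ℂ := {w | -a ≤ w.re ∧ w.re ≤ b} with hs
  set F : ℂ → ℂ := fun w => H w - H 0 * Complex.exp (w ^ 2) with hF
  have hFd : DifferentiableOn ℂ F s := by
    refine hH.sub (Differentiable.differentiableOn ?_)
    fun_prop
  have hs0 : s ∈ nhds (0 : ℂ) := by
    have h1 : IsOpen {w : ℂ | -a < w.re ∧ w.re < b} :=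
      (isOpen_lt continuous_const Complex.continuous_re).inter
        (isOpen_lt Complex.continuous_re continuous_const)
    exact mem_of_superset (h1.mem_nhds (by simp [ha, hb])) fun w hw => ⟨hw.1.le, hw.2.le⟩
  have hF0 : F 0 = 0 := by simp [hF]
  set G := dslope F 0 with hGdef
  have hGd : DifferentiableOn ℂ G s := (Complex.differentiableOn_dslope hs0).2 hFd
  have hGw : ∀ w : ℂ, w ≠ 0 → G w = F w / w := by
    intro w hw
    rw [hGdef, dslope_of_ne _ hw, slope_def_field, hF0, sub_zero, sub_zero]
  set C₁ := C + ‖H 0‖ * Real.exp ((a + b) ^ 2) with hC₁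
  have hFb : ∀ w ∈ s, ‖F w‖ ≤ C₁ * Real.exp (-w.im ^ 2 / 2) := by
    intro w hw
    refine (norm_sub_le _ _).trans ?_
    rw [norm_mul]
    have h1 := hC w hw.1 hw.2
    have h2 := mul_le_mul_of_nonneg_left (norm_exp_sq_le hw.1 hw.2 ha hb) (norm_nonneg (H 0))
    rw [hC₁]; linarith
  have hcpt : IsCompact (Set.Icc (-a) b ×ℂ Set.Icc (-1) 1) := isCompact_Icc.reProdIm isCompact_Icc
  obtain ⟨C₂, hC₂⟩ := hcpt.exists_bound_of_continuousOn (hGd.continuousOn.mono fun w hw => hw.1)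
  have hGb : ∀ w : ℂ, -a ≤ w.re → w.re ≤ b →
      ‖G w‖ ≤ (|C₁| + |C₂| * Real.exp (1 / 2)) * Real.exp (-w.im ^ 2 / 2) := by
    intro w h1 h2
    rcases le_or_gt |w.im| 1 with h | h
    · have h3 := hC₂ w ⟨⟨h1, h2⟩, abs_le.1 h⟩
      have h4 : 1 ≤ Real.exp (1 / 2) * Real.exp (-w.im ^ 2 / 2) := by
        rw [← Real.exp_add]
        refine Real.one_le_exp ?_
        have := (sq_le_one_iff_abs_le_one _).2 h
        linarith
      have h5 : |C₂| ≤ |C₂| * (Real.exp (1 / 2) * Real.exp (-w.im ^ 2 / 2)) :=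
        le_mul_of_one_le_right (abs_nonneg _) h4
      have h6 : 0 ≤ |C₁| * Real.exp (-w.im ^ 2 / 2) := by positivity
      have := le_abs_self C₂
      linarith
    · have hw1 : 1 ≤ ‖w‖ := h.le.trans (Complex.abs_im_le_norm w)
      have hw0 : w ≠ 0 := by rw [← norm_pos_iff]; linarith
      rw [hGw w hw0, norm_div]
      refine (div_le_self (norm_nonneg _) hw1).trans ((hFb w ⟨h1, h2⟩).trans ?_)
      gcongr
      have : 0 ≤ |C₂| * Real.exp (1 / 2) := by positivity
      linarith [le_abs_self C₁]
  have hV := integral_vertical_eq (by linarith : -a ≤ b) hGd hGb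
  have hsplit : ∀ c : ℝ, c ≠ 0 → -a ≤ c → c ≤ b → ∫ y : ℝ, G (c + y * Complex.I) =
      (∫ y : ℝ, H (c + y * Complex.I) / (c + y * Complex.I)) -
        H 0 * ∫ y : ℝ, Complex.exp ((c + y * Complex.I) ^ 2) / (c + y * Complex.I) := by
    intro c hc h1 h2
    have hl : Continuous fun y : ℝ => (c + y * Complex.I : ℂ) := by fun_prop
    have hmem : ∀ y : ℝ, (c + y * Complex.I : ℂ) ∈ s := fun y => by simp [hs, h1, h2]
    have hHc : Continuous fun y : ℝ => H (c + y * Complex.I) := hH.continuousOn.comp_continuous hl hmem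
    have i1 : Integrable fun y : ℝ => H (c + y * Complex.I) / (c + y * Complex.I) := by
      refine integrable_of_norm_le_exp (hHc.div hl (add_mul_I_ne_zero hc)) (C := C / |c|) fun y => ?_
      rw [norm_div, div_mul_eq_mul_div]
      have := hC _ (hmem y).1 (hmem y).2
      have h0 := abs_pos.2 hc
      have h3 := abs_le_norm_add_mul_I c y
      have e1 : ((c : ℂ) + y * Complex.I).im = y := by simp
      rw [e1] at this
      exact div_le_div₀ ((norm_nonneg _).trans this) this h0 h3
    have i2 : Integrable fun y : ℝ =>
        Complex.exp ((c + y * Complex.I) ^ 2) / (c + y * Complex.I) := by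
      refine integrable_of_norm_le_exp ((hl.pow 2).cexp.div hl (add_mul_I_ne_zero hc))
        (C := Real.exp ((a + b) ^ 2) / |c|) fun y => ?_
      rw [norm_div, div_mul_eq_mul_div]
      have := norm_exp_sq_le (hmem y).1 (hmem y).2 ha hb
      have h0 := abs_pos.2 hc
      have h3 := abs_le_norm_add_mul_I c y
      have e1 : ((c : ℂ) + y * Complex.I).im = y := by simp
      rw [e1] at this
      exact div_le_div₀ ((norm_nonneg _).trans this) this h0 h3
    rw [← integral_const_mul, ← integral_sub i1 (i2.const_mul _)]
    congr 1
    funext y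
    rw [hGw _ (add_mul_I_ne_zero hc y), hF]
    ring
  rw [hsplit b hb.ne' (by linarith) le_rfl, hsplit (-a) (by linarith) le_rfl (by linarith),
    integral_exp_sq_div hb] at hV
  have hneg : ∫ y : ℝ, Complex.exp (((-a : ℝ) + y * Complex.I) ^ 2) / ((-a : ℝ) + y * Complex.I) =
      -π := by
    rw [← integral_exp_sq_div ha, ← integral_neg, ← integral_neg_eq_self]
    congr 1
    funext y
    push_cast
    have e : (-a + -y * Complex.I : ℂ) = -(a + y * Complex.I) := by ring
    rw [e, neg_sq, div_neg]
  rw [hneg] at hV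
  linear_combination hV

theorem exists_norm_completedRiemannZeta₀_le (M : ℝ) :
    ∃ C : ℝ, ∀ z : ℂ, |z.re| ≤ M → ‖completedRiemannZeta₀ z‖ ≤ C := by
  set P := HurwitzZeta.hurwitzEvenFEPair 0 with hP
  have hconv : ∀ s : ℂ, MellinConvergent P.f_modif s := fun s =>
    (P.isStrongFEPair_toStrongFEPair.hasMellin s).1
  have hi : ∀ r : ℝ, IntegrableOn (fun x : ℝ => x ^ (r - 1) * ‖P.f_modif x‖) (Set.Ioi 0) := by
    intro r
    refine (integrableOn_congr_fun (fun x hx => ?_) measurableSet_Ioi).1 (hconv r).norm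
    rw [norm_smul, Complex.norm_cpow_eq_rpow_re_of_pos hx]
    simp
  refine ⟨(∫ x in Set.Ioi (0 : ℝ), (x ^ (M / 2 - 1) * ‖P.f_modif x‖ +
    x ^ (-M / 2 - 1) * ‖P.f_modif x‖)) / 2, fun z hz => ?_⟩
  have e : completedRiemannZeta₀ z = mellin P.f_modif (z / 2) / 2 := rfl
  rw [e, norm_div, Complex.norm_ofNat]
  refine div_le_div_of_nonneg_right ?_ two_pos.le
  rw [mellin]
  refine norm_integral_le_of_norm_le ((hi _).add (hi _)) ?_
  refine (ae_restrict_iff' measurableSet_Ioi).2 (Eventually.of_forall fun x hx => ?_)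
  have hx0 : (0 : ℝ) < x := hx
  rw [norm_smul, Complex.norm_cpow_eq_rpow_re_of_pos hx0, ← add_mul]
  refine mul_le_mul_of_nonneg_right ?_ (norm_nonneg _)
  have hre : (z / 2 - 1).re = z.re / 2 - 1 := by simp
  rw [hre]
  obtain ⟨h1, h2⟩ := abs_le.1 hz
  rcases le_total 1 x with h | h
  · have := Real.rpow_le_rpow_of_exponent_le h (show z.re / 2 - 1 ≤ M / 2 - 1 by linarith)
    have h3 : 0 ≤ x ^ (-M / 2 - 1) := by positivity
    linarith
  · have := Real.rpow_le_rpow_of_exponent_ge hx0 h (show -M / 2 - 1 ≤ z.re / 2 - 1 by linarith)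
    have h3 : 0 ≤ x ^ (M / 2 - 1) := by positivity
    linarith

/-- The entire function `z (1 - z) Λ(z)`. -/
noncomputable def xi (z : ℂ) : ℂ := z * (1 - z) * completedRiemannZeta₀ z - 1

theorem xi_one_sub (z : ℂ) : xi (1 - z) = xi z := by
  rw [xi, xi, completedRiemannZeta₀_one_sub]; ring

theorem differentiable_xi : Differentiable ℂ xi := by
  have := differentiable_completedZeta₀
  unfold xi
  fun_prop

theorem xi_eq {z : ℂ} (h0 : z ≠ 0) (h1 : z ≠ 1) (hΓ : 0 < z.re) :
    xi z = z * (1 - z) * ((π : ℂ) ^ (-z / 2) * Complex.Gamma (z / 2)) * riemannZeta z := by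
  have h1' : 1 - z ≠ 0 := sub_ne_zero.2 h1.symm
  have hG : Complex.Gammaℝ z ≠ 0 := Complex.Gammaℝ_ne_zero_of_re_pos hΓ
  rw [← Complex.Gammaℝ_def, riemannZeta_def_of_ne_zero h0, mul_assoc, mul_div_cancel₀ _ hG,
    completedRiemannZeta_eq, xi]
  field_simp
  ring

theorem exists_norm_xi_le : ∃ C : ℝ, 0 < C ∧ ∀ z : ℂ, |z.re| ≤ 3 → ‖xi z‖ ≤ C * (1 + ‖z‖) ^ 2 := by
  obtain ⟨C, hC⟩ := exists_norm_completedRiemannZeta₀_le 3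
  have hC0 : 0 ≤ C := (norm_nonneg _).trans (hC 0 (by norm_num))
  refine ⟨C + 1, by linarith, fun z hz => ?_⟩
  rw [xi]
  refine (norm_sub_le _ _).trans ?_
  rw [norm_one, norm_mul, norm_mul]
  have h1 : ‖1 - z‖ ≤ 1 + ‖z‖ := (norm_sub_le _ _).trans (by rw [norm_one])
  have h2 : ‖z‖ ≤ 1 + ‖z‖ := by linarith
  have h3 : 1 ≤ (1 + ‖z‖) ^ 2 := one_le_pow₀ (by linarith [norm_nonneg z])
  calc _ ≤ (1 + ‖z‖) * (1 + ‖z‖) * C + 1 := by gcongr; exact hC z hz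
    _ ≤ _ := by linarith

/-- The even entire function integrated in the approximate functional equation. -/
noncomputable def xiProd (t : ℝ) (w : ℂ) : ℂ :=
  (xi (1 / 2 + t * Complex.I + w) * xi (1 / 2 - t * Complex.I + w)) ^ 2 * Complex.exp (w ^ 2)

theorem xiProd_neg (t : ℝ) (w : ℂ) : xiProd t (-w) = xiProd t w := by
  rw [xiProd, xiProd, ← xi_one_sub, ← xi_one_sub (1 / 2 - t * Complex.I + -w), mul_comm (xi _),
    neg_sq]
  congr 4 <;> ring

theorem exists_norm_xiProd_le (t : ℝ) : ∃ C : ℝ, ∀ w : ℂ, -1 ≤ w.re → w.re ≤ 1 →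
    ‖xiProd t w‖ ≤ C * Real.exp (-w.im ^ 2 / 2) := by
  obtain ⟨C, hC, h⟩ := exists_norm_xi_le
  refine ⟨(C * (4 + |t|) ^ 2) ^ 4 * 16 * 1000000 * Real.exp 1, fun w h1 h2 => ?_⟩
  have hx : ∀ e : ℝ, |e| = |t| →
      ‖xi (1 / 2 + e * Complex.I + w)‖ ≤ (C * (4 + |t|) ^ 2) * (1 + |w.im|) ^ 2 := by
    intro e he
    refine (h _ (by simp; rw [abs_le]; constructor <;> linarith)).trans ?_
    have hn : 1 + ‖1 / 2 + e * Complex.I + w‖ ≤ (4 + |t|) * (1 + |w.im|) := by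
      have a1 : ‖1 / 2 + e * Complex.I + w‖ ≤ 1 / 2 + |t| + (1 + |w.im|) := by
        refine (norm_add_le _ _).trans (add_le_add ((norm_add_le _ _).trans (add_le_add ?_ ?_)) ?_)
        · norm_num
        · rw [norm_mul, Complex.norm_I, mul_one, Complex.norm_real, Real.norm_eq_abs, he]
        · refine (Complex.norm_le_abs_re_add_abs_im w).trans ?_
          have : |w.re| ≤ 1 := abs_le.2 ⟨h1, h2⟩
          linarith
      nlinarith [abs_nonneg t, abs_nonneg w.im, mul_nonneg (abs_nonneg t) (abs_nonneg w.im)]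
    calc _ ≤ C * ((4 + |t|) * (1 + |w.im|)) ^ 2 := by gcongr
      _ = _ := by ring
  have hx1 := hx t rfl
  have hx2 := hx (-t) (abs_neg t)
  rw [Complex.ofReal_neg, neg_mul, ← sub_eq_add_neg] at hx2
  have hu : (1 + |w.im|) ^ 2 ≤ 2 * (1 + w.im ^ 2) := by
    rw [← sq_abs w.im]; nlinarith [sq_nonneg (1 - |w.im|)]
  have hu1 : 1 ≤ 1 + w.im ^ 2 := by nlinarith [sq_nonneg w.im]
  have hexp : ‖Complex.exp (w ^ 2)‖ ≤ Real.exp 1 * Real.exp (-w.im ^ 2) := by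
    rw [Complex.norm_exp, ← Real.exp_add, Real.exp_le_exp, sq, Complex.mul_re]
    nlinarith
  rw [xiProd, norm_mul, norm_pow, norm_mul]
  set A := C * (4 + |t|) ^ 2 with hA
  have hA0 : 0 < A := by positivity
  calc _ ≤ ((A * (1 + |w.im|) ^ 2) * (A * (1 + |w.im|) ^ 2)) ^ 2 *
        (Real.exp 1 * Real.exp (-w.im ^ 2)) := by gcongr
    _ ≤ ((A * (2 * (1 + w.im ^ 2))) * (A * (2 * (1 + w.im ^ 2)))) ^ 2 *
        (Real.exp 1 * Real.exp (-w.im ^ 2)) := by gcongr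
    _ = A ^ 4 * 16 * (1 + w.im ^ 2) ^ 4 * (Real.exp 1 * Real.exp (-w.im ^ 2)) := by ring
    _ ≤ A ^ 4 * 16 * (1000000 * Real.exp (3 / 8 * w.im ^ 2)) *
        (Real.exp 1 * Real.exp (-w.im ^ 2)) := by
      gcongr
      exact (pow_le_pow_right₀ hu1 (by norm_num)).trans (pow_five_le w.im)
    _ = A ^ 4 * 16 * 1000000 * Real.exp 1 *
        (Real.exp (3 / 8 * w.im ^ 2) * Real.exp (-w.im ^ 2)) := by ring
    _ ≤ _ := by
      rw [← Real.exp_add]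
      gcongr
      nlinarith [sq_nonneg w.im]

theorem integral_xiProd_div (t : ℝ) :
    ∫ y : ℝ, xiProd t (1 + y * Complex.I) / (1 + y * Complex.I) = π * xiProd t 0 := by
  obtain ⟨C, hC⟩ := exists_norm_xiProd_le t
  have hd : Differentiable ℂ (xiProd t) := by
    have := differentiable_xi
    unfold xiProd
    fun_prop
  have h := integral_div_sub_integral_div one_pos one_pos hd.differentiableOn hC
  have hneg : ∫ y : ℝ, xiProd t ((-1 : ℝ) + y * Complex.I) / ((-1 : ℝ) + y * Complex.I) =
      -∫ y : ℝ, xiProd t (1 + y * Complex.I) / (1 + y * Complex.I) := by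
    rw [← integral_neg, ← integral_neg_eq_self]
    congr 1
    funext y
    push_cast
    have e : (-1 + -y * Complex.I : ℂ) = -(1 + y * Complex.I) := by ring
    rw [e, div_neg, xiProd_neg]
  rw [hneg, Complex.ofReal_one] at h
  linear_combination h / 2

theorem xiProd_eq {t : ℝ} {w : ℂ} (hw : -1 / 4 ≤ w.re) (h0 : 1 / 2 + t * Complex.I + w ≠ 1)
    (h1 : 1 / 2 - t * Complex.I + w ≠ 1) :
    xiProd t w = ((t ^ 2 + 1 / 4 : ℝ) : ℂ) ^ 4 * (π : ℂ)⁻¹ * gammaPair t 0 ^ 2 * (kernel t w *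
      (riemannZeta (1 / 2 + t * Complex.I + w) ^ 2 *
        riemannZeta (1 / 2 - t * Complex.I + w) ^ 2)) := by
  have r0 : 0 < (1 / 2 + t * Complex.I + w).re := by simp; linarith
  have r1 : 0 < (1 / 2 - t * Complex.I + w).re := by simp; linarith
  have n : ∀ z : ℂ, 0 < z.re → z ≠ 0 := by rintro z hz rfl; simp at hz
  have hg : gammaPair t 0 ≠ 0 := gammaPair_ne_zero (by norm_num)
  have hτ : ((t ^ 2 + 1 / 4 : ℝ) : ℂ) ≠ 0 := by
    have : 0 < t ^ 2 + 1 / 4 := by positivity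
    exact_mod_cast this.ne'
  have hπ : (π : ℂ) ≠ 0 := by exact_mod_cast Real.pi_ne_zero
  rw [xiProd, xi_eq (n _ r0) h0 r0, xi_eq (n _ r1) h1 r1, kernel, gammaRatio]
  have a0 : (1 / 2 + t * Complex.I + w) / 2 = gammaArg t w := by rw [gammaArg]; ring
  have a1 : (1 / 2 - t * Complex.I + w) / 2 = gammaArg (-t) w := by rw [gammaArg]; push_cast; ring
  have hp : ((π : ℂ) ^ (-(1 / 2 + t * Complex.I + w) / 2) *
      (π : ℂ) ^ (-(1 / 2 - t * Complex.I + w) / 2)) ^ 2 = (π : ℂ)⁻¹ * (π : ℂ) ^ (-2 * w) := by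
    rw [← Complex.cpow_add _ _ hπ, sq, ← Complex.cpow_add _ _ hπ, ← Complex.cpow_neg_one,
      ← Complex.cpow_add _ _ hπ]
    congr 1; ring
  have hq : ((1 / 2 + t * Complex.I + w) * (1 - (1 / 2 + t * Complex.I + w)) *
      ((1 / 2 - t * Complex.I + w) * (1 - (1 / 2 - t * Complex.I + w)))) =
      ((t ^ 2 + 1 / 4 : ℝ) : ℂ) ^ 2 * poleFactor t w := by
    have : ((t ^ 2 + 1 / 4 : ℝ) : ℂ) = 1 / 4 - (t * Complex.I) ^ 2 := by
      rw [mul_pow, Complex.I_sq]; push_cast; ring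
    have e : ((t ^ 2 + 1 / 4 : ℝ) : ℂ) ^ 2 * poleFactor t w = ((t ^ 2 + 1 / 4 : ℝ) : ℂ) ^ 2 +
        2 * w ^ 2 * ((t ^ 2 + 1 / 4 : ℝ) : ℂ) + (w ^ 4 - w ^ 2) := by
      rw [poleFactor]
      clear this
      generalize ((t ^ 2 + 1 / 4 : ℝ) : ℂ) = τ at hτ ⊢
      field_simp
    rw [e, this]
    ring
  rw [a0, a1]
  have hgp : Complex.Gamma (gammaArg t w) * Complex.Gamma (gammaArg (-t) w) = gammaPair t w := rfl
  set ζ₁ := riemannZeta (1 / 2 + t * Complex.I + w)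
  set ζ₂ := riemannZeta (1 / 2 - t * Complex.I + w)
  set E := Complex.exp (w ^ 2)
  set p₁ := (π : ℂ) ^ (-(1 / 2 + t * Complex.I + w) / 2)
  set p₂ := (π : ℂ) ^ (-(1 / 2 - t * Complex.I + w) / 2)
  set p₃ := (π : ℂ) ^ (-2 * w)
  calc _ = ((1 / 2 + t * Complex.I + w) * (1 - (1 / 2 + t * Complex.I + w)) *
      ((1 / 2 - t * Complex.I + w) * (1 - (1 / 2 - t * Complex.I + w)))) ^ 2 * (p₁ * p₂) ^ 2 *
      (Complex.Gamma (gammaArg t w) * Complex.Gamma (gammaArg (-t) w)) ^ 2 * E *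
      (ζ₁ ^ 2 * ζ₂ ^ 2) := by ring
    _ = _ := by
      rw [hq, hp, hgp]
      field_simp

/-- The smoothed approximate functional equation, in integral form. -/
theorem integral_kernel_mul_zeta {t : ℝ} (ht : 1 ≤ t) :
    ∫ y : ℝ, kernel t (1 + y * Complex.I) / (1 + y * Complex.I) *
      (riemannZeta (1 / 2 + t * Complex.I + (1 + y * Complex.I)) ^ 2 *
        riemannZeta (1 / 2 - t * Complex.I + (1 + y * Complex.I)) ^ 2) =
      π * ((‖riemannZeta (1 / 2 + t * Complex.I)‖ ^ 4 : ℝ) : ℂ) := by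
  have h := integral_xiProd_div t
  have hg : gammaPair t 0 ≠ 0 := gammaPair_ne_zero (by norm_num)
  have hτ : ((t ^ 2 + 1 / 4 : ℝ) : ℂ) ≠ 0 := by
    have : 0 < t ^ 2 + 1 / 4 := by positivity
    exact_mod_cast this.ne'
  have hπ : (π : ℂ) ≠ 0 := by exact_mod_cast Real.pi_ne_zero
  have hN : ((t ^ 2 + 1 / 4 : ℝ) : ℂ) ^ 4 * (π : ℂ)⁻¹ * gammaPair t 0 ^ 2 ≠ 0 := by positivity
  have ne1 : ∀ z : ℂ, z.im ≠ 0 ∨ z.re ≠ 1 → z ≠ 1 := by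
    rintro z hz rfl; simp at hz
  rw [xiProd_eq (by norm_num) (ne1 _ (Or.inl (by simp; linarith)))
    (ne1 _ (Or.inl (by simp; linarith))), kernel_zero] at h
  have hc : ∀ y : ℝ, xiProd t (1 + y * Complex.I) / (1 + y * Complex.I) =
      (((t ^ 2 + 1 / 4 : ℝ) : ℂ) ^ 4 * (π : ℂ)⁻¹ * gammaPair t 0 ^ 2) *
      (kernel t (1 + y * Complex.I) / (1 + y * Complex.I) *
      (riemannZeta (1 / 2 + t * Complex.I + (1 + y * Complex.I)) ^ 2 *
        riemannZeta (1 / 2 - t * Complex.I + (1 + y * Complex.I)) ^ 2)) := by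
    intro y
    rw [xiProd_eq (by norm_num) (ne1 _ (Or.inr (by norm_num))) (ne1 _ (Or.inr (by norm_num)))]
    ring
  simp_rw [hc] at h
  rw [integral_const_mul, mul_left_comm] at h
  refine (mul_left_cancel₀ hN h).trans ?_
  have hconj : riemannZeta (1 / 2 - t * Complex.I) =
      (starRingEnd ℂ) (riemannZeta (1 / 2 + t * Complex.I)) := by
    rw [← riemannZeta_conj]
    congr 1
    simp [Complex.ext_iff]
  rw [add_zero, add_zero, hconj, one_mul, ← mul_pow, Complex.mul_conj, Complex.normSq_eq_norm_sq]
  push_cast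
  ring

/-- The integrand of the smooth weight. -/
noncomputable def weightIntegrand (x t : ℝ) (w : ℂ) : ℂ := kernel t w / w * (x : ℂ) ^ (-w)

/-- The smooth weight, as an integral over the line `re w = c`. -/
noncomputable def weightOn (c x t : ℝ) : ℂ := ∫ y : ℝ, weightIntegrand x t (c + y * Complex.I)

theorem exists_norm_weightIntegrand_le : ∃ C : ℝ, 0 < C ∧ ∀ t : ℝ, 1 ≤ t → ∀ x : ℝ, 0 < x →
    ∀ c : ℝ, -1 / 4 ≤ c → c ≤ 1 → c ≠ 0 → ∀ y : ℝ,
    ‖weightIntegrand x t (c + y * Complex.I)‖ ≤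
      C * (t ^ (2 * c) * x ^ (-c) / |c|) * Real.exp (-y ^ 2 / 2) := by
  obtain ⟨C, hC, h⟩ := exists_norm_kernel_le
  refine ⟨C, hC, fun t ht x hx c hc hc1 hc0 y => ?_⟩
  have ht0 : 0 < t := by linarith
  have hre : ((c : ℂ) + y * Complex.I).re = c := by simp
  have him : ((c : ℂ) + y * Complex.I).im = y := by simp
  have h1 := (h t ht (c + y * Complex.I) (by rwa [hre]) (by rwa [hre])).1
  rw [hre, him] at h1
  rw [weightIntegrand, norm_mul, norm_div, Complex.norm_cpow_eq_rpow_re_of_pos hx, Complex.neg_re,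
    hre]
  have h2 := abs_le_norm_add_mul_I c y
  have h3 : 0 < |c| := abs_pos.2 hc0
  calc _ ≤ C * t ^ (2 * c) * Real.exp (-y ^ 2 / 2) / |c| * x ^ (-c) := by gcongr
    _ = _ := by ring

theorem continuous_weightIntegrand {x c : ℝ} (hx : 0 < x) (hc : -1 / 4 ≤ c) (hc0 : c ≠ 0) :
    Continuous fun p : ℝ × ℝ => weightIntegrand x p.1 (c + p.2 * Complex.I) := by
  have hw : Continuous fun p : ℝ × ℝ => (c + p.2 * Complex.I : ℂ) := by fun_prop
  unfold weightIntegrand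
  exact ((continuous_kernel hc).div hw fun p => add_mul_I_ne_zero hc0 _).mul
    (hw.neg.const_cpow (Or.inl (by exact_mod_cast hx.ne')))

/-- The integral of the Gaussian majorant. -/
noncomputable def gaussMass : ℝ := ∫ y : ℝ, Real.exp (-y ^ 2 / 2)

theorem integrable_gauss : Integrable fun y : ℝ => Real.exp (-y ^ 2 / 2) := by
  have h := integrable_exp_neg_mul_sq (b := 1 / 2) (by norm_num)
  refine h.congr (Eventually.of_forall fun y => ?_)
  simp only; congr 1; ring

theorem gaussMass_nonneg : 0 ≤ gaussMass := integral_nonneg fun _ => (Real.exp_pos _).le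

theorem exists_norm_weightOn_le : ∃ C : ℝ, 0 < C ∧ ∀ t : ℝ, 1 ≤ t → ∀ x : ℝ, 0 < x →
    ∀ c : ℝ, -1 / 4 ≤ c → c ≤ 1 → c ≠ 0 →
    ‖weightOn c x t‖ ≤ C * (t ^ (2 * c) * x ^ (-c) / |c|) := by
  obtain ⟨C, hC, h⟩ := exists_norm_weightIntegrand_le
  refine ⟨C * (gaussMass + 1), by have := gaussMass_nonneg; positivity,
    fun t ht x hx c hc hc1 hc0 => ?_⟩
  have ht0 : 0 < t := by linarith
  have := norm_integral_le_of_norm_le (integrable_gauss.const_mul _)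
    (Eventually.of_forall (h t ht x hx c hc hc1 hc0))
  rw [integral_const_mul, ← gaussMass] at this
  refine this.trans ?_
  have h3 : 0 ≤ t ^ (2 * c) * x ^ (-c) / |c| := by positivity
  nlinarith [mul_nonneg hC.le h3]

theorem rpow_neg_le_of_mem {x r : ℝ} (hx : 0 < x) (h1 : -1 / 4 ≤ r) (h2 : r ≤ 1) :
    x ^ (-r) ≤ x ^ (1 / 4 : ℝ) + x ^ (-1 : ℝ) := by
  have a1 : 0 ≤ x ^ (1 / 4 : ℝ) := by positivity
  have a2 : 0 ≤ x ^ (-1 : ℝ) := by positivity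
  rcases le_total 1 x with h | h
  · have := Real.rpow_le_rpow_of_exponent_le h (show -r ≤ 1 / 4 by linarith)
    linarith
  · have := Real.rpow_le_rpow_of_exponent_ge hx h (show -1 ≤ -r by linarith)
    linarith

theorem differentiableAt_cpow_neg {x : ℝ} (hx : 0 < x) (w : ℂ) :
    DifferentiableAt ℂ (fun w : ℂ => (x : ℂ) ^ (-w)) w :=
  differentiableAt_id.neg.const_cpow (Or.inl (by exact_mod_cast hx.ne'))

/-- A bound for the kernel times a power on the whole strip. -/
theorem exists_norm_kernel_mul_cpow_le {t x : ℝ} (ht : 1 ≤ t) (hx : 0 < x) :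
    ∃ C : ℝ, 0 ≤ C ∧ ∀ w : ℂ, -1 / 4 ≤ w.re → w.re ≤ 1 →
      ‖kernel t w * (x : ℂ) ^ (-w)‖ ≤ C * Real.exp (-w.im ^ 2 / 2) := by
  obtain ⟨C, hC, h⟩ := exists_norm_kernel_le
  refine ⟨C * t ^ (2 : ℝ) * (x ^ (1 / 4 : ℝ) + x ^ (-1 : ℝ)), by positivity,
    fun w h1 h2 => ?_⟩
  rw [norm_mul, Complex.norm_cpow_eq_rpow_re_of_pos hx, Complex.neg_re]
  have a1 := (h t ht w h1 h2).1
  have a2 := rpow_neg_le_of_mem hx h1 h2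
  have a3 : t ^ (2 * w.re) ≤ t ^ (2 : ℝ) :=
    Real.rpow_le_rpow_of_exponent_le ht (by linarith)
  calc _ ≤ C * t ^ (2 : ℝ) * Real.exp (-w.im ^ 2 / 2) *
        (x ^ (1 / 4 : ℝ) + x ^ (-1 : ℝ)) := by
        refine mul_le_mul (a1.trans ?_) a2 (by positivity) (by positivity)
        gcongr
    _ = _ := by ring

theorem weightOn_eq_weightOn_one {c t x : ℝ} (ht : 1 ≤ t) (hx : 0 < x) (hc : 0 < c) (hc1 : c ≤ 1) :
    weightOn c x t = weightOn 1 x t := by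
  obtain ⟨C, hC, h⟩ := exists_norm_kernel_mul_cpow_le ht hx
  refine (integral_vertical_eq (C := C / c) hc1 (fun w hw => ?_) fun w h1 h2 => ?_).symm
  · have hw0 : w ≠ 0 := by
      rintro rfl
      have := hw.1
      simp at this
      linarith
    exact (((differentiableAt_kernel (by linarith [hw.1])).div differentiableAt_id hw0).mul
      (differentiableAt_cpow_neg hx w)).differentiableWithinAt
  · rw [weightIntegrand, div_mul_eq_mul_div, norm_div, div_mul_eq_mul_div]
    have := h w (by linarith) h2
    exact div_le_div₀ ((norm_nonneg _).trans this) this hc (h1.trans (Complex.re_le_norm w))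

theorem weightOn_one_sub {t x : ℝ} (ht : 1 ≤ t) (hx : 0 < x) :
    weightOn 1 x t - weightOn (-(1 / 4)) x t = 2 * π := by
  obtain ⟨C, hC, h⟩ := exists_norm_kernel_mul_cpow_le ht hx
  have := integral_div_sub_integral_div (a := 1 / 4) (b := 1) (C := C)
    (H := fun w => kernel t w * (x : ℂ) ^ (-w)) (by norm_num) one_pos (fun w hw =>
      ((differentiableAt_kernel (by linarith [hw.1])).mul
        (differentiableAt_cpow_neg hx w)).differentiableWithinAt)
      (fun w h1 h2 => h w (by linarith) h2)
  simp only [kernel_zero, neg_zero, Complex.cpow_zero, mul_one] at this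
  rw [← this, weightOn, weightOn]
  simp only [weightIntegrand, div_mul_eq_mul_div]

theorem norm_exp_mul_I (a t : ℝ) : ‖Complex.exp (a * t * Complex.I)‖ = 1 := by
  have := Complex.norm_exp_ofReal_mul_I (a * t)
  push_cast at this
  exact this

theorem exists_norm_integral_exp_mul_kernel_le : ∃ C : ℝ, 0 < C ∧ ∀ T : ℝ, 1 ≤ T → ∀ a : ℝ, a ≠ 0 →
    ∀ w : ℂ, 0 < w.re → w.re ≤ 1 →
    ‖∫ t in (1 : ℝ)..T, Complex.exp (a * t * Complex.I) * kernel t w‖ ≤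
      C * (T ^ (2 * w.re) / w.re) / |a| * Real.exp (-w.im ^ 2 / 2) := by
  obtain ⟨C, hC, h⟩ := exists_norm_kernel_le
  refine ⟨3 * C, by positivity, fun T hT a ha w hw0 hw1 => ?_⟩
  have hw : -1 / 4 ≤ w.re := by linarith
  have hac : (a : ℂ) ≠ 0 := by exact_mod_cast ha
  set E := Real.exp (-w.im ^ 2 / 2) with hE
  have hIcc : Set.uIcc 1 T = Set.Icc 1 T := Set.uIcc_of_le hT
  have hu : ∀ t ∈ Set.uIcc 1 T, HasDerivAt (fun t : ℝ => kernel t w)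
      (deriv (fun t : ℝ => kernel t w) t) t := fun t ht => by
    rw [hIcc] at ht
    exact (differentiableAt_kernel_real ht.1 hw).hasDerivAt
  have hv : ∀ t ∈ Set.uIcc 1 T, HasDerivAt
      (fun t : ℝ => Complex.exp (a * t * Complex.I) / (a * Complex.I))
      (Complex.exp (a * t * Complex.I)) t := fun t _ => by
    have h1 : HasDerivAt (fun t : ℝ => (a : ℂ) * t * Complex.I) (a * 1 * Complex.I) t :=
      ((Complex.ofRealCLM.hasDerivAt (x := t)).const_mul (a : ℂ)).mul_const Complex.I
    refine (h1.cexp.div_const _).congr_deriv ?_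
    field_simp
  have hdb : ∀ t ∈ Set.Icc 1 T, ‖deriv (fun t : ℝ => kernel t w) t‖ ≤
      C * t ^ (2 * w.re - 1) * E := fun t ht => (h t ht.1 w hw hw1).2
  have hgi : IntervalIntegrable (fun t : ℝ => C * t ^ (2 * w.re - 1) * E) volume 1 T :=
    ((intervalIntegral.intervalIntegrable_rpow' (by linarith)).const_mul C).mul_const E
  have hu' : IntervalIntegrable (deriv fun t : ℝ => kernel t w) volume 1 T := by
    refine hgi.mono_fun (stronglyMeasurable_deriv _).aestronglyMeasurable ?_
    refine (ae_restrict_iff' measurableSet_uIoc).2 (Eventually.of_forall fun t ht => ?_)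
    rw [Set.uIoc_of_le hT] at ht
    exact (hdb t ⟨ht.1.le, ht.2⟩).trans (le_abs_self _)
  have hv' : IntervalIntegrable (fun t : ℝ => Complex.exp (a * t * Complex.I)) volume 1 T := by
    apply Continuous.intervalIntegrable
    fun_prop
  have hparts := intervalIntegral.integral_mul_deriv_eq_deriv_mul hu hv hu' hv'
  have hcomm : ∫ t in (1 : ℝ)..T, Complex.exp (a * t * Complex.I) * kernel t w =
      ∫ t in (1 : ℝ)..T, kernel t w * Complex.exp (a * t * Complex.I) := by
    simp_rw [mul_comm]
  rw [hcomm, hparts]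
  have hnv : ∀ t : ℝ, ‖Complex.exp (a * t * Complex.I) / (a * Complex.I)‖ = 1 / |a| := fun t => by
    rw [norm_div, norm_exp_mul_I, norm_mul, Complex.norm_I, mul_one, Complex.norm_real,
      Real.norm_eq_abs]
  have hT0 : 0 < T := by linarith
  have hT1 : 1 ≤ T ^ (2 * w.re) := Real.one_le_rpow hT (by linarith)
  have hb1 : ∀ t : ℝ, 1 ≤ t → t ≤ T →
      ‖kernel t w * (Complex.exp (a * t * Complex.I) / (a * Complex.I))‖ ≤
      C * T ^ (2 * w.re) * E * (1 / |a|) := fun t ht htT => by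
    rw [norm_mul, hnv]
    refine mul_le_mul_of_nonneg_right ((h t ht w hw hw1).1.trans ?_) (by positivity)
    gcongr
  have hb2 : ‖∫ t in (1 : ℝ)..T, deriv (fun t : ℝ => kernel t w) t *
      (Complex.exp (a * t * Complex.I) / (a * Complex.I))‖ ≤
      C * (T ^ (2 * w.re) / (2 * w.re)) * E * (1 / |a|) := by
    refine (intervalIntegral.norm_integral_le_of_norm_le hT
      (Eventually.of_forall fun t ht => ?_) (hgi.mul_const (1 / |a|))).trans ?_
    · rw [norm_mul, hnv]
      exact mul_le_mul_of_nonneg_right (hdb t ⟨ht.1.le, ht.2⟩) (by positivity)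
    · rw [intervalIntegral.integral_mul_const, intervalIntegral.integral_mul_const,
        intervalIntegral.integral_const_mul, integral_rpow (Or.inl (by linarith)), sub_add_cancel,
        Real.one_rpow]
      gcongr
      linarith
  have hle : C * T ^ (2 * w.re) * E * (1 / |a|) ≤ C * (T ^ (2 * w.re) / w.re) * E * (1 / |a|) := by
    gcongr
    rw [le_div_iff₀ hw0]
    nlinarith
  have hle2 : C * (T ^ (2 * w.re) / (2 * w.re)) * E * (1 / |a|) ≤
      C * (T ^ (2 * w.re) / w.re) * E * (1 / |a|) := by
    gcongr
    linarith
  refine (norm_sub_le _ _).trans ((add_le_add (norm_sub_le _ _) hb2).trans ?_)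
  have := hb1 T hT le_rfl
  have := hb1 1 le_rfl hT
  calc _ ≤ 3 * (C * (T ^ (2 * w.re) / w.re) * E * (1 / |a|)) := by linarith
    _ = _ := by ring

/-- The oscillatory integral of the weight. -/
noncomputable def oscIntegral (T x a : ℝ) : ℂ :=
  ∫ t in (1 : ℝ)..T, Complex.exp (a * t * Complex.I) * weightOn 1 x t

theorem exists_norm_oscIntegral_le_of_line : ∃ C : ℝ, 0 < C ∧ ∀ T : ℝ, 1 ≤ T → ∀ a : ℝ, a ≠ 0 →
    ∀ x : ℝ, 0 < x → ∀ c : ℝ, 0 < c → c ≤ 1 →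
    ‖oscIntegral T x a‖ ≤ C * (T ^ (2 * c) * x ^ (-c) / c ^ 2) / |a| := by
  obtain ⟨C, hC, h⟩ := exists_norm_integral_exp_mul_kernel_le
  obtain ⟨C₁, hC₁, h₁⟩ := exists_norm_weightIntegrand_le
  refine ⟨C * (gaussMass + 1), by have := gaussMass_nonneg; positivity,
    fun T hT a ha x hx c hc hc1 => ?_⟩
  have hT0 : 0 < T := by linarith
  have e1 : oscIntegral T x a = ∫ t in Set.Ioc 1 T, ∫ y : ℝ,
      Complex.exp (a * t * Complex.I) * weightIntegrand x t (c + y * Complex.I) := by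
    rw [oscIntegral, intervalIntegral.integral_of_le hT]
    refine setIntegral_congr_fun measurableSet_Ioc fun t ht => ?_
    rw [integral_const_mul, ← weightOn_eq_weightOn_one ht.1.le hx hc hc1, weightOn]
  have hInt : Integrable (fun p : ℝ × ℝ => Complex.exp (a * p.1 * Complex.I) *
      weightIntegrand x p.1 (c + p.2 * Complex.I)) ((volume.restrict (Set.Ioc 1 T)).prod volume) := by
    have hg : Integrable (fun p : ℝ × ℝ => (C₁ * (T ^ (2 * c) * x ^ (-c) / c)) *
        Real.exp (-p.2 ^ 2 / 2)) ((volume.restrict (Set.Ioc 1 T)).prod volume) :=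
      (integrable_const _).mul_prod integrable_gauss
    refine hg.mono' ?_ ?_
    · refine Continuous.aestronglyMeasurable ?_
      exact Continuous.mul (by fun_prop) (continuous_weightIntegrand hx (by linarith) hc.ne')
    · have : ∀ᵐ p : ℝ × ℝ ∂((volume.restrict (Set.Ioc 1 T)).prod volume), p.1 ∈ Set.Ioc 1 T :=
        Measure.quasiMeasurePreserving_fst.ae (ae_restrict_mem measurableSet_Ioc)
      filter_upwards [this] with p hp
      rw [norm_mul, norm_exp_mul_I, one_mul]
      refine (h₁ p.1 hp.1.le x hx c (by linarith) hc1 hc.ne' p.2).trans ?_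
      rw [abs_of_pos hc]
      have := hp.1.le
      gcongr
      exact hp.2
  rw [e1, integral_integral_swap hInt]
  have hin : ∀ y : ℝ, ‖∫ t in Set.Ioc 1 T,
      Complex.exp (a * t * Complex.I) * weightIntegrand x t (c + y * Complex.I)‖ ≤
      C * (T ^ (2 * c) * x ^ (-c) / c ^ 2) / |a| * Real.exp (-y ^ 2 / 2) := by
    intro y
    have hre : ((c : ℂ) + y * Complex.I).re = c := by simp
    have him : ((c : ℂ) + y * Complex.I).im = y := by simp
    have h2 := h T hT a ha (c + y * Complex.I) (by rwa [hre]) (by rwa [hre])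
    rw [hre, him] at h2
    have e2 : ∀ t : ℝ, Complex.exp (a * t * Complex.I) * weightIntegrand x t (c + y * Complex.I) =
        Complex.exp (a * t * Complex.I) * kernel t (c + y * Complex.I) *
          ((x : ℂ) ^ (-(c + y * Complex.I)) / (c + y * Complex.I)) := fun t => by
      rw [weightIntegrand]; ring
    simp_rw [e2]
    rw [← intervalIntegral.integral_of_le hT, intervalIntegral.integral_mul_const, norm_mul, norm_div,
      Complex.norm_cpow_eq_rpow_re_of_pos hx, Complex.neg_re, hre]
    have h3 := abs_le_norm_add_mul_I c y
    rw [abs_of_pos hc] at h3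
    calc _ ≤ C * (T ^ (2 * c) / c) / |a| * Real.exp (-y ^ 2 / 2) * (x ^ (-c) / c) := by gcongr
      _ = _ := by field_simp
  refine (norm_integral_le_of_norm_le (integrable_gauss.const_mul _)
    (Eventually.of_forall hin)).trans ?_
  rw [integral_const_mul, ← gaussMass]
  have h3 : 0 ≤ C * (T ^ (2 * c) * x ^ (-c) / c ^ 2) / |a| := by positivity
  calc _ ≤ C * (T ^ (2 * c) * x ^ (-c) / c ^ 2) / |a| * (gaussMass + 1) := by gcongr; linarith
    _ = _ := by ring

theorem hasSum_divisorFun_mul_cpow {z : ℂ} (hz : 1 < z.re) :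
    HasSum (fun n : ℕ => (divisorFun 2 n : ℂ) * (n : ℂ) ^ (-z)) (riemannZeta z ^ 2) := by
  have h1 : LSeriesSummable (fun n => ((ArithmeticFunction.zeta : ArithmeticFunction ℂ) n)) z := by
    simpa using ArithmeticFunction.LSeriesSummable_zeta_iff.2 hz
  have h2 := ArithmeticFunction.LSeriesSummable_mul h1 h1
  have h3 := ArithmeticFunction.LSeries_mul' h1 h1
  have h4 : LSeries (fun n => ((ArithmeticFunction.zeta : ArithmeticFunction ℂ) n)) z
      = riemannZeta z := by
    simpa using ArithmeticFunction.LSeries_zeta_eq_riemannZeta hz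
  rw [h4] at h3
  rw [sq, ← h3]
  have h5 := h2.LSeriesHasSum
  unfold LSeriesHasSum at h5
  convert h5 using 1
  ext n
  rcases eq_or_ne n 0 with rfl | hn
  · simp
  · rw [LSeries.term_of_ne_zero hn, Complex.cpow_neg, div_eq_mul_inv]
    congr 1
    rw [divisorFun_two_apply, ArithmeticFunction.coe_zeta_mul_apply]
    have : ∀ i ∈ n.divisors, ((ArithmeticFunction.zeta : ArithmeticFunction ℂ) i) = 1 := by
      intro i hi
      have : i ≠ 0 := (Nat.pos_of_mem_divisors hi).ne'
      simp [ArithmeticFunction.zeta_apply, this]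
    rw [Finset.sum_congr rfl this]
    simp

theorem norm_divisorFun_mul_cpow (n : ℕ) {z : ℂ} (hz : z.re ≠ 0) :
    ‖(divisorFun 2 n : ℂ) * (n : ℂ) ^ (-z)‖ = divisorFun 2 n * (n : ℝ) ^ (-z.re) := by
  rw [norm_mul, Complex.norm_real, Real.norm_of_nonneg (divisorFun_nonneg 2 n),
    Complex.norm_natCast_cpow_of_re_ne_zero n (by simpa using hz)]
  simp

theorem summable_divisorFun_mul_rpow {r : ℝ} (hr : 1 < r) :
    Summable fun n : ℕ => divisorFun 2 n * (n : ℝ) ^ (-r) := by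
  have h := (hasSum_divisorFun_mul_cpow (z := r) (by simpa using hr)).summable.norm
  refine h.congr fun n => ?_
  rw [norm_divisorFun_mul_cpow n (by simp; linarith)]
  simp

/-- The coefficient of the pair `(m, n)` in the double Dirichlet series. -/
noncomputable def pairCoef (p : ℕ × ℕ) : ℝ :=
  divisorFun 2 p.1 * divisorFun 2 p.2 / √((p.1 : ℝ) * p.2)

theorem pairCoef_nonneg (p : ℕ × ℕ) : 0 ≤ pairCoef p :=
  div_nonneg (mul_nonneg (divisorFun_nonneg 2 _) (divisorFun_nonneg 2 _)) (Real.sqrt_nonneg _)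

theorem summable_pairCoef_div : Summable fun p : ℕ × ℕ => pairCoef p / ((p.1 : ℝ) * p.2) := by
  have h := summable_divisorFun_mul_rpow (r := 3 / 2) (by norm_num)
  refine (h.mul_of_nonneg h (fun n => ?_) (fun n => ?_)).congr fun p => ?_
  · exact mul_nonneg (divisorFun_nonneg 2 _) (Real.rpow_nonneg (Nat.cast_nonneg _) _)
  · exact mul_nonneg (divisorFun_nonneg 2 _) (Real.rpow_nonneg (Nat.cast_nonneg _) _)
  · have e : ∀ x : ℝ, 0 ≤ x → x ^ (-(3 / 2) : ℝ) = (√x)⁻¹ * x⁻¹ := by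
      intro x hx
      rcases hx.eq_or_lt with rfl | hx
      · norm_num
      rw [Real.sqrt_eq_rpow, ← Real.rpow_neg hx.le, ← Real.rpow_neg_one x, ← Real.rpow_add hx]
      norm_num
    simp only [pairCoef]
    rw [e _ (Nat.cast_nonneg _), e _ (Nat.cast_nonneg _), Real.sqrt_mul (Nat.cast_nonneg _)]
    simp only [div_eq_mul_inv, mul_inv]
    ring

theorem pairCoef_eq_zero {p : ℕ × ℕ} (h : ¬ (1 ≤ p.1 ∧ 1 ≤ p.2)) : pairCoef p = 0 := by
  unfold pairCoef
  have : p.1 = 0 ∨ p.2 = 0 := by omega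
  rcases this with h | h <;> simp [h]

/-- The term of the double series at height `t`, on the line of integration. -/
theorem term_eq {m n : ℕ} (hm : 1 ≤ m) (hn : 1 ≤ n) (t : ℝ) (w : ℂ) :
    (divisorFun 2 m : ℂ) * (m : ℂ) ^ (-(1 / 2 + t * Complex.I + w)) *
      ((divisorFun 2 n : ℂ) * (n : ℂ) ^ (-(1 / 2 - t * Complex.I + w))) =
    (pairCoef (m, n) : ℂ) * (Complex.exp (((Real.log n - Real.log m : ℝ) : ℂ) * t * Complex.I) *
      (((m : ℝ) * n : ℝ) : ℂ) ^ (-w)) := by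
  have hm0 : (0 : ℝ) < m := by exact_mod_cast hm
  have hn0 : (0 : ℝ) < n := by exact_mod_cast hn
  have hmc : (m : ℂ) ≠ 0 := by exact_mod_cast hm0.ne'
  have hnc : (n : ℂ) ≠ 0 := by exact_mod_cast hn0.ne'
  have hs : ((√((m : ℝ) * n) : ℝ) : ℂ)⁻¹ = (m : ℂ) ^ (-(1 / 2) : ℂ) * (n : ℂ) ^ (-(1 / 2) : ℂ) := by
    rw [← Complex.ofReal_natCast, ← Complex.ofReal_natCast n, ← Complex.mul_cpow_ofReal_nonneg hm0.le hn0.le, Real.sqrt_eq_rpow,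
      Complex.cpow_neg, ← Complex.ofReal_mul, Complex.ofReal_cpow (by positivity)]
    norm_num
  have hx : (((m : ℝ) * n : ℝ) : ℂ) ^ (-w) = (m : ℂ) ^ (-w) * (n : ℂ) ^ (-w) := by
    rw [Complex.ofReal_mul, Complex.mul_cpow_ofReal_nonneg hm0.le hn0.le]
    simp
  have he : Complex.exp (((Real.log n - Real.log m : ℝ) : ℂ) * t * Complex.I)
      = (m : ℂ) ^ (-(t * Complex.I)) * (n : ℂ) ^ (t * Complex.I) := by
    rw [Complex.cpow_def_of_ne_zero hmc, Complex.cpow_def_of_ne_zero hnc, ← Complex.exp_add]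
    congr 1
    rw [← Complex.ofReal_natCast, ← Complex.ofReal_natCast n, ← Complex.ofReal_log hm0.le, ← Complex.ofReal_log hn0.le]
    push_cast
    ring
  have e1 : (-(1 / 2 + t * Complex.I + w) : ℂ) = -(1 / 2) + -(t * Complex.I) + -w := by ring
  have e2 : (-(1 / 2 - t * Complex.I + w) : ℂ) = -(1 / 2) + (t * Complex.I) + -w := by ring
  rw [he, hx, e1, e2, Complex.cpow_add _ _ hmc, Complex.cpow_add _ _ hmc, Complex.cpow_add _ _ hnc,
    Complex.cpow_add _ _ hnc]
  have hp : ((pairCoef (m, n) : ℝ) : ℂ) = (divisorFun 2 m : ℂ) * divisorFun 2 n *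
      ((m : ℂ) ^ (-(1 / 2) : ℂ) * (n : ℂ) ^ (-(1 / 2) : ℂ)) := by
    rw [← hs]
    simp only [pairCoef]
    rw [div_eq_mul_inv]
    push_cast
    rfl
  rw [hp]
  ring

theorem hasSum_mul_of_hasSum {f g : ℕ → ℂ} {a b : ℂ} (hf : HasSum f a) (hg : HasSum g b) :
    HasSum (fun p : ℕ × ℕ => f p.1 * g p.2) (a * b) :=
  hf.mul hg (summable_mul_of_summable_norm hf.summable.norm hg.summable.norm)

theorem hasSum_zeta_sq_mul_zeta_sq {t : ℝ} {w : ℂ} (hw : w.re = 1) :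
    HasSum (fun p : ℕ × ℕ => (pairCoef p : ℂ) *
      (Complex.exp (((Real.log p.2 - Real.log p.1 : ℝ) : ℂ) * t * Complex.I) *
      (((p.1 : ℝ) * p.2 : ℝ) : ℂ) ^ (-w)))
      (riemannZeta (1 / 2 + t * Complex.I + w) ^ 2 *
        riemannZeta (1 / 2 - t * Complex.I + w) ^ 2) := by
  have r1 : (1 / 2 + t * Complex.I + w : ℂ).re = 3 / 2 := by simp [hw]; norm_num
  have r2 : (1 / 2 - t * Complex.I + w : ℂ).re = 3 / 2 := by simp [hw]; norm_num
  have h1 := hasSum_divisorFun_mul_cpow (z := 1 / 2 + t * Complex.I + w) (by rw [r1]; norm_num)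
  have h2 := hasSum_divisorFun_mul_cpow (z := 1 / 2 - t * Complex.I + w) (by rw [r2]; norm_num)
  convert hasSum_mul_of_hasSum h1 h2 using 1
  ext p
  by_cases hp : 1 ≤ p.1 ∧ 1 ≤ p.2
  · exact (term_eq hp.1 hp.2 t w).symm
  · rw [pairCoef_eq_zero hp]
    have : p.1 = 0 ∨ p.2 = 0 := by omega
    rcases this with h | h <;> simp [h]

/-- The integrand of the contribution of a pair to the fourth power of the zeta function. -/
noncomputable def pairIntegrand (t : ℝ) (p : ℕ × ℕ) (y : ℝ) : ℂ :=
  (pairCoef p : ℂ) * (Complex.exp (((Real.log p.2 - Real.log p.1 : ℝ) : ℂ) * t * Complex.I) *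
    weightIntegrand ((p.1 : ℝ) * p.2) t (((1 : ℝ) : ℂ) + y * Complex.I))

/-- The contribution of a pair to the fourth power of the zeta function. -/
noncomputable def pairTerm (t : ℝ) (p : ℕ × ℕ) : ℂ :=
  (pairCoef p : ℂ) * (Complex.exp (((Real.log p.2 - Real.log p.1 : ℝ) : ℂ) * t * Complex.I) *
    weightOn 1 ((p.1 : ℝ) * p.2) t)

theorem integral_pairIntegrand (t : ℝ) (p : ℕ × ℕ) :
    ∫ y, pairIntegrand t p y = pairTerm t p := by
  unfold pairIntegrand pairTerm weightOn
  rw [integral_const_mul, integral_const_mul]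

theorem exists_norm_pairIntegrand_le : ∃ C : ℝ, 0 < C ∧ ∀ t : ℝ, 1 ≤ t → ∀ p : ℕ × ℕ, ∀ y : ℝ,
    ‖pairIntegrand t p y‖ ≤
      C * t ^ 2 * (pairCoef p / ((p.1 : ℝ) * p.2)) * Real.exp (-y ^ 2 / 2) := by
  obtain ⟨C, hC, h⟩ := exists_norm_weightIntegrand_le
  refine ⟨C, hC, fun t ht p y => ?_⟩
  by_cases hp : 1 ≤ p.1 ∧ 1 ≤ p.2
  · have h1 : (0 : ℝ) < p.1 := by exact_mod_cast hp.1
    have h2 : (0 : ℝ) < p.2 := by exact_mod_cast hp.2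
    have h3 := h t ht _ (mul_pos h1 h2) 1 (by norm_num) le_rfl one_ne_zero y
    unfold pairIntegrand
    rw [norm_mul, norm_mul, norm_exp_mul_I, one_mul, Complex.norm_real,
      Real.norm_of_nonneg (pairCoef_nonneg p)]
    refine (mul_le_mul_of_nonneg_left h3 (pairCoef_nonneg p)).trans_eq ?_
    rw [Real.rpow_neg_one]
    norm_num
    ring
  · simp [pairIntegrand, pairCoef_eq_zero hp]

theorem integrable_pairIntegrand {t : ℝ} (ht : 1 ≤ t) (p : ℕ × ℕ) :
    Integrable (pairIntegrand t p) := by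
  obtain ⟨C, hC, h⟩ := exists_norm_pairIntegrand_le
  refine Integrable.mono' (integrable_gauss.const_mul
    (C * t ^ 2 * (pairCoef p / ((p.1 : ℝ) * p.2)))) ?_ (Eventually.of_forall fun y => h t ht p y)
  by_cases hp : 1 ≤ p.1 ∧ 1 ≤ p.2
  · have h1 : (0 : ℝ) < p.1 := by exact_mod_cast hp.1
    have h2 : (0 : ℝ) < p.2 := by exact_mod_cast hp.2
    have hc := (continuous_weightIntegrand (mul_pos h1 h2) (c := 1) (by norm_num) one_ne_zero).comp
      (Continuous.prodMk (continuous_const (y := t)) continuous_id)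
    exact (continuous_const.mul (continuous_const.mul hc)).aestronglyMeasurable
  · have : pairIntegrand t p = fun _ => 0 := by
      ext y; simp [pairIntegrand, pairCoef_eq_zero hp]
    rw [this]
    exact aestronglyMeasurable_const

theorem hasSum_pairTerm {t : ℝ} (ht : 1 ≤ t) :
    HasSum (pairTerm t) (π * ((‖riemannZeta (1 / 2 + t * Complex.I)‖ ^ 4 : ℝ) : ℂ)) := by
  obtain ⟨C, hC, h⟩ := exists_norm_pairIntegrand_le
  have hs : Summable fun p => ∫ y, ‖pairIntegrand t p y‖ := by
    refine Summable.of_nonneg_of_le (fun p => integral_nonneg fun _ => norm_nonneg _) (fun p => ?_)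
      ((summable_pairCoef_div.mul_left (C * t ^ 2)).mul_right gaussMass)
    unfold gaussMass
    rw [← integral_const_mul]
    exact integral_mono (integrable_pairIntegrand ht p).norm (integrable_gauss.const_mul _)
      fun y => h t ht p y
  have h1 := hasSum_integral_of_summable_integral_norm (integrable_pairIntegrand ht) hs
  simp only [integral_pairIntegrand] at h1
  suffices h3 : (π * ((‖riemannZeta (1 / 2 + t * Complex.I)‖ ^ 4 : ℝ) : ℂ)) =
      ∫ y, ∑' p, pairIntegrand t p y by
    rw [h3]; exact h1
  rw [← integral_kernel_mul_zeta ht]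
  congr 1
  ext y
  have h2 := (hasSum_zeta_sq_mul_zeta_sq (t := t) (w := 1 + y * Complex.I) (by simp)).mul_left
    (kernel t (1 + y * Complex.I) / (1 + y * Complex.I))
  rw [← h2.tsum_eq]
  refine tsum_congr fun p => ?_
  unfold pairIntegrand weightIntegrand
  rw [Complex.ofReal_one]
  ring

theorem exists_norm_pairTerm_le : ∃ C : ℝ, 0 < C ∧ ∀ t : ℝ, 1 ≤ t → ∀ p : ℕ × ℕ,
    ‖pairTerm t p‖ ≤ C * t ^ 2 * (pairCoef p / ((p.1 : ℝ) * p.2)) := by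
  obtain ⟨C, hC, h⟩ := exists_norm_weightOn_le
  refine ⟨C, hC, fun t ht p => ?_⟩
  by_cases hp : 1 ≤ p.1 ∧ 1 ≤ p.2
  · have h1 : (0 : ℝ) < p.1 := by exact_mod_cast hp.1
    have h2 : (0 : ℝ) < p.2 := by exact_mod_cast hp.2
    have h3 := h t ht _ (mul_pos h1 h2) 1 (by norm_num) le_rfl one_ne_zero
    unfold pairTerm
    rw [norm_mul, norm_mul, norm_exp_mul_I, one_mul, Complex.norm_real,
      Real.norm_of_nonneg (pairCoef_nonneg p)]
    refine (mul_le_mul_of_nonneg_left h3 (pairCoef_nonneg p)).trans_eq ?_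
    rw [Real.rpow_neg_one]
    norm_num
    ring
  · simp [pairTerm, pairCoef_eq_zero hp]

theorem stronglyMeasurable_weightOn {x c : ℝ} (hx : 0 < x) (hc : -1 / 4 ≤ c) (hc0 : c ≠ 0) :
    StronglyMeasurable fun t => weightOn c x t :=
  (continuous_weightIntegrand hx hc hc0).stronglyMeasurable.integral_prod_right'

theorem stronglyMeasurable_pairTerm (p : ℕ × ℕ) : StronglyMeasurable fun t => pairTerm t p := by
  by_cases hp : 1 ≤ p.1 ∧ 1 ≤ p.2
  · have h1 : (0 : ℝ) < p.1 := by exact_mod_cast hp.1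
    have h2 : (0 : ℝ) < p.2 := by exact_mod_cast hp.2
    refine stronglyMeasurable_const.mul (StronglyMeasurable.mul ?_
      (stronglyMeasurable_weightOn (mul_pos h1 h2) (by norm_num) one_ne_zero))
    exact Continuous.stronglyMeasurable (by fun_prop)
  · have : (fun t => pairTerm t p) = fun _ => 0 := by
      ext y; simp [pairTerm, pairCoef_eq_zero hp]
    rw [this]
    exact stronglyMeasurable_const

theorem hasSum_oscIntegral {T : ℝ} (hT : 1 ≤ T) :
    HasSum (fun p : ℕ × ℕ => (pairCoef p : ℂ) *
      oscIntegral T ((p.1 : ℝ) * p.2) (Real.log p.2 - Real.log p.1))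
      (π * ((∫ t in (1 : ℝ)..T, ‖riemannZeta (1 / 2 + t * Complex.I)‖ ^ 4 : ℝ) : ℂ)) := by
  obtain ⟨C, hC, h⟩ := exists_norm_pairTerm_le
  have hb : ∀ p : ℕ × ℕ, ∀ t ∈ Set.Ioc 1 T, ‖pairTerm t p‖ ≤
      C * T ^ 2 * (pairCoef p / ((p.1 : ℝ) * p.2)) := fun p t ht => by
    refine (h t ht.1.le p).trans ?_
    have := pairCoef_nonneg p
    have h1 := ht.1
    have h2 := ht.2
    gcongr
  have hi : ∀ p, Integrable (fun t => pairTerm t p) (volume.restrict (Set.Ioc 1 T)) := fun p =>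
    Integrable.of_bound (stronglyMeasurable_pairTerm p).aestronglyMeasurable _
      ((ae_restrict_iff' measurableSet_Ioc).2 (Eventually.of_forall (hb p)))
  have hs : Summable fun p => ∫ t in Set.Ioc 1 T, ‖pairTerm t p‖ := by
    refine Summable.of_nonneg_of_le (fun p => integral_nonneg fun _ => norm_nonneg _) (fun p => ?_)
      ((summable_pairCoef_div.mul_left (C * T ^ 2)).mul_left (T - 1))
    have h1 := setIntegral_mono_on (hi p).norm (integrable_const
      (C * T ^ 2 * (pairCoef p / ((p.1 : ℝ) * p.2)))) measurableSet_Ioc (hb p)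
    refine h1.trans_eq ?_
    rw [setIntegral_const]
    simp [hT, Measure.real]
  have h1 := hasSum_integral_of_summable_integral_norm hi hs
  have e1 : (fun p : ℕ × ℕ => (pairCoef p : ℂ) *
      oscIntegral T ((p.1 : ℝ) * p.2) (Real.log p.2 - Real.log p.1)) =
      fun p => ∫ t in Set.Ioc 1 T, pairTerm t p := by
    ext p
    unfold oscIntegral pairTerm
    rw [intervalIntegral.integral_of_le hT, integral_const_mul]
  have e2 : (π * ((∫ t in (1 : ℝ)..T, ‖riemannZeta (1 / 2 + t * Complex.I)‖ ^ 4 : ℝ) : ℂ)) =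
      ∫ t in Set.Ioc 1 T, ∑' p, pairTerm t p := by
    rw [intervalIntegral.integral_of_le hT, ← integral_complex_ofReal, ← integral_const_mul]
    refine setIntegral_congr_fun measurableSet_Ioc fun t ht => ?_
    exact (hasSum_pairTerm ht.1.le).tsum_eq.symm
  rw [e1, e2]
  exact h1

theorem exists_norm_pairCoef_mul_oscIntegral_le : ∃ C : ℝ, 0 < C ∧ ∀ T : ℝ, 1 ≤ T →
    ∀ p : ℕ × ℕ, 1 ≤ p.1 → 1 ≤ p.2 → p.1 ≠ p.2 →
    ‖(pairCoef p : ℂ) * oscIntegral T ((p.1 : ℝ) * p.2) (Real.log p.2 - Real.log p.1)‖ ≤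
      C * pairBound T p := by
  obtain ⟨C, hC, h⟩ := exists_norm_oscIntegral_le_of_line
  refine ⟨16 * C, by positivity, fun T hT p h1 h2 hne => ?_⟩
  have p1 : (0 : ℝ) < p.1 := by exact_mod_cast h1
  have p2 : (0 : ℝ) < p.2 := by exact_mod_cast h2
  have hT0 : 0 < T := by linarith
  have ha : Real.log p.2 - Real.log p.1 ≠ 0 := fun hz => hne <| by
    have := Real.log_injOn_pos (Set.mem_Ioi.2 p2) (Set.mem_Ioi.2 p1) (sub_eq_zero.1 hz)
    exact_mod_cast this.symm
  have hx := mul_pos p1 p2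
  have b1 := h T hT _ ha _ hx (1 / 4) (by norm_num) (by norm_num)
  have b2 := h T hT _ ha _ hx 1 (by norm_num) le_rfl
  generalize hxx : (p.1 : ℝ) * p.2 = x at *
  generalize haa : Real.log p.2 - Real.log p.1 = a at *
  have e1 : C * (T ^ (2 * (1 / 4) : ℝ) * x ^ (-(1 / 4) : ℝ) / (1 / 4) ^ 2) =
      16 * C * (T ^ 2 / x) ^ (1 / 4 : ℝ) := by
    rw [Real.div_rpow (by positivity) hx.le, Real.rpow_neg hx.le, ← Real.rpow_natCast T 2,
      ← Real.rpow_mul hT0.le]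
    norm_num
    ring
  have e2 : C * (T ^ (2 * 1 : ℝ) * x ^ (-1 : ℝ) / 1 ^ 2) ≤ 16 * C * (T ^ 2 / x) := by
    rw [Real.rpow_neg_one]
    have : T ^ (2 * 1 : ℝ) = T ^ 2 := by norm_num
    rw [this, div_eq_mul_inv (T ^ 2)]
    have : 0 ≤ C * (T ^ 2 * x⁻¹) := by positivity
    linarith
  have a0 : 0 < |a| := abs_pos.2 ha
  have b3 : ‖oscIntegral T x a‖ ≤ 16 * C * decay T x / |a| := by
    unfold decay
    rw [mul_min_of_nonneg _ _ (by positivity), le_div_iff₀ a0, le_min_iff, ← le_div_iff₀ a0,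
      ← le_div_iff₀ a0]
    rw [e1] at b1
    exact ⟨b1, b2.trans (by gcongr)⟩
  rw [norm_mul, Complex.norm_real, Real.norm_of_nonneg (pairCoef_nonneg p)]
  refine (mul_le_mul_of_nonneg_left b3 (pairCoef_nonneg p)).trans_eq ?_
  unfold pairBound pairCoef
  rw [hxx, haa]
  ring

theorem exists_norm_oscIntegral_zero_le : ∃ C : ℝ, 0 < C ∧ ∀ T : ℝ, 1 ≤ T → ∀ x : ℝ, 0 < x →
    ‖oscIntegral T x 0‖ ≤ C * (T ^ 3 / x) := by
  obtain ⟨C, hC, h⟩ := exists_norm_weightOn_le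
  refine ⟨C, hC, fun T hT x hx => ?_⟩
  unfold oscIntegral
  refine (intervalIntegral.norm_integral_le_of_norm_le_const (C := C * (T ^ 2 / x))
    fun t ht => ?_).trans ?_
  · rw [Set.uIoc_of_le hT] at ht
    have := h t ht.1.le x hx 1 (by norm_num) le_rfl one_ne_zero
    rw [norm_mul, norm_exp_mul_I, one_mul]
    refine this.trans ?_
    rw [Real.rpow_neg_one, abs_one, div_one, div_eq_mul_inv]
    have e : t ^ (2 * 1 : ℝ) = t ^ 2 := by norm_num
    rw [e]
    have h1 := ht.1
    have h2 := ht.2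
    gcongr
  · rw [abs_of_nonneg (by linarith), mul_assoc]
    refine mul_le_mul_of_nonneg_left ?_ hC.le
    calc T ^ 2 / x * (T - 1) ≤ T ^ 2 / x * T := by gcongr; linarith
      _ = T ^ 3 / x := by ring

theorem exists_norm_oscIntegral_zero_sub_le : ∃ C : ℝ, 0 < C ∧ ∀ T : ℝ, 1 ≤ T → ∀ n : ℕ, 1 ≤ n →
    ‖oscIntegral T ((n : ℝ) * n) 0 - 2 * π * (T - 1)‖ ≤ C * √(n * T) := by
  obtain ⟨C, hC, h⟩ := exists_norm_weightOn_le
  refine ⟨8 * C, by positivity, fun T hT n hn => ?_⟩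
  have hn0 : (0 : ℝ) < n := by exact_mod_cast hn
  have hx : (0 : ℝ) < (n : ℝ) * n := mul_pos hn0 hn0
  have hT0 : 0 < T := by linarith
  have hx4 : ((n : ℝ) * n) ^ (1 / 4 : ℝ) = √n := by
    rw [← sq, ← Real.rpow_natCast, ← Real.rpow_mul hn0.le, Real.sqrt_eq_rpow]
    norm_num
  have hb : ∀ t ∈ Set.Ioc 1 T, ‖weightOn (-(1 / 4)) ((n : ℝ) * n) t‖ ≤
      4 * C * √n * t ^ (-(1 / 2) : ℝ) := fun t ht => by
    have := h t ht.1.le _ hx (-(1 / 4)) (by norm_num) (by norm_num) (by norm_num)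
    refine this.trans_eq ?_
    rw [neg_neg, hx4]
    norm_num
    ring
  have hg : IntervalIntegrable (fun t : ℝ => 4 * C * √n * t ^ (-(1 / 2) : ℝ)) volume 1 T :=
    (intervalIntegral.intervalIntegrable_rpow' (by norm_num)).const_mul _
  have hw : IntervalIntegrable (fun t : ℝ => weightOn (-(1 / 4)) ((n : ℝ) * n) t) volume 1 T := by
    refine hg.mono_fun' ?_ ?_
    · exact (stronglyMeasurable_weightOn hx (by norm_num) (by norm_num)).aestronglyMeasurable
    · rw [Set.uIoc_of_le hT]
      exact (ae_restrict_iff' measurableSet_Ioc).2 (Eventually.of_forall hb)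
  have e : oscIntegral T ((n : ℝ) * n) 0 =
      2 * π * (T - 1) + ∫ t in (1 : ℝ)..T, weightOn (-(1 / 4)) ((n : ℝ) * n) t := by
    have e1 : oscIntegral T ((n : ℝ) * n) 0 = ∫ t in (1 : ℝ)..T,
        ((2 * π : ℂ) + weightOn (-(1 / 4)) ((n : ℝ) * n) t) := by
      unfold oscIntegral
      refine intervalIntegral.integral_congr fun t ht => ?_
      rw [Set.uIcc_of_le hT] at ht
      have := weightOn_one_sub ht.1 hx
      simp only [Complex.ofReal_zero, zero_mul, Complex.exp_zero, one_mul]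
      rw [← this]
      ring
    rw [e1, intervalIntegral.integral_add (by simp) hw, intervalIntegral.integral_const]
    simp
    ring
  rw [e, add_sub_cancel_left]
  refine (intervalIntegral.norm_integral_le_of_norm_le hT
    (Eventually.of_forall hb) hg).trans ?_
  rw [intervalIntegral.integral_const_mul, integral_rpow (Or.inl (by norm_num)),
    Real.sqrt_mul hn0.le, Real.sqrt_eq_rpow T]
  norm_num
  have : 0 ≤ C * √n := by positivity
  nlinarith


theorem pairCoef_self (n : ℕ) : pairCoef (n, n) = divisorSq n / n := by
  unfold pairCoef
  rw [divisorSq_apply, Real.sqrt_mul_self (Nat.cast_nonneg _)]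
  ring

theorem exists_norm_diagonal_sub_le : ∃ C : ℝ, 0 < C ∧ ∀ T : ℝ, 1 ≤ T → ∀ n : ℕ, 1 ≤ n →
    ‖(pairCoef (n, n) : ℂ) * oscIntegral T ((n : ℝ) * n) 0 -
      ((if n ≤ ⌊T⌋₊ then 2 * π * (T - 1) * (divisorSq n / n) else 0 : ℝ) : ℂ)‖ ≤
      C * (divisorSq n * cutoff T n) := by
  obtain ⟨C₁, hC₁, h₁⟩ := exists_norm_oscIntegral_zero_le
  obtain ⟨C₂, hC₂, h₂⟩ := exists_norm_oscIntegral_zero_sub_le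
  refine ⟨C₁ + C₂, by positivity, fun T hT n hn => ?_⟩
  have hn0 : (0 : ℝ) < n := by exact_mod_cast hn
  have hT0 : 0 < T := by linarith
  have hd : 0 ≤ divisorSq n := by rw [divisorSq_apply]; positivity
  have hc : 0 ≤ cutoff T n := cutoff_nonneg hT0.le hn0.le
  rw [pairCoef_self]
  by_cases hnT : n ≤ ⌊T⌋₊
  · rw [if_pos hnT]
    have hnT' : (n : ℝ) ≤ T := (Nat.le_floor_iff hT0.le).1 hnT
    have hq : 1 ≤ T / n := (one_le_div hn0).2 hnT'
    have hb : √(n * T) / n ≤ cutoff T n := by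
      have e : √(n * T) / n = (T / n) ^ (1 / 2 : ℝ) := by
        rw [← Real.sqrt_eq_rpow, div_eq_iff hn0.ne', Real.sqrt_eq_iff_mul_self_eq (by positivity)
          (by positivity)]
        have := Real.mul_self_sqrt (show 0 ≤ T / n by positivity)
        symm
        calc √(T / n) * n * (√(T / n) * n) = (√(T / n) * √(T / n)) * n * n := by ring
          _ = n * T := by rw [this]; field_simp
      rw [e]
      exact le_min (Real.rpow_le_rpow_of_exponent_le hq (by norm_num))
        (Real.rpow_le_rpow_of_exponent_le hq (by norm_num))
    have e : ((divisorSq n / n : ℝ) : ℂ) * oscIntegral T ((n : ℝ) * n) 0 -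
        ((2 * π * (T - 1) * (divisorSq n / n) : ℝ) : ℂ) =
        ((divisorSq n / n : ℝ) : ℂ) * (oscIntegral T ((n : ℝ) * n) 0 - 2 * π * (T - 1)) := by
      push_cast; ring
    rw [e, norm_mul, Complex.norm_real, Real.norm_of_nonneg (by positivity)]
    calc divisorSq n / n * ‖oscIntegral T ((n : ℝ) * n) 0 - 2 * π * (T - 1)‖
        ≤ divisorSq n / n * (C₂ * √(n * T)) := by gcongr; exact h₂ T hT n hn
      _ = C₂ * (divisorSq n * (√(n * T) / n)) := by ring
      _ ≤ C₂ * (divisorSq n * cutoff T n) := by gcongr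
      _ ≤ (C₁ + C₂) * (divisorSq n * cutoff T n) := by gcongr; linarith
  · rw [if_neg hnT]
    have hnT' : T < n := (Nat.floor_lt hT0.le).1 (not_le.1 hnT)
    have hq : T / n ≤ 1 := (div_le_one hn0).2 hnT'.le
    have hq0 : 0 < T / n := by positivity
    have hb : T ^ 3 / ((n : ℝ) * n) / n ≤ cutoff T n := by
      have e : T ^ 3 / ((n : ℝ) * n) / n = (T / n) ^ (3 : ℝ) := by
        have : (T / n) ^ (3 : ℝ) = (T / n) ^ 3 := by norm_cast
        rw [this]
        field_simp
      rw [e]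
      exact le_min (Real.rpow_le_rpow_of_exponent_ge hq0 hq (by norm_num))
        (Real.rpow_le_rpow_of_exponent_ge hq0 hq (by norm_num))
    rw [Complex.ofReal_zero, sub_zero, norm_mul, Complex.norm_real,
      Real.norm_of_nonneg (by positivity)]
    calc divisorSq n / n * ‖oscIntegral T ((n : ℝ) * n) 0‖
        ≤ divisorSq n / n * (C₁ * (T ^ 3 / ((n : ℝ) * n))) := by
          gcongr; exact h₁ T hT _ (mul_pos hn0 hn0)
      _ = C₁ * (divisorSq n * (T ^ 3 / ((n : ℝ) * n) / n)) := by ring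
      _ ≤ C₁ * (divisorSq n * cutoff T n) := by gcongr
      _ ≤ (C₁ + C₂) * (divisorSq n * cutoff T n) := by gcongr; linarith

theorem exists_abs_fourth_moment_sub_le : ∃ C : ℝ, 0 < C ∧ ∀ T : ℝ, 1 ≤ T →
    |π * (∫ t in (1 : ℝ)..T, ‖riemannZeta (1 / 2 + t * Complex.I)‖ ^ 4) -
      2 * π * (T - 1) * ∑ n ∈ Finset.Ioc 0 ⌊T⌋₊, divisorSq n / n| ≤
      C * (T * (1 + Real.log T) ^ 3) := by
  obtain ⟨C₁, hC₁, h₁⟩ := exists_norm_pairCoef_mul_oscIntegral_le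
  obtain ⟨C₂, hC₂, h₂⟩ := exists_norm_diagonal_sub_le
  refine ⟨C₁ * 10000000 + C₂ * 41484, by positivity, fun T hT => ?_⟩
  set f : ℕ × ℕ → ℂ := fun p => (pairCoef p : ℂ) *
      oscIntegral T ((p.1 : ℝ) * p.2) (Real.log p.2 - Real.log p.1) with hf
  have hsum : HasSum f _ := hasSum_oscIntegral hT
  set I := ∫ t in (1 : ℝ)..T, ‖riemannZeta (1 / 2 + t * Complex.I)‖ ^ 4
  set S := ∑ n ∈ Finset.Ioc 0 ⌊T⌋₊, divisorSq n / n with hS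
  have hlim : Tendsto (fun M : ℕ => ∑ p ∈ Finset.range (M + 1) ×ˢ Finset.range (M + 1), f p) atTop
      (nhds (π * (I : ℂ))) := by
    refine hsum.comp (tendsto_atTop_finset_of_monotone (fun a b hab => ?_) fun p => ?_)
    · exact Finset.product_subset_product (Finset.range_mono (by omega))
        (Finset.range_mono (by omega))
    · exact ⟨p.1 + p.2, by simp⟩
  have hlim2 := (hlim.sub_const ((2 * π * (T - 1) * S : ℝ) : ℂ)).norm
  have hfin : ‖π * (I : ℂ) - ((2 * π * (T - 1) * S : ℝ) : ℂ)‖ ≤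
      (C₁ * 10000000 + C₂ * 41484) * (T * (1 + Real.log T) ^ 3) := by
    refine le_of_tendsto hlim2 ?_
    filter_upwards [eventually_ge_atTop ⌊T⌋₊] with M hM
    have e1 : ∑ p ∈ Finset.range (M + 1) ×ˢ Finset.range (M + 1), f p =
        ∑ p ∈ Finset.Icc 1 M ×ˢ Finset.Icc 1 M, f p := by
      symm
      refine Finset.sum_subset (fun p hp => ?_) fun p hp hp' => ?_
      · simp only [Finset.mem_product, Finset.mem_Icc, Finset.mem_range] at hp ⊢
        omega
      · simp only [Finset.mem_product, Finset.mem_Icc, Finset.mem_range] at hp hp'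
        simp only [hf]
        rw [pairCoef_eq_zero (by omega), Complex.ofReal_zero, zero_mul]
    have e2 : 2 * π * (T - 1) * S = ∑ n ∈ Finset.Icc 1 M,
        if n ≤ ⌊T⌋₊ then 2 * π * (T - 1) * (divisorSq n / n) else 0 := by
      rw [hS, Finset.mul_sum, ← Finset.sum_filter]
      refine Finset.sum_congr ?_ fun _ _ => rfl
      ext n
      simp only [Finset.mem_Ioc, Finset.mem_filter, Finset.mem_Icc]
      omega
    rw [e1, ← Finset.diag_union_offDiag, Finset.sum_union (Finset.disjoint_diag_offDiag _),
      Finset.sum_diag, e2, Complex.ofReal_sum, add_comm, add_sub_assoc, ← Finset.sum_sub_distrib]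
    have b1 : ‖∑ p ∈ (Finset.Icc 1 M).offDiag, f p‖ ≤
        C₁ * (10000000 * T * (1 + Real.log T) ^ 3) := by
      have hmem : ∀ p ∈ (Finset.Icc 1 M).offDiag, 1 ≤ p.1 ∧ 1 ≤ p.2 ∧ p.1 ≠ p.2 := fun p hp => by
        simp only [Finset.mem_offDiag, Finset.mem_Icc] at hp
        exact ⟨hp.1.1, hp.2.1.1, hp.2.2⟩
      refine (norm_sum_le_of_le _ (f := f) (n := fun p => C₁ * pairBound T p) fun p hp => ?_).trans ?_
      · obtain ⟨m1, m2, m3⟩ := hmem p hp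
        exact h₁ T hT p m1 m2 m3
      · rw [← Finset.mul_sum]
        exact mul_le_mul_of_nonneg_left (sum_pairBound_le hT _ hmem) hC₁.le
    have b2 : ‖∑ n ∈ Finset.Icc 1 M, (f (n, n) -
        ((if n ≤ ⌊T⌋₊ then 2 * π * (T - 1) * (divisorSq n / n) else 0 : ℝ) : ℂ))‖ ≤
        C₂ * (41484 * T * (1 + Real.log T) ^ 3) := by
      refine (norm_sum_le_of_le _ (n := fun n : ℕ => C₂ * (divisorSq n * cutoff T n))
        fun n hn => ?_).trans ?_
      · have := h₂ T hT n (Finset.mem_Icc.1 hn).1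
        simpa only [hf, sub_self] using this
      · rw [← Finset.mul_sum]
        exact mul_le_mul_of_nonneg_left (sum_divisorSq_mul_cutoff_le hT M) hC₂.le
    refine (norm_add_le _ _).trans ((add_le_add b1 b2).trans_eq ?_)
    ring
  rw [← Complex.ofReal_mul, ← Complex.ofReal_sub, Complex.norm_real] at hfin
  exact hfin

theorem exists_abs_fourth_moment_sub_main_le : ∃ C : ℝ, 0 < C ∧ ∀ T : ℝ, 1 ≤ T →
    |(∫ t in (1 : ℝ)..T, ‖riemannZeta (1 / 2 + t * Complex.I)‖ ^ 4) -
      (1 / (2 * π ^ 2)) * T * (Real.log T) ^ 4| ≤ C * (T * (1 + Real.log T) ^ 3) := by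
  obtain ⟨C₁, hC₁, h₁⟩ := exists_abs_fourth_moment_sub_le
  obtain ⟨C₂, hC₂, h₂⟩ := exists_abs_sum_divisorSq_div_sub_le
  refine ⟨C₁ + 2 * C₂ + 1, by positivity, fun T hT => ?_⟩
  have h1 := h₁ T hT
  have h2 := h₂ T hT
  set I := ∫ t in (1 : ℝ)..T, ‖riemannZeta (1 / 2 + t * Complex.I)‖ ^ 4
  set S := ∑ n ∈ Finset.Ioc 0 ⌊T⌋₊, divisorSq n / n
  have hL : 0 ≤ Real.log T := Real.log_nonneg hT
  have hLT : Real.log T ≤ T := (Real.log_le_sub_one_of_pos (by linarith)).trans (by linarith)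
  set L := Real.log T
  have hpi := Real.pi_gt_three
  have h4 : L ^ 4 ≤ T * (1 + L) ^ 3 := by
    calc L ^ 4 = L * L ^ 3 := by ring
      _ ≤ T * (1 + L) ^ 3 := by gcongr; linarith
  have a1 : |I - 2 * (T - 1) * S| ≤ C₁ * (T * (1 + L) ^ 3) := by
    have e : π * I - 2 * π * (T - 1) * S = π * (I - 2 * (T - 1) * S) := by ring
    rw [e, abs_mul, abs_of_pos Real.pi_pos] at h1
    nlinarith [abs_nonneg (I - 2 * (T - 1) * S)]
  have a2 : |2 * (T - 1) * (S - L ^ 4 / (4 * π ^ 2))| ≤ 2 * C₂ * (T * (1 + L) ^ 3) := by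
    rw [abs_mul, abs_of_nonneg (by linarith)]
    calc 2 * (T - 1) * |S - L ^ 4 / (4 * π ^ 2)| ≤ 2 * T * (C₂ * (1 + L) ^ 3) := by
          gcongr; linarith
      _ = 2 * C₂ * (T * (1 + L) ^ 3) := by ring
  have a3 : |2 * (L ^ 4 / (4 * π ^ 2))| ≤ T * (1 + L) ^ 3 := by
    rw [abs_of_nonneg (by positivity)]
    refine le_trans ?_ h4
    rw [mul_div_assoc', div_le_iff₀ (by positivity)]
    have hpi2 : 1 ≤ π ^ 2 := by nlinarith
    rw [mul_comm 2]
    exact mul_le_mul_of_nonneg_left (by linarith) (pow_nonneg hL 4)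
  have e : I - 1 / (2 * π ^ 2) * T * L ^ 4 = (I - 2 * (T - 1) * S) +
      2 * (T - 1) * (S - L ^ 4 / (4 * π ^ 2)) - 2 * (L ^ 4 / (4 * π ^ 2)) := by
    field_simp
    ring
  rw [e]
  have t1 := abs_sub (I - 2 * (T - 1) * S + 2 * (T - 1) * (S - L ^ 4 / (4 * π ^ 2)))
    (2 * (L ^ 4 / (4 * π ^ 2)))
  have t2 := abs_add_le (I - 2 * (T - 1) * S) (2 * (T - 1) * (S - L ^ 4 / (4 * π ^ 2)))
  linarith

end InghamFourthMoment

/-- Ingham's asymptotic formula for the fourth moment: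
`∫₁ᵀ |ζ(1/2+it)|⁴ dt = (1/(2π²)) T (log T)⁴ + O(T (log T)³)` as `T → ∞`. -/
theorem ingham_fourth_moment_asymptotic :
    ∃ C : ℝ, 0 < C ∧ ∀ᶠ T : ℝ in atTop,
      |(∫ t in (1:ℝ)..T, ‖riemannZeta (1/2 + t * Complex.I)‖ ^ 4) -
        (1 / (2 * Real.pi ^ 2)) * T * (Real.log T) ^ 4| ≤
        C * T * (Real.log T) ^ 3 := by
  obtain ⟨C, hC, h⟩ := InghamFourthMoment.exists_abs_fourth_moment_sub_main_le
  refine ⟨8 * C, by positivity, ?_⟩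
  filter_upwards [eventually_ge_atTop (Real.exp 1)] with T hT
  have hT1 : 1 ≤ T := (Real.one_le_exp zero_le_one).trans hT
  have hL : 1 ≤ Real.log T := (Real.le_log_iff_exp_le (by linarith)).2 hT
  refine (h T hT1).trans ?_
  calc C * (T * (1 + Real.log T) ^ 3) ≤ C * (T * (2 * Real.log T) ^ 3) := by gcongr; linarith
    _ = 8 * C * T * Real.log T ^ 3 := by ring
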